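/- Let d ≥ 5 and let P be a prime centrally symmetric simplicial d-polytope with g_2(P) = C(d,2) − d. Then for every vertex u of P: (1) the vertices u and −u have exactly 2d−2 common neighbors in the graph of ∂P (equivalently, st(u) and st(−u) share exactly 2d−2 vertices); and (2) the graph of st(u) ∪ st(−u) equals the graph of ∂P, i.e., every vertex w ∉ {u,−u} is adjacent to u or to −u, and for every edge e of ∂P either e ∪ {u} or e ∪ {−u} is a face of ∂P. -/

import Mathlib

open Finset
open scoped Classical

noncomputable section

/-- A finite graph: a finite vertex set together with a finite set of edges,
where each edge is (intended to be) a 2-element subset of the vertex set. -/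
structure FinGraph (ι : Type) where
  verts : Finset ι
  edges : Finset (Finset ι)

/-- Every edge is a 2-element subset of the vertex set. -/
def FinGraph.Good {ι : Type} (G : FinGraph ι) : Prop :=
  ∀ e ∈ G.edges, e ⊆ G.verts ∧ e.card = 2

/-- The standard inner (dot) product on `ℝ^d`. -/
def dotR {d : ℕ} (x y : Fin d → ℝ) : ℝ := ∑ i, x i * y i

/-- An infinitesimal motion of the framework `(G, p)`. -/
def IsMotion {ι : Type} {d : ℕ} (G : FinGraph ι) (p m : ι → Fin d → ℝ) : Prop :=
  ∀ e ∈ G.edges, ∀ u ∈ e, ∀ v ∈ e, dotR (p u - p v) (m u - m v) = 0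

/-- The framework `(G, p)` is infinitesimally rigid in `ℝ^d`: every infinitesimal
motion is the restriction of a motion `x ↦ A x + b` of `ℝ^d` with `A` skew-symmetric. -/
def IsInfRigid {ι : Type} (d : ℕ) (G : FinGraph ι) (p : ι → Fin d → ℝ) : Prop :=
  ∀ m : ι → Fin d → ℝ, IsMotion G p m →
    ∃ (A : Matrix (Fin d) (Fin d) ℝ) (b : Fin d → ℝ),
      A.transpose = -A ∧ ∀ v ∈ G.verts, m v = A.mulVec (p v) + b

/-- A stress on the framework `(G, p)`. -/
def IsStress {ι : Type} {d : ℕ} (G : FinGraph ι) (p : ι → Fin d → ℝ)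
    (ω : Finset ι → ℝ) : Prop :=
  ∀ v ∈ G.verts,
    (∑ e ∈ G.edges.filter (fun e => v ∈ e), ∑ u ∈ e.erase v, ω e • (p v - p u)) = 0

/-- A centrally symmetric framework with free involution `ν` satisfying `p (ν v) = -(p v)`. -/
def IsCSFramework {ι : Type} {d : ℕ} (G : FinGraph ι) (p : ι → Fin d → ℝ) (ν : ι → ι) : Prop :=
  (∀ v ∈ G.verts, ν (ν v) = v) ∧
  (∀ v ∈ G.verts, ν v ∈ G.verts) ∧
  (∀ v ∈ G.verts, ν v ≠ v) ∧
  (∀ e ∈ G.edges, e.image ν ∈ G.edges) ∧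
  (∀ e ∈ G.edges, e.image ν ≠ e) ∧
  (∀ v ∈ G.verts, p (ν v) = -(p v))

/-- The convex body spanned by a finite point set. -/
def polyBody {d : ℕ} (V : Finset (Fin d → ℝ)) : Set (Fin d → ℝ) :=
  convexHull ℝ (V : Set (Fin d → ℝ))

/-- `(f, c)` is a supporting functional for `conv V` exposing the face `F`. -/
def IsSupport {d : ℕ} (V : Finset (Fin d → ℝ)) (f : (Fin d → ℝ) →ₗ[ℝ] ℝ) (c : ℝ)
    (F : Set (Fin d → ℝ)) : Prop :=
  (∀ y ∈ polyBody V, f y ≤ c) ∧ F = {y ∈ polyBody V | f y = c}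

/-- A proper face of the polytope `conv V`. -/
def IsProperFace {d : ℕ} (V : Finset (Fin d → ℝ)) (F : Set (Fin d → ℝ)) : Prop :=
  (∃ f c, IsSupport V f c F) ∧ F ≠ polyBody V

/-- A simplicial `d`-polytope in `ℝ^d`, recorded by its vertex set `V`: the polytope is
`conv V`, it is `d`-dimensional, every element of `V` is a vertex, and every proper face
is a simplex (the convex hull of its affinely independent vertex set). -/
structure SPolytope (d : ℕ) where
  V : Finset (Fin d → ℝ)
  span_top : affineSpan ℝ (V : Set (Fin d → ℝ)) = ⊤
  extreme : ∀ v ∈ V, v ∉ convexHull ℝ ((V.erase v : Finset (Fin d → ℝ)) : Set (Fin d → ℝ))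
  simplicial : ∀ F : Set (Fin d → ℝ), IsProperFace V F →
    AffineIndependent ℝ
      (fun x : {y : Fin d → ℝ // y ∈ (V : Set (Fin d → ℝ)) ∩ F} => (x : Fin d → ℝ)) ∧
    F = convexHull ℝ ((V : Set (Fin d → ℝ)) ∩ F)

/-- `s` is a face of the boundary complex `∂P`. -/
def BFace {d : ℕ} (P : SPolytope d) (s : Finset (Fin d → ℝ)) : Prop :=
  s ⊆ P.V ∧ ∃ F : Set (Fin d → ℝ), IsProperFace P.V F ∧ (s : Set (Fin d → ℝ)) ⊆ F

/-- The number of vertices of `∂P`. -/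
def f0 {d : ℕ} (P : SPolytope d) : ℕ := P.V.card

/-- The edges of `∂P`. -/
def edgeFinset {d : ℕ} (P : SPolytope d) : Finset (Finset (Fin d → ℝ)) :=
  P.V.powerset.filter fun e => e.card = 2 ∧ BFace P e

/-- The number of edges of `∂P`. -/
def f1 {d : ℕ} (P : SPolytope d) : ℕ := (edgeFinset P).card

/-- `g₂(P) = f₁ - d f₀ + C(d+1, 2)`. -/
def g2 {d : ℕ} (P : SPolytope d) : ℤ :=
  (f1 P : ℤ) - (d : ℤ) * (f0 P : ℤ) + ((d + 1).choose 2 : ℤ)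

/-- `P` is centrally symmetric. -/
def IsCS {d : ℕ} (P : SPolytope d) : Prop := ∀ v ∈ P.V, -v ∈ P.V

/-- A missing face of `∂P`. -/
def IsMissingFace {d : ℕ} (P : SPolytope d) (σ : Finset (Fin d → ℝ)) : Prop :=
  σ ⊆ P.V ∧ ¬ BFace P σ ∧ ∀ τ ⊂ σ, BFace P τ

/-- `P` is prime: `∂P` has no missing facet, i.e. no missing face of cardinality `d`. -/
def IsPrimePoly {d : ℕ} (P : SPolytope d) : Prop :=
  ¬ ∃ σ : Finset (Fin d → ℝ), IsMissingFace P σ ∧ σ.card = d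

/-- The graph (1-skeleton) of `∂P` as a framework graph. -/
def fullGraph {d : ℕ} (P : SPolytope d) : FinGraph (Fin d → ℝ) :=
  ⟨P.V, edgeFinset P⟩

/-- The graph (1-skeleton) of the star of the face `τ` in `∂P`. -/
def starGraph {d : ℕ} (P : SPolytope d) (τ : Finset (Fin d → ℝ)) : FinGraph (Fin d → ℝ) :=
  ⟨P.V.filter fun v => BFace P (insert v τ),
   P.V.powerset.filter fun e => e.card = 2 ∧ BFace P (e ∪ τ)⟩

/-- Adjacency in the graph of `∂P`. -/
def Adj {d : ℕ} (P : SPolytope d) (u v : Fin d → ℝ) : Prop :=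
  u ≠ v ∧ BFace P {u, v}

/-- `σ` is a face of the link of the face `τ` in `∂P`. -/
def LinkFace {d : ℕ} (P : SPolytope d) (τ σ : Finset (Fin d → ℝ)) : Prop :=
  Disjoint σ τ ∧ BFace P (σ ∪ τ)

/-- `P` is a `d`-dimensional cross-polytope: its vertex set is `{±b₁, …, ±b_d}`
for some basis `b₁, …, b_d` of `ℝ^d`. -/
def IsCrossPolytope {d : ℕ} (P : SPolytope d) : Prop :=
  ∃ b : Fin d → (Fin d → ℝ), LinearIndependent ℝ b ∧
    (P.V : Set (Fin d → ℝ)) = Set.range b ∪ Set.range (fun i => -(b i))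

/-- A facet of `P`: a proper face with `d` vertices. -/
def IsFacet {d : ℕ} (P : SPolytope d) (F : Set (Fin d → ℝ)) : Prop :=
  IsProperFace P.V F ∧ ((P.V : Set (Fin d → ℝ)) ∩ F).ncard = d

/-- `x` lies beyond exactly one facet of `P`: it is strictly separated from `P` by the
affine hull of one facet `F`, and not separated from `P` by the affine hull of any
other facet. -/
def BeyondExactlyOne {d : ℕ} (P : SPolytope d) (x : Fin d → ℝ) : Prop :=
  ∃ F : Set (Fin d → ℝ), IsFacet P F ∧
    (∀ f c, IsSupport P.V f c F → c < f x) ∧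
    (∀ F' : Set (Fin d → ℝ), IsFacet P F' → F' ≠ F →
      ∀ f c, IsSupport P.V f c F' → f x < c)

/-- `P` is obtained from a `d`-dimensional cross-polytope by symmetric stacking: there is
a sequence of cs simplicial `d`-polytopes starting at a cross-polytope and ending at `P`,
each obtained from the previous one as `conv (P_k ∪ {v, -v})` for a point `v` lying
beyond exactly one facet of `P_k`. -/
def SymmetricStackingFrom {d : ℕ} (P : SPolytope d) : Prop :=
  ∃ (m : ℕ) (Q : Fin (m + 1) → SPolytope d),
    (∀ k, IsCS (Q k)) ∧
    IsCrossPolytope (Q 0) ∧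
    Q (Fin.last m) = P ∧
    ∀ k : Fin m, ∃ v : Fin d → ℝ,
      BeyondExactlyOne (Q (Fin.castSucc k)) v ∧
      polyBody (Q (Fin.succ k)).V =
        convexHull ℝ (polyBody (Q (Fin.castSucc k)).V ∪ {v, -v})

/-- `P` is a stacked `d`-polytope: obtained from a `d`-simplex by repeatedly adding a
point beyond exactly one facet. -/
def IsStacked {d : ℕ} (P : SPolytope d) : Prop :=
  ∃ (m : ℕ) (R : Fin (m + 1) → SPolytope d),
    (R 0).V.card = d + 1 ∧
    R (Fin.last m) = P ∧
    ∀ k : Fin m, ∃ v : Fin d → ℝ,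
      BeyondExactlyOne (R (Fin.castSucc k)) v ∧
      polyBody (R (Fin.succ k)).V =
        convexHull ℝ (polyBody (R (Fin.castSucc k)).V ∪ {v})

/-- Every `d` vertices of `P`, no two of which are antipodal, are affinely independent. -/
def GenPos {d : ℕ} (P : SPolytope d) : Prop :=
  ∀ S : Finset (Fin d → ℝ), S ⊆ P.V → S.card = d →
    (∀ x ∈ S, ∀ y ∈ S, x ≠ -y) →
    AffineIndependent ℝ (fun s : {x : Fin d → ℝ // x ∈ S} => (s : Fin d → ℝ))

/-- The graph of the cone `v₀ * S` over a simplicial complex `S` (a set of finsets):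
the vertices of `S` together with `v₀`, and the edges of `S` together with all edges
from `v₀` to vertices of `S`. -/
def coneGraph {d : ℕ} (P : SPolytope d) (v0 : Fin d → ℝ)
    (S : Set (Finset (Fin d → ℝ))) : FinGraph (Fin d → ℝ) :=
  ⟨insert v0 (P.V.filter fun u => ({u} : Finset (Fin d → ℝ)) ∈ S),
   (P.V.powerset.filter fun e => e.card = 2 ∧ e ∈ S) ∪
     (P.V.filter fun u => ({u} : Finset (Fin d → ℝ)) ∈ S).image
       fun u => ({v0, u} : Finset (Fin d → ℝ))⟩


namespace CSLB

/-- The sign of a real number, as `x / |x|`. -/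
def sg (x : ℝ) : ℝ := x / |x|

lemma sg_neg (x : ℝ) : sg (-x) = - sg x := by simp [sg, neg_div]
lemma sg_mul (x : ℝ) : sg x * x = |x| := by
  unfold sg
  rcases eq_or_ne x 0 with h | h
  · simp [h]
  · field_simp
    exact (sq_abs x).symm
lemma sg_pos {x : ℝ} (h : 0 < x) : sg x = 1 := by
  unfold sg; rw [abs_of_pos h]; field_simp
lemma sg_neg' {x : ℝ} (h : x < 0) : sg x = -1 := by
  unfold sg; rw [abs_of_neg h, div_neg, div_self h.ne]

lemma sum_swap {ι : Type*} (N : Finset ι) (E : ι → ι → Prop) (Esym : ∀ a b, E a b → E b a)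
    (F : ι → ι → ℝ) :
    ∑ a ∈ N, ∑ b ∈ N.filter (E a), F a b = ∑ a ∈ N, ∑ b ∈ N.filter (E a), F b a := by
  simp only [Finset.sum_filter]
  rw [Finset.sum_comm]
  refine Finset.sum_congr rfl fun a _ => Finset.sum_congr rfl fun b _ => ?_
  by_cases h : E a b
  · simp [h, Esym _ _ h]
  · have : ¬ E b a := fun h' => h (Esym _ _ h')
    simp [h, this]

section L2
variable {ι : Type*} (N : Finset ι) (E : ι → ι → Prop) (g h : ι → ℝ)

/-- planar area form -/
def om (g h : ι → ℝ) (a b : ι) : ℝ := g a * h b - h a * g b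
/-- the wedge `x ∧ g` relative to the area form -/
def xi (g h x : ι → ℝ) (a b : ι) : ℝ := (x a * g b - x b * g a) / om g h a b
/-- weights -/
def cc (g h : ι → ℝ) (a b : ι) : ℝ := |om g h a b| / (g a * g b)
/-- signed sum of wedges at a vertex -/
def Sx (x : ι → ℝ) (a : ι) : ℝ := ∑ b ∈ N.filter (E a), sg (om g h a b) * xi g h x a b

variable {N E g h}

lemma cc_xi (hω0 : ∀ a b, E a b → om g h a b ≠ 0) (hg : ∀ a b, E a b → g a ≠ 0)
    (Esym : ∀ a b, E a b → E b a) (x : ι → ℝ) {a b : ι} (hab : E a b) :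
    cc g h a b * xi g h x a b = sg (om g h a b) * (x a / g a - x b / g b) := by
  have h1 := hω0 a b hab
  have h2 := hg a b hab
  have h3 := hg b a (Esym _ _ hab)
  unfold cc xi
  rw [← sg_mul]
  field_simp

lemma om_swap (a b : ι) : om g h b a = - om g h a b := by unfold om; ring
lemma xi_swap (x : ι → ℝ) (a b : ι) : xi g h x b a = xi g h x a b := by
  unfold xi; rw [om_swap, div_neg, ← neg_div]; congr 1; ring

lemma pairing (hω0 : ∀ a b, E a b → om g h a b ≠ 0) (hg : ∀ a b, E a b → g a ≠ 0)
    (Esym : ∀ a b, E a b → E b a) (x y : ι → ℝ) :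
    2 * ∑ a ∈ N, Sx N E g h x a / g a * y a =
      ∑ a ∈ N, ∑ b ∈ N.filter (E a), cc g h a b * xi g h x a b * xi g h y a b := by
  have e1 : ∑ a ∈ N, Sx N E g h x a / g a * y a =
      ∑ a ∈ N, ∑ b ∈ N.filter (E a), sg (om g h a b) * xi g h x a b * (y a / g a) := by
    refine Finset.sum_congr rfl fun a _ => ?_
    rw [Sx, Finset.sum_div, Finset.sum_mul]
    refine Finset.sum_congr rfl fun b _ => ?_
    ring
  have e2 := sum_swap N E Esym (fun a b => sg (om g h a b) * xi g h x a b * (y a / g a))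
  rw [two_mul]
  nth_rewrite 2 [e1]
  rw [e2, e1, ← Finset.sum_add_distrib]
  refine Finset.sum_congr rfl fun a _ => ?_
  rw [← Finset.sum_add_distrib]
  refine Finset.sum_congr rfl fun b hb => ?_
  have hab := (Finset.mem_filter.1 hb).2
  have := cc_xi hω0 hg Esym y hab
  rw [xi_swap x a b, om_swap a b, sg_neg]
  linear_combination (-xi g h x a b) * this

lemma sum_cc_xi (hω0 : ∀ a b, E a b → om g h a b ≠ 0) (hg : ∀ a b, E a b → g a ≠ 0)
    (Esym : ∀ a b, E a b → E b a)
    (bal : ∀ a ∈ N, ∑ b ∈ N.filter (E a), sg (om g h a b) = 0) (x : ι → ℝ) :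
    ∑ a ∈ N, ∑ b ∈ N.filter (E a), cc g h a b * xi g h x a b = 0 := by
  have e1 : ∑ a ∈ N, ∑ b ∈ N.filter (E a), sg (om g h a b) * (x a / g a) = 0 := by
    refine Finset.sum_eq_zero fun a ha => ?_
    rw [← Finset.sum_mul, bal a ha, zero_mul]
  have e2 := sum_swap N E Esym (fun a b => sg (om g h a b) * (x a / g a))
  rw [e1] at e2
  have : ∀ a ∈ N, ∑ b ∈ N.filter (E a), cc g h a b * xi g h x a b =
     (∑ b ∈ N.filter (E a), sg (om g h a b) * (x a / g a)) +
     ∑ b ∈ N.filter (E a), sg (om g h b a) * (x b / g b) := by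
    intro a _
    rw [← Finset.sum_add_distrib]
    refine Finset.sum_congr rfl fun b hb => ?_
    rw [cc_xi hω0 hg Esym x (Finset.mem_filter.1 hb).2, om_swap a b, sg_neg]
    ring
  rw [Finset.sum_congr rfl this, Finset.sum_add_distrib, e1, ← e2, zero_add]

lemma xi_h (hω0 : ∀ a b, E a b → om g h a b ≠ 0) {a b : ι} (hab : E a b) :
    xi g h h a b = -1 := by
  unfold xi
  rw [div_eq_iff (hω0 a b hab)]
  unfold om; ring

theorem L2 (hω0 : ∀ a b, E a b → om g h a b ≠ 0) (hg : ∀ a b, E a b → g a ≠ 0)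
    (Esym : ∀ a b, E a b → E b a)
    (bal : ∀ a ∈ N, ∑ b ∈ N.filter (E a), sg (om g h a b) = 0)
    (uniq : ∀ a b a' b', E a b → E a' b' → 0 < g a → g b < 0 → 0 < g a' → g b' < 0 →
      0 < om g h a b * om g h a' b' → a = a' ∧ b = b')
    (x l : ι → ℝ) (hxl : ∑ a ∈ N, Sx N E g h x a / g a * l a = 0)
    (hll : ∑ a ∈ N, Sx N E g h l a / g a * l a < 0) :
    0 ≤ ∑ a ∈ N, Sx N E g h x a / g a * x a ∧
    (∑ a ∈ N, Sx N E g h x a / g a * x a = 0 → ∀ a ∈ N, Sx N E g h x a = 0) := by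
  have pxl := pairing (N := N) hω0 hg Esym x l
  have pll := pairing (N := N) hω0 hg Esym l l
  have pxx := pairing (N := N) hω0 hg Esym x x
  rw [hxl] at pxl
  have sx := sum_cc_xi hω0 hg Esym bal x
  have sl := sum_cc_xi hω0 hg Esym bal l
  have s1 : ∑ a ∈ N, ∑ b ∈ N.filter (E a), cc g h a b = 0 := by
    have := sum_cc_xi hω0 hg Esym bal h
    rw [← neg_eq_zero, ← Finset.sum_neg_distrib, ← this]
    refine Finset.sum_congr rfl fun a _ => ?_
    rw [← Finset.sum_neg_distrib]
    refine Finset.sum_congr rfl fun b hb => ?_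
    rw [xi_h hω0 (Finset.mem_filter.1 hb).2]; ring
  -- the general expansion
  have expand : ∀ r t : ℝ, ∑ a ∈ N, ∑ b ∈ N.filter (E a),
      cc g h a b * (xi g h x a b - r - t * xi g h l a b) ^ 2 =
      2 * (∑ a ∈ N, Sx N E g h x a / g a * x a) + t ^ 2 * (2 * ∑ a ∈ N, Sx N E g h l a / g a * l a) := by
    intro r t
    have : ∑ a ∈ N, ∑ b ∈ N.filter (E a),
      cc g h a b * (xi g h x a b - r - t * xi g h l a b) ^ 2 =
      (∑ a ∈ N, ∑ b ∈ N.filter (E a), cc g h a b * xi g h x a b * xi g h x a b) +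
      t ^ 2 * (∑ a ∈ N, ∑ b ∈ N.filter (E a), cc g h a b * xi g h l a b * xi g h l a b) +
      r ^ 2 * (∑ a ∈ N, ∑ b ∈ N.filter (E a), cc g h a b) -
      2 * t * (∑ a ∈ N, ∑ b ∈ N.filter (E a), cc g h a b * xi g h x a b * xi g h l a b) -
      2 * r * (∑ a ∈ N, ∑ b ∈ N.filter (E a), cc g h a b * xi g h x a b) +
      2 * r * t * (∑ a ∈ N, ∑ b ∈ N.filter (E a), cc g h a b * xi g h l a b) := by
      simp only [Finset.mul_sum]
      simp only [← Finset.sum_add_distrib, ← Finset.sum_sub_distrib]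
      refine Finset.sum_congr rfl fun a _ => Finset.sum_congr rfl fun b _ => ?_
      ring
    rw [this, sx, sl, s1, ← pxl, ← pxx, ← pll]; ring
  -- nonnegativity once negative terms vanish
  have nonneg : ∀ f : ι → ι → ℝ, (∀ a b, E a b → cc g h a b < 0 → f a b = 0) →
      ∀ a ∈ N, ∀ b ∈ N.filter (E a), 0 ≤ cc g h a b * f a b ^ 2 := by
    intro f hf a _ b hb
    have hab := (Finset.mem_filter.1 hb).2
    by_cases hc : cc g h a b < 0
    · rw [hf a b hab hc]; simp
    · exact mul_nonneg (not_lt.1 hc) (sq_nonneg _)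
  have ccneg : ∀ a b, E a b → cc g h a b < 0 →
      (0 < g a ∧ g b < 0) ∨ (0 < g b ∧ g a < 0) := by
    intro a b hab hc
    have h1 := hg a b hab
    have h2 := hg b a (Esym _ _ hab)
    have h3 := hω0 a b hab
    unfold cc at hc
    have h4 : g a * g b < 0 := by
      by_contra hcon
      exact absurd hc (not_lt.2 (div_nonneg (abs_nonneg _) (not_lt.1 hcon)))
    rcases mul_neg_iff.1 h4 with h | h
    · exact Or.inl h
    · exact Or.inr ⟨h.2, h.1⟩
  -- existence of constants
  obtain ⟨r, t, hrt⟩ : ∃ r t : ℝ, ∀ a b, E a b → cc g h a b < 0 →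
      xi g h x a b - r - t * xi g h l a b = 0 := by
    -- reduce to oriented crossing pairs
    suffices H : ∃ r t : ℝ, ∀ a b, E a b → 0 < g a → g b < 0 →
        xi g h x a b - r - t * xi g h l a b = 0 by
      obtain ⟨r, t, H⟩ := H
      refine ⟨r, t, fun a b hab hc => ?_⟩
      rcases ccneg a b hab hc with h1 | h1
      · exact H a b hab h1.1 h1.2
      · rw [← xi_swap x, ← xi_swap l]
        exact H b a (Esym _ _ hab) h1.1 h1.2
    by_contra hcon
    -- then l is constant on crossing pairs
    have hl : ∃ r : ℝ, ∀ a b, E a b → 0 < g a → g b < 0 → xi g h l a b = r := by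
      by_contra hcon2
      apply hcon
      -- two classes
      by_cases hp : ∃ a b, E a b ∧ 0 < g a ∧ g b < 0 ∧ 0 < om g h a b
      · by_cases hn : ∃ a b, E a b ∧ 0 < g a ∧ g b < 0 ∧ om g h a b < 0
        · obtain ⟨a1, b1, e1, ga1, gb1, o1⟩ := hp
          obtain ⟨a2, b2, e2, ga2, gb2, o2⟩ := hn
          have key : ∀ a b, E a b → 0 < g a → g b < 0 → (a1 = a ∧ b1 = b) ∨ (a2 = a ∧ b2 = b) := by
            intro a b hab h1 h2
            rcases lt_or_gt_of_ne (hω0 a b hab) with h3 | h3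
            · exact Or.inr (uniq _ _ _ _ e2 hab ga2 gb2 h1 h2 (mul_pos_of_neg_of_neg o2 h3))
            · exact Or.inl (uniq _ _ _ _ e1 hab ga1 gb1 h1 h2 (mul_pos o1 h3))
          have hne : xi g h l a1 b1 - xi g h l a2 b2 ≠ 0 := by
            intro h0
            apply hcon2
            refine ⟨xi g h l a1 b1, fun a b hab h1 h2 => ?_⟩
            rcases key a b hab h1 h2 with ⟨rfl, rfl⟩ | ⟨rfl, rfl⟩
            · rfl
            · linarith
          refine ⟨xi g h x a1 b1 - (xi g h x a1 b1 - xi g h x a2 b2) /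
            (xi g h l a1 b1 - xi g h l a2 b2) * xi g h l a1 b1, (xi g h x a1 b1 - xi g h x a2 b2) /
            (xi g h l a1 b1 - xi g h l a2 b2), fun a b hab h1 h2 => ?_⟩
          rcases key a b hab h1 h2 with ⟨rfl, rfl⟩ | ⟨rfl, rfl⟩
          · ring
          · field_simp; ring
        · obtain ⟨a1, b1, e1, ga1, gb1, o1⟩ := hp
          refine absurd ⟨xi g h l a1 b1, fun a b hab h1 h2 => ?_⟩ hcon2
          have h3 : 0 < om g h a b := by
            rcases lt_or_gt_of_ne (hω0 a b hab) with h3 | h3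
            · exact absurd ⟨a, b, hab, h1, h2, h3⟩ hn
            · exact h3
          obtain ⟨rfl, rfl⟩ := uniq _ _ _ _ e1 hab ga1 gb1 h1 h2 (mul_pos o1 h3)
          rfl
      · by_cases hn : ∃ a b, E a b ∧ 0 < g a ∧ g b < 0
        · obtain ⟨a1, b1, e1, ga1, gb1⟩ := hn
          refine absurd ⟨xi g h l a1 b1, fun a b hab h1 h2 => ?_⟩ hcon2
          have h3 : ∀ a b, E a b → 0 < g a → g b < 0 → om g h a b < 0 := by
            intro a b hab h1 h2
            rcases lt_or_gt_of_ne (hω0 a b hab) with h3 | h3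
            · exact h3
            · exact absurd ⟨a, b, hab, h1, h2, h3⟩ hp
          obtain ⟨rfl, rfl⟩ := uniq _ _ _ _ e1 hab ga1 gb1 h1 h2
            (mul_pos_of_neg_of_neg (h3 _ _ e1 ga1 gb1) (h3 _ _ hab h1 h2))
          rfl
        · exact absurd ⟨0, fun a b hab h1 h2 => absurd ⟨a, b, hab, h1, h2⟩ hn⟩ hcon2
    obtain ⟨r, hr⟩ := hl
    have hr' : ∀ a b, E a b → cc g h a b < 0 → xi g h l a b - r = 0 := by
      intro a b hab hc
      rcases ccneg a b hab hc with h1 | h1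
      · rw [hr a b hab h1.1 h1.2, sub_self]
      · rw [← xi_swap l, hr b a (Esym _ _ hab) h1.1 h1.2, sub_self]
    have h0 : 0 ≤ ∑ a ∈ N, ∑ b ∈ N.filter (E a), cc g h a b * (xi g h l a b - r) ^ 2 :=
      Finset.sum_nonneg fun a ha => Finset.sum_nonneg fun b hb => nonneg _ hr' a ha b hb
    have h1 : ∑ a ∈ N, ∑ b ∈ N.filter (E a), cc g h a b * (xi g h l a b - r) ^ 2 =
        (∑ a ∈ N, ∑ b ∈ N.filter (E a), cc g h a b * xi g h l a b * xi g h l a b) +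
        r ^ 2 * (∑ a ∈ N, ∑ b ∈ N.filter (E a), cc g h a b) -
        2 * r * (∑ a ∈ N, ∑ b ∈ N.filter (E a), cc g h a b * xi g h l a b) := by
      simp only [Finset.mul_sum]
      simp only [← Finset.sum_add_distrib, ← Finset.sum_sub_distrib]
      refine Finset.sum_congr rfl fun a _ => Finset.sum_congr rfl fun b _ => ?_
      ring
    rw [h1, s1, sl, ← pll] at h0
    linarith
  have hE := expand r t
  have hnn := nonneg _ hrt
  have h0 : 0 ≤ ∑ a ∈ N, ∑ b ∈ N.filter (E a),
      cc g h a b * (xi g h x a b - r - t * xi g h l a b) ^ 2 :=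
    Finset.sum_nonneg fun a ha => Finset.sum_nonneg fun b hb => hnn a ha b hb
  have ht : t ^ 2 * (2 * ∑ a ∈ N, Sx N E g h l a / g a * l a) ≤ 0 :=
    mul_nonpos_of_nonneg_of_nonpos (sq_nonneg _) (by linarith)
  refine ⟨by linarith, fun hz => ?_⟩
  have ht0 : t = 0 := by
    by_contra hne
    have : 0 < t ^ 2 := by positivity
    nlinarith
  have hz0 : ∑ a ∈ N, ∑ b ∈ N.filter (E a),
      cc g h a b * (xi g h x a b - r - t * xi g h l a b) ^ 2 = 0 := by
    rw [hE, hz, ht0]; ring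
  have hxi : ∀ a ∈ N, ∀ b ∈ N.filter (E a), xi g h x a b = r := by
    intro a ha b hb
    have z1 := (Finset.sum_eq_zero_iff_of_nonneg
      (fun a ha => Finset.sum_nonneg fun b hb => hnn a ha b hb)).1 hz0 a ha
    have z2 := (Finset.sum_eq_zero_iff_of_nonneg (fun b hb => hnn a ha b hb)).1 z1 b hb
    have hab := (Finset.mem_filter.1 hb).2
    have hc : cc g h a b ≠ 0 := by
      unfold cc
      exact div_ne_zero (abs_ne_zero.2 (hω0 a b hab))
        (mul_ne_zero (hg a b hab) (hg b a (Esym _ _ hab)))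
    rcases mul_eq_zero.1 z2 with h | h
    · exact absurd h hc
    · have := pow_eq_zero_iff (two_ne_zero) |>.1 h
      rw [ht0] at this
      linarith
  intro a ha
  rw [Sx, Finset.sum_congr rfl (fun b hb => by rw [hxi a ha b hb]), ← Finset.sum_mul, bal a ha,
    zero_mul]

end L2
end CSLB

namespace CSLB
section D3
open Matrix

/-- cross product in three-space -/
def cr (a b : Fin 3 → ℝ) : Fin 3 → ℝ :=
  ![a 1 * b 2 - a 2 * b 1, a 2 * b 0 - a 0 * b 2, a 0 * b 1 - a 1 * b 0]
/-- determinant in three-space -/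
def dt (a b c : Fin 3 → ℝ) : ℝ := cr a b ⬝ᵥ c

lemma dt_swap (a b c : Fin 3 → ℝ) : dt b a c = - dt a b c := by
  simp [dt, cr, dotProduct, Fin.sum_univ_three]; ring
lemma dt_rot (a b c : Fin 3 → ℝ) : dt b c a = dt a b c := by
  simp [dt, cr, dotProduct, Fin.sum_univ_three]; ring
lemma cr_swap (a b : Fin 3 → ℝ) : cr b a = - cr a b := by
  ext i; fin_cases i <;> simp [cr] <;> ring
lemma cr_add_left (a b c : Fin 3 → ℝ) : cr (a + b) c = cr a c + cr b c := by
  ext i; fin_cases i <;> simp [cr] <;> ring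
lemma cr_sub_left (a b c : Fin 3 → ℝ) : cr (a - b) c = cr a c - cr b c := by
  ext i; fin_cases i <;> simp [cr] <;> ring
lemma cr_sub_right (a b c : Fin 3 → ℝ) : cr a (b - c) = cr a b - cr a c := by
  ext i; fin_cases i <;> simp [cr] <;> ring
lemma cr_smul_right (t : ℝ) (a b : Fin 3 → ℝ) : cr a (t • b) = t • cr a b := by
  ext i; fin_cases i <;> simp [cr] <;> ring
lemma cr_smul_left (t : ℝ) (a b : Fin 3 → ℝ) : cr (t • a) b = t • cr a b := by
  ext i; fin_cases i <;> simp [cr] <;> ring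
lemma cr_zero_left (b : Fin 3 → ℝ) : cr 0 b = 0 := by
  ext i; fin_cases i <;> simp [cr]
lemma cr_zero_right (b : Fin 3 → ℝ) : cr b 0 = 0 := by
  ext i; fin_cases i <;> simp [cr]
lemma cr_self (b : Fin 3 → ℝ) : cr b b = 0 := by
  ext i; fin_cases i <;> simp [cr] <;> ring
lemma cr_sum_right {ι : Type*} (s : Finset ι) (a : Fin 3 → ℝ) (f : ι → Fin 3 → ℝ) :
    cr a (∑ i ∈ s, f i) = ∑ i ∈ s, cr a (f i) := by
  induction s using Finset.induction_on with
  | empty => simp [cr_zero_right]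
  | insert i s hi ih =>
    rw [Finset.sum_insert hi, Finset.sum_insert hi, ← ih]
    ext i; fin_cases i <;> simp [cr] <;> ring

lemma dt_decomp (a b c y : Fin 3 → ℝ) :
    dt a b c • y = (y ⬝ᵥ a) • cr b c + (y ⬝ᵥ b) • cr c a + (y ⬝ᵥ c) • cr a b := by
  ext i; fin_cases i <;> simp [dt, cr, dotProduct, Fin.sum_univ_three] <;> ring

lemma ext3 {a b c y z : Fin 3 → ℝ} (h : dt a b c ≠ 0) (ha : y ⬝ᵥ a = z ⬝ᵥ a)
    (hb : y ⬝ᵥ b = z ⬝ᵥ b) (hc : y ⬝ᵥ c = z ⬝ᵥ c) : y = z := by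
  have := dt_decomp a b c y
  rw [ha, hb, hc, ← dt_decomp a b c z] at this
  exact smul_right_injective _ h this

lemma dot_self_ne {v : Fin 3 → ℝ} (h : v ≠ 0) : v ⬝ᵥ v ≠ 0 := by
  rwa [Ne, dotProduct_self_eq_zero]

lemma par_of_cr {a v : Fin 3 → ℝ} (hv : v ≠ 0) (h : cr a v = 0) :
    a = ((a ⬝ᵥ v) / (v ⬝ᵥ v)) • v := by
  have h1 : (v ⬝ᵥ v) • a = (a ⬝ᵥ v) • v + cr v (cr a v) := by
    ext i; fin_cases i <;> simp [cr, dotProduct, Fin.sum_univ_three] <;> ring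
  rw [h, cr_zero_right, add_zero] at h1
  rw [div_eq_inv_mul, mul_smul, ← h1, smul_smul, inv_mul_cancel₀ (dot_self_ne hv), one_smul]

lemma cr_cr (v a y : Fin 3 → ℝ) : cr y (cr v a) = (y ⬝ᵥ a) • v - (y ⬝ᵥ v) • a := by
  ext i; fin_cases i <;> simp [cr, dotProduct, Fin.sum_univ_three] <;> ring

lemma perp_cr {v a y : Fin 3 → ℝ} (h : cr v a ≠ 0) (hv : y ⬝ᵥ v = 0) (ha : y ⬝ᵥ a = 0) :
    y = ((y ⬝ᵥ cr v a) / (cr v a ⬝ᵥ cr v a)) • cr v a := by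
  apply par_of_cr h
  rw [cr_cr, hv, ha]; simp

lemma cr_dot_left (v a : Fin 3 → ℝ) : cr v a ⬝ᵥ v = 0 := by
  simp [cr, dotProduct, Fin.sum_univ_three]; ring
lemma cr_dot_right (v a : Fin 3 → ℝ) : cr v a ⬝ᵥ a = 0 := by
  simp [cr, dotProduct, Fin.sum_univ_three]; ring

lemma cr_ne_of_dt {a b c : Fin 3 → ℝ} (h : dt a b c ≠ 0) : cr a b ≠ 0 := by
  intro h0; apply h; rw [dt, h0]; simp

/-- the vector with prescribed dot products -/
def bbv (a b c : Fin 3 → ℝ) (x y z : ℝ) : Fin 3 → ℝ :=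
  (dt a b c)⁻¹ • (x • cr b c + y • cr c a + z • cr a b)

lemma bbv_a {a b c : Fin 3 → ℝ} (h : dt a b c ≠ 0) (x y z : ℝ) : bbv a b c x y z ⬝ᵥ a = x := by
  have : (x • cr b c + y • cr c a + z • cr a b) ⬝ᵥ a = x * dt a b c := by
    simp [dt, cr, dotProduct, Fin.sum_univ_three]; ring
  rw [bbv, smul_dotProduct, this, smul_eq_mul]; field_simp
lemma bbv_b {a b c : Fin 3 → ℝ} (h : dt a b c ≠ 0) (x y z : ℝ) : bbv a b c x y z ⬝ᵥ b = y := by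
  have : (x • cr b c + y • cr c a + z • cr a b) ⬝ᵥ b = y * dt a b c := by
    simp [dt, cr, dotProduct, Fin.sum_univ_three]; ring
  rw [bbv, smul_dotProduct, this, smul_eq_mul]; field_simp
lemma bbv_c {a b c : Fin 3 → ℝ} (h : dt a b c ≠ 0) (x y z : ℝ) : bbv a b c x y z ⬝ᵥ c = z := by
  have : (x • cr b c + y • cr c a + z • cr a b) ⬝ᵥ c = z * dt a b c := by
    simp [dt, cr, dotProduct, Fin.sum_univ_three]; ring
  rw [bbv, smul_dotProduct, this, smul_eq_mul]; field_simp

/-- the axial vector -/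
def alv (a b c n1 n2 n3 : Fin 3 → ℝ) : Fin 3 → ℝ :=
  (dt a b c)⁻¹ • ((n1 ⬝ᵥ b) • c + (n2 ⬝ᵥ c) • a + (n3 ⬝ᵥ a) • b)

lemma alv_a {a b c n1 n2 n3 : Fin 3 → ℝ} (h : dt a b c ≠ 0) (h1 : n1 ⬝ᵥ a = 0)
    (h13 : n1 ⬝ᵥ c + n3 ⬝ᵥ a = 0) : cr (alv a b c n1 n2 n3) a = n1 := by
  apply smul_right_injective _ h
  have h3 : n3 ⬝ᵥ a = - (n1 ⬝ᵥ c) := by linarith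
  simp only
  rw [dt_decomp a b c n1, h1, alv, cr_smul_left, smul_smul, mul_inv_cancel₀ h, one_smul,
    cr_add_left, cr_add_left, cr_smul_left, cr_smul_left, cr_smul_left, cr_self, h3, cr_swap a b]
  simp

lemma alv_rot (a b c n1 n2 n3 : Fin 3 → ℝ) : alv b c a n2 n3 n1 = alv a b c n1 n2 n3 := by
  rw [alv, alv, dt_rot]; congr 1; abel

lemma al_unique {v a y : Fin 3 → ℝ} {β : ℝ} (h : cr v a ≠ 0) (h1 : cr y v + β • cr v a = 0)
    (h2 : cr y a + β • cr v a = 0) : y = β • (a - v) := by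
  have e1 : cr (y - β • (a - v)) v = 0 := by
    rw [← h1, cr_sub_left, cr_smul_left, cr_sub_left, cr_self, cr_swap v a]; simp
  have e2 : cr (y - β • (a - v)) a = 0 := by
    rw [← h2, cr_sub_left, cr_smul_left, cr_sub_left, cr_self]; simp
  have hv : v ≠ 0 := fun h0 => h (by rw [h0, cr_zero_left])
  have e3 := par_of_cr hv e1
  set s := ((y - β • (a - v)) ⬝ᵥ v) / (v ⬝ᵥ v)
  rw [e3, cr_smul_left] at e2
  rcases smul_eq_zero.1 e2 with h0 | h0
  · rw [h0, zero_smul] at e3; exact sub_eq_zero.1 e3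
  · exact absurd h0 h


/-- a simplicial 2-sphere with strictly convex position in three-space -/
structure Cfg (ι : Type*) where
  N : Finset ι
  p : ι → Fin 3 → ℝ
  T : ι → ι → ι → Prop
  Tsw : ∀ a b c, T a b c → T b a c
  Tro : ∀ a b c, T a b c → T b c a
  TN : ∀ a b c, T a b c → a ∈ N
  Tdet : ∀ a b c, T a b c → dt (p a) (p b) (p c) ≠ 0
  Tq : ∀ a b c, T a b c → ∃ q : Fin 3 → ℝ, q ⬝ᵥ p a = 1 ∧ q ⬝ᵥ p b = 1 ∧ q ⬝ᵥ p c = 1 ∧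
    ∀ w ∈ N, w ≠ a → w ≠ b → w ≠ c → q ⬝ᵥ p w < 1
  Tpiv : ∀ a b c, T a b c → ∃ c', c' ≠ c ∧ T a b c'

namespace Cfg
variable {ι : Type*} (C : Cfg ι)

/-- determinant of an indexed triangle -/
def D (a b c : ι) : ℝ := dt (C.p a) (C.p b) (C.p c)

variable {C}
lemma Tswr {a b c : ι} (h : C.T a b c) : C.T a c b := C.Tro _ _ _ (C.Tsw _ _ _ h)
lemma Tne {a b c : ι} (h : C.T a b c) : a ≠ b := by
  rintro rfl
  apply C.Tdet _ _ _ h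
  rw [dt, cr_self]; simp
lemma Tne2 {a b c : ι} (h : C.T a b c) : b ≠ c := Tne (C.Tro _ _ _ h)
lemma Tne3 {a b c : ι} (h : C.T a b c) : a ≠ c := Tne (Tswr h)
lemma TNb {a b c : ι} (h : C.T a b c) : b ∈ C.N := C.TN _ _ _ (C.Tro _ _ _ h)
lemma TNc {a b c : ι} (h : C.T a b c) : c ∈ C.N := TNb (C.Tro _ _ _ h)
lemma D_swr (a b c : ι) : C.D a c b = - C.D a b c := by
  simp [D, dt, cr, dotProduct, Fin.sum_univ_three]; ring

lemma opp {v a c c' : ι} (h : C.T v a c) (h' : C.T v a c') (hne : c ≠ c') :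
    C.D v a c * C.D v a c' < 0 := by
  obtain ⟨q, q1, q2, q3, q4⟩ := C.Tq _ _ _ h
  obtain ⟨r, r1, r2, r3, r4⟩ := C.Tq _ _ _ h'
  have hc : cr (C.p v) (C.p a) ≠ 0 := cr_ne_of_dt (C.Tdet _ _ _ h)
  have e := perp_cr (y := r - q) hc (by rw [sub_dotProduct, q1, r1, sub_self])
    (by rw [sub_dotProduct, q2, r2, sub_self])
  set t := ((r - q) ⬝ᵥ cr (C.p v) (C.p a)) / (cr (C.p v) (C.p a) ⬝ᵥ cr (C.p v) (C.p a))
  have e1 : r ⬝ᵥ C.p c - 1 = t * C.D v a c := by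
    rw [← q3, ← sub_dotProduct, e, smul_dotProduct]; rfl
  have e2 : 1 - q ⬝ᵥ C.p c' = t * C.D v a c' := by
    rw [← r3, ← sub_dotProduct, e, smul_dotProduct]; rfl
  have h1 := r4 c (TNc h) (Tne3 h).symm (Tne2 h).symm hne
  have h2 := q4 c' (TNc h') (Tne3 h').symm (Tne2 h').symm hne.symm
  have h3 : (t * C.D v a c) * (t * C.D v a c') < 0 := by
    rw [← e1, ← e2]; exact mul_neg_of_neg_of_pos (by linarith) (by linarith)
  nlinarith [sq_nonneg t]

/-- the triangles on an edge come in an oriented pair -/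
lemma pair {v a c : ι} (h : C.T v a c) : ∃ c1 c2, c1 ≠ c2 ∧ C.T v a c1 ∧ C.T v a c2 ∧
    0 < C.D v a c1 ∧ C.D v a c2 < 0 ∧ C.N.filter (C.T v a) = {c1, c2} := by
  obtain ⟨c', hne, h'⟩ := C.Tpiv _ _ _ h
  have key : ∀ c1 c2, c1 ≠ c2 → C.T v a c1 → C.T v a c2 → C.N.filter (C.T v a) = {c1, c2} := by
    intro c1 c2 h12 h1 h2
    ext w
    simp only [Finset.mem_filter, Finset.mem_insert, Finset.mem_singleton]
    constructor
    · rintro ⟨_, hw⟩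
      by_contra hcon
      push Not at hcon
      have o1 := opp h1 h2 h12
      have o2 := opp h1 hw (Ne.symm hcon.1)
      have o3 := opp h2 hw (Ne.symm hcon.2)
      rcases mul_neg_iff.1 o1 with o | o <;> rcases mul_neg_iff.1 o2 with o' | o' <;>
        rcases mul_neg_iff.1 o3 with o'' | o'' <;> linarith [o.1, o.2, o'.1, o'.2, o''.1, o''.2]
    · rintro (rfl | rfl)
      · exact ⟨TNc h1, h1⟩
      · exact ⟨TNc h2, h2⟩
  rcases mul_neg_iff.1 (opp h h' hne.symm) with o | o
  · exact ⟨c, c', hne.symm, h, h', o.1, o.2, key _ _ hne.symm h h'⟩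
  · exact ⟨c', c, hne, h', h, o.2, o.1, key _ _ hne h' h⟩

lemma sum_pair_smul {v a c1 c2 : ι} (h12 : c1 ≠ c2) (h1 : 0 < C.D v a c1) (h2 : C.D v a c2 < 0)
    (hf : C.N.filter (C.T v a) = {c1, c2}) (F : ι → Fin 3 → ℝ) :
    ∑ c ∈ C.N.filter (C.T v a), sg (C.D v a c) • F c = F c1 - F c2 := by
  rw [hf, Finset.sum_pair h12, sg_pos h1, sg_neg' h2]; simp [sub_eq_add_neg]

lemma empty_of_not {v a : ι} (h : ¬ ∃ c, C.T v a c) : C.N.filter (C.T v a) = ∅ := by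
  ext w; simp only [Finset.mem_filter, Finset.notMem_empty, iff_false, not_and]
  exact fun _ hw => h ⟨w, hw⟩

lemma bal (v a : ι) : ∑ c ∈ C.N.filter (C.T v a), sg (C.D v a c) = 0 := by
  by_cases h : ∃ c, C.T v a c
  · obtain ⟨c, h⟩ := h
    obtain ⟨c1, c2, h12, _, _, h1, h2, hf⟩ := pair h
    rw [hf, Finset.sum_pair h12, sg_pos h1, sg_neg' h2]; ring
  · rw [empty_of_not h, Finset.sum_empty]

end Cfg
end D3
end CSLB

namespace CSLB
section D3b
open Matrix
namespace Cfg
variable {ι : Type*} {C : Cfg ι}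

/-- affine part of the local motion on a triangle -/
def BB (C : Cfg ι) (μ : ι → Fin 3 → ℝ) (a b c : ι) : Fin 3 → ℝ :=
  bbv (C.p a) (C.p b) (C.p c) (μ a ⬝ᵥ C.p a) (μ b ⬝ᵥ C.p b) (μ c ⬝ᵥ C.p c)
/-- axial part of the local motion on a triangle -/
def AL (C : Cfg ι) (μ : ι → Fin 3 → ℝ) (a b c : ι) : Fin 3 → ℝ :=
  alv (C.p a) (C.p b) (C.p c) (μ a - C.BB μ a b c) (μ b - C.BB μ a b c) (μ c - C.BB μ a b c)
/-- infinitesimal motion -/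
def Mot (C : Cfg ι) (μ : ι → Fin 3 → ℝ) : Prop :=
  ∀ a b c, C.T a b c → (C.p a - C.p b) ⬝ᵥ (μ a - μ b) = 0
/-- jump coefficient across an edge -/
def bet (C : Cfg ι) (μ : ι → Fin 3 → ℝ) (v a : ι) : ℝ :=
  ((∑ c ∈ C.N.filter (C.T v a), sg (C.D v a c) • C.BB μ v a c) ⬝ᵥ cr (C.p v) (C.p a)) /
    (cr (C.p v) (C.p a) ⬝ᵥ cr (C.p v) (C.p a))

variable {μ : ι → Fin 3 → ℝ}

lemma BB_a {a b c : ι} (h : C.T a b c) : C.BB μ a b c ⬝ᵥ C.p a = μ a ⬝ᵥ C.p a :=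
  bbv_a (C.Tdet _ _ _ h) _ _ _
lemma BB_b {a b c : ι} (h : C.T a b c) : C.BB μ a b c ⬝ᵥ C.p b = μ b ⬝ᵥ C.p b :=
  bbv_b (C.Tdet _ _ _ h) _ _ _
lemma BB_c {a b c : ι} (h : C.T a b c) : C.BB μ a b c ⬝ᵥ C.p c = μ c ⬝ᵥ C.p c :=
  bbv_c (C.Tdet _ _ _ h) _ _ _
lemma BB_rot {a b c : ι} (h : C.T a b c) : C.BB μ b c a = C.BB μ a b c :=
  ext3 (C.Tdet _ _ _ h) (by rw [BB_c (C.Tro _ _ _ h), BB_a h])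
   (by rw [BB_a (C.Tro _ _ _ h), BB_b h]) (by rw [BB_b (C.Tro _ _ _ h), BB_c h])
lemma BB_sw {a b c : ι} (h : C.T a b c) : C.BB μ b a c = C.BB μ a b c :=
  ext3 (C.Tdet _ _ _ h) (by rw [BB_b (C.Tsw _ _ _ h), BB_a h])
   (by rw [BB_a (C.Tsw _ _ _ h), BB_b h]) (by rw [BB_c (C.Tsw _ _ _ h), BB_c h])

lemma AL_rot {a b c : ι} (h : C.T a b c) : C.AL μ b c a = C.AL μ a b c := by
  rw [AL, BB_rot h, alv_rot]; rfl

lemma AL_a (hμ : C.Mot μ) {a b c : ι} (h : C.T a b c) :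
    cr (C.AL μ a b c) (C.p a) + C.BB μ a b c = μ a := by
  rw [AL, alv_a (C.Tdet _ _ _ h)]
  · simp
  · rw [sub_dotProduct, BB_a h, sub_self]
  · have h1 := hμ _ _ _ (Tswr h)
    have h2 := BB_a (μ := μ) h
    have h3 := BB_c (μ := μ) h
    simp only [sub_dotProduct, dotProduct_sub] at h1 ⊢
    rw [dotProduct_comm (C.p a), dotProduct_comm (C.p a), dotProduct_comm (C.p c),
      dotProduct_comm (C.p c)] at h1
    linarith
lemma AL_b (hμ : C.Mot μ) {a b c : ι} (h : C.T a b c) :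
    cr (C.AL μ a b c) (C.p b) + C.BB μ a b c = μ b := by
  rw [← AL_rot h, ← BB_rot h, AL_a hμ (C.Tro _ _ _ h)]
lemma AL_c (hμ : C.Mot μ) {a b c : ι} (h : C.T a b c) :
    cr (C.AL μ a b c) (C.p c) + C.BB μ a b c = μ c := by
  rw [← AL_rot h, ← BB_rot h, AL_b hμ (C.Tro _ _ _ h)]
lemma AL_sw (hμ : C.Mot μ) {a b c : ι} (h : C.T a b c) : C.AL μ b a c = C.AL μ a b c := by
  rw [← sub_eq_zero]
  have := al_unique (y := C.AL μ b a c - C.AL μ a b c) (β := 0) (cr_ne_of_dt (C.Tdet _ _ _ h))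
  simp only [zero_smul, add_zero] at this
  apply this
  · have h1 := AL_b hμ (C.Tsw _ _ _ h)
    have h2 := AL_a hμ h
    rw [BB_sw h, ← h2] at h1
    rw [cr_sub_left, add_right_cancel h1, sub_self]
  · have h1 := AL_a hμ (C.Tsw _ _ _ h)
    have h2 := AL_b hμ h
    rw [BB_sw h, ← h2] at h1
    rw [cr_sub_left, add_right_cancel h1, sub_self]

lemma bet_BB (v a : ι) : ∑ c ∈ C.N.filter (C.T v a), sg (C.D v a c) • C.BB μ v a c =
    C.bet μ v a • cr (C.p v) (C.p a) := by
  by_cases h : ∃ c, C.T v a c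
  · obtain ⟨c, h⟩ := h
    apply perp_cr (cr_ne_of_dt (C.Tdet _ _ _ h))
    all_goals
      obtain ⟨c1, c2, h12, t1, t2, h1, h2, hf⟩ := pair h
      rw [sum_pair_smul h12 h1 h2 hf]
    · rw [sub_dotProduct, BB_a t1, BB_a t2, sub_self]
    · rw [sub_dotProduct, BB_b t1, BB_b t2, sub_self]
  · simp [bet, empty_of_not h]

lemma bet_AL (hμ : C.Mot μ) (v a : ι) :
    ∑ c ∈ C.N.filter (C.T v a), sg (C.D v a c) • C.AL μ v a c =
    C.bet μ v a • (C.p a - C.p v) := by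
  by_cases h : ∃ c, C.T v a c
  · obtain ⟨c, h⟩ := h
    obtain ⟨c1, c2, h12, t1, t2, h1, h2, hf⟩ := pair h
    have hb := bet_BB (C := C) (μ := μ) v a
    rw [sum_pair_smul h12 h1 h2 hf] at hb ⊢
    apply al_unique (cr_ne_of_dt (C.Tdet _ _ _ h))
    · have := AL_a hμ t1
      have := AL_a hμ t2
      rw [← hb, cr_sub_left, sub_add_sub_comm, AL_a hμ t1, AL_a hμ t2, sub_self]
    · rw [← hb, cr_sub_left, sub_add_sub_comm, AL_b hμ t1, AL_b hμ t2, sub_self]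
  · simp [bet, empty_of_not h]

lemma bet_sym (v a : ι) : C.bet μ v a = C.bet μ a v := by
  by_cases h : ∃ c, C.T v a c
  · obtain ⟨c, h⟩ := h
    have h1 := bet_BB (C := C) (μ := μ) v a
    have h2 := bet_BB (C := C) (μ := μ) a v
    have hne := cr_ne_of_dt (C.Tdet _ _ _ h)
    have hf : C.N.filter (C.T a v) = C.N.filter (C.T v a) := by
      ext w; simp only [Finset.mem_filter]
      exact and_congr_right fun _ => ⟨C.Tsw _ _ _, C.Tsw _ _ _⟩
    rw [hf, cr_swap, smul_neg] at h2
    have h3 : ∑ c ∈ C.N.filter (C.T v a), sg (C.D a v c) • C.BB μ a v c =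
        - ∑ c ∈ C.N.filter (C.T v a), sg (C.D v a c) • C.BB μ v a c := by
      rw [← Finset.sum_neg_distrib]
      refine Finset.sum_congr rfl fun c hc => ?_
      rw [BB_sw (Finset.mem_filter.1 hc).2, D, dt_swap, sg_neg, neg_smul]; rfl
    rw [h3, h1] at h2
    exact smul_left_injective _ hne (neg_injective h2)
  · have h' : ¬ ∃ c, C.T a v c := fun ⟨c, hc⟩ => h ⟨c, C.Tsw _ _ _ hc⟩
    simp [bet, empty_of_not h, empty_of_not h']

/-- equilibrium of the jump coefficients -/
lemma bet_equil (hμ : C.Mot μ) (v : ι) :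
    ∑ a ∈ C.N, C.bet μ v a • (C.p a - C.p v) = 0 := by
  rw [← Finset.sum_congr rfl (fun a _ => bet_AL hμ v a)]
  ext i
  simp only [Finset.sum_apply, Pi.smul_apply, smul_eq_mul, Pi.zero_apply]
  have := sum_swap C.N (C.T v) (fun a b h => Tswr h) (fun a c => sg (C.D v a c) * C.AL μ v a c i)
  have h2 : ∑ a ∈ C.N, ∑ c ∈ C.N.filter (C.T v a), sg (C.D v c a) * C.AL μ v c a i =
      - ∑ a ∈ C.N, ∑ c ∈ C.N.filter (C.T v a), sg (C.D v a c) * C.AL μ v a c i := by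
    simp only [← Finset.sum_neg_distrib]
    refine Finset.sum_congr rfl fun a _ => Finset.sum_congr rfl fun c hc => ?_
    have h := (Finset.mem_filter.1 hc).2
    rw [D_swr, sg_neg, ← AL_rot (Tswr h), AL_sw hμ (C.Tro _ _ _ h), AL_rot h, neg_mul]
  rw [h2] at this
  linarith

end Cfg
end D3b
end CSLB

namespace CSLB
section D3c
open Matrix

lemma dual_dot {n : ℕ} (f : Module.Dual ℝ (Fin n → ℝ)) : ∃ y : Fin n → ℝ, ∀ z, f z = y ⬝ᵥ z := by
  refine ⟨fun i => f (Pi.single i 1), fun z => ?_⟩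
  rw [LinearMap.pi_apply_eq_sum_univ f z]
  simp only [dotProduct, smul_eq_mul]
  refine Finset.sum_congr rfl fun i _ => ?_
  rw [mul_comm]; congr 2; ext j; simp [Pi.single_apply, eq_comm]

lemma exists_gh {ι : Type*} (S : Finset ι) (p : ι → Fin 3 → ℝ) (v : Fin 3 → ℝ)
    (hS : S.Nonempty) (hp : ∀ a ∈ S, cr v (p a) ≠ 0) :
    ∃ g h : Fin 3 → ℝ, cr g h = v ∧ ∀ a ∈ S, g ⬝ᵥ p a ≠ 0 := by
  obtain ⟨f, hf⟩ := Module.exists_dual_forall_apply_ne_zero (K := ℝ)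
    (fun a : S => cr v (p a)) (fun a => hp a a.2)
  obtain ⟨y, hy⟩ := dual_dot f
  have key : ∀ a ∈ S, cr v y ⬝ᵥ p a ≠ 0 := by
    intro a ha h0
    apply hf ⟨a, ha⟩
    rw [hy]
    have : y ⬝ᵥ cr v (p a) = - (cr v y ⬝ᵥ p a) := by
      simp [cr, dotProduct, Fin.sum_univ_three]; ring
    simp only [this, h0, neg_zero]
  obtain ⟨a, ha⟩ := hS
  have hg : cr v y ≠ 0 := fun h0 => key a ha (by rw [h0]; simp)
  refine ⟨cr v y, (cr v y ⬝ᵥ cr v y)⁻¹ • cr v (cr v y), ?_, key⟩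
  rw [cr_smul_right, cr_cr, cr_dot_left, zero_smul, sub_zero, smul_smul,
    inv_mul_cancel₀ (dot_self_ne hg), one_smul]

namespace Cfg
variable {ι : Type*} {C : Cfg ι} {μ : ι → Fin 3 → ℝ} {g h : Fin 3 → ℝ} {v : ι}

lemma om_D (hv : cr g h = C.p v) (a b : ι) :
    om (fun i => g ⬝ᵥ C.p i) (fun i => h ⬝ᵥ C.p i) a b = C.D v a b := by
  rw [D, ← hv]
  simp [om, dt, cr, dotProduct, Fin.sum_univ_three]; ring

lemma gv (hv : cr g h = C.p v) : g ⬝ᵥ C.p v = 0 := by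
  rw [← hv, dotProduct_comm, cr_dot_left]
lemma hv0 (hv : cr g h = C.p v) : h ⬝ᵥ C.p v = 0 := by
  rw [← hv, dotProduct_comm, cr_dot_right]

lemma pne {a b : ι} (ht : C.T v a b) : C.p v ≠ 0 := by
  intro h0; apply C.Tdet _ _ _ ht; rw [h0, dt, cr_zero_left]; simp

lemma xi_spec (hv : cr g h = C.p v) {a b : ι} (ht : C.T v a b) {B : Fin 3 → ℝ} {x : ι → ℝ}
    (h1 : B ⬝ᵥ C.p v = 0) (h2 : B ⬝ᵥ C.p a = x a) (h3 : B ⬝ᵥ C.p b = x b) :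
    cr g B = - (xi (fun i => g ⬝ᵥ C.p i) (fun i => h ⬝ᵥ C.p i) x a b) • C.p v := by
  have e1 : cr (cr g B) (C.p v) = 0 := by
    have : cr (cr g B) (C.p v) = (g ⬝ᵥ C.p v) • B - (B ⬝ᵥ C.p v) • g := by
      ext i; fin_cases i <;> simp [cr, dotProduct, Fin.sum_univ_three] <;> ring
    rw [this, gv hv, h1]; simp
  have e2 := par_of_cr (pne ht) e1
  set s := (cr g B ⬝ᵥ C.p v) / (C.p v ⬝ᵥ C.p v)
  rw [e2]
  congr 1
  have hD : C.D v a b ≠ 0 := C.Tdet _ _ _ ht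
  have e3 : dt (cr g B) (C.p a) (C.p b) = (g ⬝ᵥ C.p a) * x b - (g ⬝ᵥ C.p b) * x a := by
    rw [← h2, ← h3]
    simp [dt, cr, dotProduct, Fin.sum_univ_three]; ring
  rw [e2] at e3
  have e4 : dt (s • C.p v) (C.p a) (C.p b) = s * C.D v a b := by
    rw [dt, cr_smul_left, smul_dotProduct]; rfl
  rw [e4] at e3
  rw [xi, om_D hv, ← neg_div, eq_div_iff hD]
  linarith

lemma Sx_spec (hv : cr g h = C.p v) {a : ι} {x : ι → ℝ} {B : ι → Fin 3 → ℝ} {β : ℝ}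
    (hpv : C.p v ≠ 0)
    (hB : ∀ c, C.T v a c → B c ⬝ᵥ C.p v = 0 ∧ B c ⬝ᵥ C.p a = x a ∧ B c ⬝ᵥ C.p c = x c)
    (hs : ∑ c ∈ C.N.filter (C.T v a), sg (C.D v a c) • B c = β • cr (C.p v) (C.p a)) :
    Sx C.N (C.T v) (fun i => g ⬝ᵥ C.p i) (fun i => h ⬝ᵥ C.p i) x a = - β * (g ⬝ᵥ C.p a) := by
  have e1 : cr g (∑ c ∈ C.N.filter (C.T v a), sg (C.D v a c) • B c) =
      - Sx C.N (C.T v) (fun i => g ⬝ᵥ C.p i) (fun i => h ⬝ᵥ C.p i) x a • C.p v := by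
    rw [cr_sum_right, Sx, ← Finset.sum_neg_distrib, Finset.sum_smul]
    refine Finset.sum_congr rfl fun c hc => ?_
    have ht := (Finset.mem_filter.1 hc).2
    rw [cr_smul_right, xi_spec hv ht (hB c ht).1 (hB c ht).2.1 (hB c ht).2.2, om_D hv, smul_smul,
      mul_neg]
  rw [hs, cr_smul_right, cr_cr, gv hv, zero_smul, sub_zero, smul_smul] at e1
  have := smul_left_injective _ hpv e1
  linarith

lemma uniq2 (hv : cr g h = C.p v) {a b a' b' : ι} (t : C.T v a b) (t' : C.T v a' b')
    (ga : 0 < g ⬝ᵥ C.p a) (gb : g ⬝ᵥ C.p b < 0) (ga' : 0 < g ⬝ᵥ C.p a') (gb' : g ⬝ᵥ C.p b' < 0)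
    (ho : 0 < C.D v a b * C.D v a' b') : a = a' ∧ b = b' := by
  obtain ⟨q, q1, q2, q3, q4⟩ := C.Tq _ _ _ t
  obtain ⟨r, r1, r2, r3, r4⟩ := C.Tq _ _ _ t'
  have qle : ∀ w ∈ C.N, q ⬝ᵥ C.p w ≤ 1 := by
    intro w hw
    by_cases h1 : w = v; · rw [h1, q1]
    by_cases h2 : w = a; · rw [h2, q2]
    by_cases h3 : w = b; · rw [h3, q3]
    exact (q4 w hw h1 h2 h3).le
  have rle : ∀ w ∈ C.N, r ⬝ᵥ C.p w ≤ 1 := by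
    intro w hw
    by_cases h1 : w = v; · rw [h1, r1]
    by_cases h2 : w = a'; · rw [h2, r2]
    by_cases h3 : w = b'; · rw [h3, r3]
    exact (r4 w hw h1 h2 h3).le
  have hD : C.D v a b ≠ 0 := C.Tdet _ _ _ t
  have hθ : 0 < C.D v a' b' / C.D v a b := by
    have : C.D v a' b' / C.D v a b = (C.D v a b * C.D v a' b') / (C.D v a b) ^ 2 := by
      unfold D; field_simp
    rw [this]; apply div_pos ho; unfold D; positivity
  set θ := C.D v a' b' / C.D v a b with hθd
  set y := (g ⬝ᵥ C.p a) • C.p b - (g ⬝ᵥ C.p b) • C.p a with hy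
  set y' := (g ⬝ᵥ C.p a') • C.p b' - (g ⬝ᵥ C.p b') • C.p a' with hy'
  have hpar : cr (y' - θ • y) (C.p v) = 0 := by
    have e1 : g ⬝ᵥ (y' - θ • y) = 0 := by
      rw [hy, hy']
      simp only [dotProduct_sub, dotProduct_smul, smul_eq_mul]; ring
    have e2 : h ⬝ᵥ (y' - θ • y) = 0 := by
      have e3 : h ⬝ᵥ (y' - θ • y) = C.D v a' b' - θ * C.D v a b := by
        rw [hy, hy', ← om_D hv, ← om_D hv]
        simp only [dotProduct_sub, dotProduct_smul, smul_eq_mul, om]; ring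
      rw [e3, hθd, div_mul_cancel₀ _ hD, sub_self]
    rw [← hv, cr_cr, dotProduct_comm, e2, dotProduct_comm, e1]; simp
  have e5 := par_of_cr (pne t) hpar
  set s := ((y' - θ • y) ⬝ᵥ C.p v) / (C.p v ⬝ᵥ C.p v)
  have e6 : y' = θ • y + s • C.p v := by rw [← e5]; abel
  have q5 : q ⬝ᵥ y' = θ * (g ⬝ᵥ C.p a - g ⬝ᵥ C.p b) + s := by
    rw [e6, hy]; simp only [dotProduct_add, dotProduct_sub, dotProduct_smul, smul_eq_mul, q1, q2, q3]
    ring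
  have r5 : r ⬝ᵥ y' = g ⬝ᵥ C.p a' - g ⬝ᵥ C.p b' := by
    rw [hy']; simp only [dotProduct_sub, dotProduct_smul, smul_eq_mul, r2, r3]; ring
  have r6 : r ⬝ᵥ y' = θ * (r ⬝ᵥ y) + s := by
    rw [e6]; simp only [dotProduct_add, dotProduct_smul, smul_eq_mul, r1]; ring
  have r7 : r ⬝ᵥ y ≤ g ⬝ᵥ C.p a - g ⬝ᵥ C.p b := by
    rw [hy]; simp only [dotProduct_sub, dotProduct_smul, smul_eq_mul]
    have := rle a (TNb t); have := rle b (TNc t)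
    nlinarith
  have q6 : q ⬝ᵥ y' = (g ⬝ᵥ C.p a') * (q ⬝ᵥ C.p b') - (g ⬝ᵥ C.p b') * (q ⬝ᵥ C.p a') := by
    rw [hy']; simp only [dotProduct_sub, dotProduct_smul, smul_eq_mul]
  have h8 : (g ⬝ᵥ C.p a') * (1 - q ⬝ᵥ C.p b') + (-(g ⬝ᵥ C.p b')) * (1 - q ⬝ᵥ C.p a') ≤ 0 := by
    nlinarith [mul_le_mul_of_nonneg_left r7 hθ.le]
  have hb := qle b' (TNc t')
  have ha := qle a' (TNb t')
  have z1 : 0 ≤ (g ⬝ᵥ C.p a') * (1 - q ⬝ᵥ C.p b') := mul_nonneg ga'.le (by linarith)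
  have z2 : 0 ≤ (-(g ⬝ᵥ C.p b')) * (1 - q ⬝ᵥ C.p a') := mul_nonneg (by linarith) (by linarith)
  have hb1 : q ⬝ᵥ C.p b' = 1 := by
    have : (g ⬝ᵥ C.p a') * (1 - q ⬝ᵥ C.p b') = 0 := by linarith
    rcases mul_eq_zero.1 this with h | h <;> linarith
  have ha1 : q ⬝ᵥ C.p a' = 1 := by
    have : (-(g ⬝ᵥ C.p b')) * (1 - q ⬝ᵥ C.p a') = 0 := by linarith
    rcases mul_eq_zero.1 this with h | h <;> linarith
  constructor
  · by_contra hne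
    refine absurd (q4 a' (TNb t') (Tne t').symm (Ne.symm hne) ?_) (by rw [ha1]; exact lt_irrefl _)
    rintro rfl; linarith
  · by_contra hne
    refine absurd (q4 b' (TNc t') (Tne3 t').symm ?_ (Ne.symm hne)) (by rw [hb1]; exact lt_irrefl _)
    rintro rfl; linarith


lemma q_le {a b c : ι} {q : Fin 3 → ℝ} (q1 : q ⬝ᵥ C.p a = 1) (q2 : q ⬝ᵥ C.p b = 1)
    (q3 : q ⬝ᵥ C.p c = 1) (q4 : ∀ w ∈ C.N, w ≠ a → w ≠ b → w ≠ c → q ⬝ᵥ C.p w < 1) :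
    ∀ w ∈ C.N, q ⬝ᵥ C.p w ≤ 1 := by
  intro w hw
  by_cases h1 : w = a; · rw [h1, q1]
  by_cases h2 : w = b; · rw [h2, q2]
  by_cases h3 : w = c; · rw [h3, q3]
  exact (q4 w hw h1 h2 h3).le

theorem local_ineq (hμ : C.Mot μ) {a0 b0 : ι} (t0 : C.T v a0 b0) :
    ∑ a ∈ C.N, C.bet μ v a * (μ a ⬝ᵥ C.p a - μ v ⬝ᵥ C.p v) ≤ 0 ∧
    (∑ a ∈ C.N, C.bet μ v a * (μ a ⬝ᵥ C.p a - μ v ⬝ᵥ C.p v) = 0 →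
      ∀ a ∈ C.N, C.bet μ v a = 0) := by
  set S := C.N.filter (fun a => ∃ c, C.T v a c) with hS
  have hpv := pne t0
  have hSne : S.Nonempty := ⟨a0, Finset.mem_filter.2 ⟨TNb t0, b0, t0⟩⟩
  obtain ⟨g, h, hv, hg⟩ := exists_gh S C.p (C.p v) hSne (by
    intro a ha
    obtain ⟨_, c, hc⟩ := Finset.mem_filter.1 ha
    exact cr_ne_of_dt (C.Tdet _ _ _ hc))
  have hg' : ∀ a c, C.T v a c → g ⬝ᵥ C.p a ≠ 0 := fun a c hc =>
    hg a (Finset.mem_filter.2 ⟨TNb hc, c, hc⟩)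
  obtain ⟨f, f1, f2, f3, f4⟩ := C.Tq _ _ _ t0
  have fle := q_le f1 f2 f3 f4
  choose! q q1 q2 q3 q4 using C.Tq
  -- the auxiliary vector
  set h0 : Fin 3 → ℝ := ((μ v ⬝ᵥ C.p v) / (C.p v ⬝ᵥ C.p v)) • C.p v with hh0
  have h0v : h0 ⬝ᵥ C.p v = μ v ⬝ᵥ C.p v := by
    rw [hh0, smul_dotProduct, smul_eq_mul, div_mul_cancel₀ _ (dot_self_ne hpv)]
  set x : ι → ℝ := fun a => μ a ⬝ᵥ C.p a - h0 ⬝ᵥ C.p a with hx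
  set l : ι → ℝ := fun a => 1 - f ⬝ᵥ C.p a with hl
  have Sxx : ∀ a, Sx C.N (C.T v) (fun i => g ⬝ᵥ C.p i) (fun i => h ⬝ᵥ C.p i) x a =
      - C.bet μ v a * (g ⬝ᵥ C.p a) := by
    intro a
    refine Sx_spec hv (B := fun c => C.BB μ v a c - h0) hpv (fun c hc => ⟨?_, ?_, ?_⟩) ?_
    · rw [sub_dotProduct, BB_a hc, h0v, sub_self]
    · rw [sub_dotProduct, BB_b hc]
    · rw [sub_dotProduct, BB_c hc]
    · simp only [smul_sub]
      rw [Finset.sum_sub_distrib, ← Finset.sum_smul, bal, zero_smul, sub_zero, bet_BB]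
  have Sxl : ∀ a, ∃ lam : ℝ, (0 ≤ lam ∧ ((∃ c, C.T v a c) → 0 < lam)) ∧
      Sx C.N (C.T v) (fun i => g ⬝ᵥ C.p i) (fun i => h ⬝ᵥ C.p i) l a = - lam * (g ⬝ᵥ C.p a) := by
    intro a
    by_cases hc : ∃ c, C.T v a c
    · obtain ⟨c, hc⟩ := hc
      obtain ⟨c1, c2, h12, t1, t2, d1, d2, hf⟩ := pair hc
      have hcr := cr_ne_of_dt (C.Tdet _ _ _ hc)
      have e := perp_cr (y := q v a c1 - q v a c2) hcr
        (by rw [sub_dotProduct, q1 _ _ _ t1, q1 _ _ _ t2, sub_self])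
        (by rw [sub_dotProduct, q2 _ _ _ t1, q2 _ _ _ t2, sub_self])
      set t := ((q v a c1 - q v a c2) ⬝ᵥ cr (C.p v) (C.p a)) /
        (cr (C.p v) (C.p a) ⬝ᵥ cr (C.p v) (C.p a))
      have ht : 0 < t := by
        have e2 : t * C.D v a c1 = 1 - q v a c2 ⬝ᵥ C.p c1 := by
          rw [← q3 _ _ _ t1, ← sub_dotProduct, e, smul_dotProduct]; rfl
        have := q4 _ _ _ t2 c1 (TNc t1) (Tne3 t1).symm (Tne2 t1).symm h12
        exact pos_of_mul_pos_left (by rw [e2]; linarith) d1.le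
      refine ⟨t, ⟨ht.le, fun _ => ht⟩, Sx_spec hv (B := fun c => q v a c - f) hpv
        (fun c hc => ⟨?_, ?_, ?_⟩) ?_⟩
      · rw [sub_dotProduct, q1 _ _ _ hc, f1, sub_self]
      · rw [sub_dotProduct, q2 _ _ _ hc]
      · rw [sub_dotProduct, q3 _ _ _ hc]
      · simp only [smul_sub]
        rw [Finset.sum_sub_distrib, ← Finset.sum_smul, bal, zero_smul, sub_zero,
          sum_pair_smul h12 d1 d2 hf, e]
    · refine ⟨0, ⟨le_refl _, fun h => absurd h hc⟩, ?_⟩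
      rw [Sx, empty_of_not hc]; simp
  have eq1 := bet_equil hμ v
  have Dsum : ∀ w : Fin 3 → ℝ, ∑ a ∈ C.N, C.bet μ v a * (w ⬝ᵥ C.p a - w ⬝ᵥ C.p v) = 0 := by
    intro w
    have : w ⬝ᵥ (∑ a ∈ C.N, C.bet μ v a • (C.p a - C.p v)) = 0 := by rw [eq1]; simp
    rw [dotProduct_sum] at this
    simpa only [dotProduct_smul, dotProduct_sub, smul_eq_mul] using this
  have bz : ∀ a, (¬ ∃ c, C.T v a c) → C.bet μ v a = 0 := by
    intro a ha; simp [bet, empty_of_not ha]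
  have conv : ∀ y : ι → ℝ, ∑ a ∈ C.N, Sx C.N (C.T v) (fun i => g ⬝ᵥ C.p i) (fun i => h ⬝ᵥ C.p i) x a
      / (g ⬝ᵥ C.p a) * y a = - ∑ a ∈ C.N, C.bet μ v a * y a := by
    intro y
    rw [← Finset.sum_neg_distrib]
    refine Finset.sum_congr rfl fun a _ => ?_
    rw [Sxx]
    by_cases ha : ∃ c, C.T v a c
    · obtain ⟨c, hc⟩ := ha
      have := hg' _ _ hc
      field_simp
    · rw [bz a ha]; simp
  have key := L2 (N := C.N) (E := C.T v) (g := fun i => g ⬝ᵥ C.p i) (h := fun i => h ⬝ᵥ C.p i)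
    (fun a b hab => by rw [om_D hv]; exact C.Tdet _ _ _ hab) hg' (fun a b hab => Tswr hab)
    (fun a _ => by simp only [om_D hv]; exact bal v a)
    (fun a b a' b' t t' h1 h2 h3 h4 h5 => by
      rw [om_D hv, om_D hv] at h5
      exact uniq2 hv t t' h1 h2 h3 h4 h5) x l
    (by
      rw [conv, neg_eq_zero, ← neg_eq_zero, ← Finset.sum_neg_distrib, ← Dsum f]
      refine Finset.sum_congr rfl fun a _ => ?_
      rw [hl, f1]; ring)
    (by
      choose lam hlam1 hlam2 using Sxl
      have e : ∑ a ∈ C.N, Sx C.N (C.T v) (fun i => g ⬝ᵥ C.p i) (fun i => h ⬝ᵥ C.p i) l a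
          / (g ⬝ᵥ C.p a) * l a = - ∑ a ∈ C.N, (if ∃ c, C.T v a c then lam a * l a else 0) := by
        rw [← Finset.sum_neg_distrib]
        refine Finset.sum_congr rfl fun a _ => ?_
        by_cases ha : ∃ c, C.T v a c
        · rw [if_pos ha, hlam2]
          obtain ⟨c, hc⟩ := ha
          have := hg' _ _ hc
          field_simp
        · rw [if_neg ha, Sx, empty_of_not ha]; simp
      rw [e, neg_lt_zero]
      obtain ⟨c', hne, hc'⟩ := C.Tpiv _ _ _ t0
      refine Finset.sum_pos' (fun a ha => ?_) ⟨c', TNc hc', ?_⟩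
      · split_ifs
        · exact mul_nonneg (hlam1 a).1 (by have := fle a ha; simp only [hl]; linarith)
        · exact le_refl _
      · have hex : ∃ c, C.T v c' c := ⟨a0, Tswr hc'⟩
        rw [if_pos hex]
        refine mul_pos ((hlam1 c').2 hex) ?_
        have := f4 c' (TNc hc') (Tne3 hc').symm (Tne2 hc').symm hne
        simp only [hl]; linarith)
  have B : ∑ a ∈ C.N, C.bet μ v a * x a =
      ∑ a ∈ C.N, C.bet μ v a * (μ a ⬝ᵥ C.p a - μ v ⬝ᵥ C.p v) := by
    rw [← sub_eq_zero, ← Finset.sum_sub_distrib, ← neg_eq_zero, ← Finset.sum_neg_distrib, ← Dsum h0]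
    refine Finset.sum_congr rfl fun a _ => ?_
    rw [hx, h0v]; ring
  rw [conv, B] at key
  refine ⟨by linarith [key.1], fun hz a ha => ?_⟩
  by_cases hex : ∃ c, C.T v a c
  · have h1 := key.2 (by rw [hz, neg_zero]) a ha
    rw [Sxx] at h1
    obtain ⟨c, hc⟩ := hex
    rcases mul_eq_zero.1 h1 with h2 | h2
    · linarith
    · exact absurd h2 (hg' _ _ hc)
  · exact bz a hex

theorem bet_zero (hμ : C.Mot μ) (v a : ι) (hv : v ∈ C.N) (ha : a ∈ C.N) : C.bet μ v a = 0 := by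
  have hle : ∀ v ∈ C.N, ∑ a ∈ C.N, C.bet μ v a * (μ a ⬝ᵥ C.p a - μ v ⬝ᵥ C.p v) ≤ 0 ∧
    (∑ a ∈ C.N, C.bet μ v a * (μ a ⬝ᵥ C.p a - μ v ⬝ᵥ C.p v) = 0 →
      ∀ a ∈ C.N, C.bet μ v a = 0) := by
    intro v _
    by_cases hex : ∃ a c, C.T v a c
    · obtain ⟨a, c, h⟩ := hex
      exact local_ineq hμ h
    · have : ∀ a, C.bet μ v a = 0 := fun a => by
        have : ¬ ∃ c, C.T v a c := fun ⟨c, hc⟩ => hex ⟨a, c, hc⟩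
        simp [bet, empty_of_not this]
      simp [this]
  have htot : ∑ v ∈ C.N, ∑ a ∈ C.N, C.bet μ v a * (μ a ⬝ᵥ C.p a - μ v ⬝ᵥ C.p v) = 0 := by
    have e := Finset.sum_comm (s := C.N) (t := C.N)
      (f := fun v a => C.bet μ v a * (μ a ⬝ᵥ C.p a - μ v ⬝ᵥ C.p v))
    have e2 : ∑ a ∈ C.N, ∑ v ∈ C.N, C.bet μ v a * (μ a ⬝ᵥ C.p a - μ v ⬝ᵥ C.p v) =
       - ∑ v ∈ C.N, ∑ a ∈ C.N, C.bet μ v a * (μ a ⬝ᵥ C.p a - μ v ⬝ᵥ C.p v) := by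
      simp only [← Finset.sum_neg_distrib]
      refine Finset.sum_congr rfl fun a _ => Finset.sum_congr rfl fun b _ => ?_
      rw [bet_sym]; ring
    rw [e2] at e
    linarith
  have hz := (Finset.sum_eq_zero_iff_of_nonpos (fun v hv => (hle v hv).1)).1 htot v hv
  exact (hle v hv).2 hz a ha

theorem step (hμ : C.Mot μ) {a b c c' : ι} (h : C.T a b c) (h' : C.T a b c')
    (za : μ a = 0) (zb : μ b = 0) (zc : μ c = 0) : μ c' = 0 := by
  by_cases hne : c' = c
  · rw [hne, zc]
  have b0 := bet_zero hμ a b (C.TN _ _ _ h) (TNb h)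
  have e1 := bet_BB (C := C) (μ := μ) a b
  have e2 := bet_AL hμ a b
  rw [b0, zero_smul] at e1 e2
  have hB : C.BB μ a b c = 0 := by
    rw [BB, za, zb, zc]; simp [bbv]
  have hA : C.AL μ a b c = 0 := by
    rw [AL, hB, za, zb, zc]; simp [alv]
  obtain ⟨c1, c2, h12, t1, t2, d1, d2, hf⟩ := pair h
  rw [sum_pair_smul h12 d1 d2 hf, sub_eq_zero] at e1 e2
  have mc : c ∈ ({c1, c2} : Finset ι) := hf ▸ Finset.mem_filter.2 ⟨TNc h, h⟩
  have mc' : c' ∈ ({c1, c2} : Finset ι) := hf ▸ Finset.mem_filter.2 ⟨TNc h', h'⟩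
  simp only [Finset.mem_insert, Finset.mem_singleton] at mc mc'
  have hB' : C.BB μ a b c' = 0 := by
    rcases mc with rfl | rfl <;> rcases mc' with rfl | rfl <;> simp_all
  have hA' : C.AL μ a b c' = 0 := by
    rcases mc with rfl | rfl <;> rcases mc' with rfl | rfl <;> simp_all
  have := AL_c hμ h'
  rw [hB', hA', cr_zero_left, add_zero] at this
  exact this.symm

/-- Dehn rigidity for a strictly convex simplicial sphere -/
theorem rigid (hμ : C.Mot μ) {a0 b0 c0 : ι}
    (conn : ∀ Q : ι → ι → ι → Prop, (∀ a b c, Q a b c → Q b a c) → (∀ a b c, Q a b c → Q b c a) →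
      (∀ a b c c', C.T a b c → C.T a b c' → Q a b c → Q a b c') → Q a0 b0 c0 →
      ∀ a b c, C.T a b c → Q a b c)
    (za : μ a0 = 0) (zb : μ b0 = 0) (zc : μ c0 = 0) :
    ∀ a b c, C.T a b c → μ a = 0 ∧ μ b = 0 ∧ μ c = 0 := by
  apply conn (fun a b c => μ a = 0 ∧ μ b = 0 ∧ μ c = 0)
  · rintro a b c ⟨h1, h2, h3⟩; exact ⟨h2, h1, h3⟩
  · rintro a b c ⟨h1, h2, h3⟩; exact ⟨h2, h3, h1⟩
  · rintro a b c c' h h' ⟨h1, h2, h3⟩; exact ⟨h1, h2, step hμ h h' h1 h2 h3⟩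
  · exact ⟨za, zb, zc⟩

end Cfg
end D3c
end CSLB

namespace CSLB
section Geo
open Matrix

/-- pointwise negation of a finset -/
def ng {d : ℕ} (s : Finset (Fin d → ℝ)) : Finset (Fin d → ℝ) := s.image Neg.neg

lemma mem_ng {d : ℕ} {s : Finset (Fin d → ℝ)} {v : Fin d → ℝ} : v ∈ ng s ↔ -v ∈ s := by
  unfold ng
  simp only [Finset.mem_image]
  constructor
  · rintro ⟨a, ha, rfl⟩; simpa using ha
  · intro h; exact ⟨-v, h, by simp⟩
lemma ng_ng {d : ℕ} (s : Finset (Fin d → ℝ)) : ng (ng s) = s := by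
  ext v; simp [mem_ng]
lemma ng_insert {d : ℕ} (a : Fin d → ℝ) (s : Finset (Fin d → ℝ)) :
    ng (insert a s) = insert (-a) (ng s) := by
  simp [ng, Finset.image_insert]
lemma ng_union {d : ℕ} (s t : Finset (Fin d → ℝ)) : ng (s ∪ t) = ng s ∪ ng t := by
  simp [ng, Finset.image_union]
lemma card_ng {d : ℕ} (s : Finset (Fin d → ℝ)) : (ng s).card = s.card :=
  Finset.card_image_of_injective _ neg_injective

/-- a centrally symmetric simplicial polytope in polar form -/
structure CSP (d : ℕ) where
  V : Finset (Fin d → ℝ)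
  neg : ∀ v ∈ V, -v ∈ V
  span : Submodule.span ℝ (V : Set (Fin d → ℝ)) = ⊤
  simp : ∀ q : Fin d → ℝ, (∀ v ∈ V, q ⬝ᵥ v ≤ 1) →
    LinearIndepOn ℝ id {v : Fin d → ℝ | v ∈ V ∧ q ⬝ᵥ v = 1}
  ext : ∀ v ∈ V, ∃ q : Fin d → ℝ, (∀ w ∈ V, q ⬝ᵥ w ≤ 1) ∧ q ⬝ᵥ v = 1

/-- prescribed dot products on a linearly independent set -/
lemma interp {d : ℕ} {s : Set (Fin d → ℝ)} (hs : LinearIndepOn ℝ id s) (x : (Fin d → ℝ) → ℝ) :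
    ∃ h : Fin d → ℝ, ∀ v ∈ s, h ⬝ᵥ v = x v := by
  let b := Module.Basis.extend hs
  obtain ⟨y, hy⟩ := dual_dot (b.constr ℝ (fun i => x i))
  refine ⟨y, fun v hv => ?_⟩
  rw [← hy]
  have hv' : v ∈ hs.extend (Set.subset_univ _) := hs.subset_extend _ hv
  have hb : b ⟨v, hv'⟩ = v := by simp [b]
  conv_lhs => rw [← hb]
  rw [Module.Basis.constr_basis]

lemma span_top_of_card {d : ℕ} {s : Finset (Fin d → ℝ)} (hs : LinearIndepOn ℝ id (s : Set (Fin d → ℝ)))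
    (hc : s.card = d) : Submodule.span ℝ (s : Set (Fin d → ℝ)) = ⊤ := by
  have h1 : LinearIndependent ℝ (fun x : s => (x : Fin d → ℝ)) := hs
  have := h1.span_eq_top_of_card_eq_finrank' (by simp [hc])
  simpa using this

lemma card_le_of_li {d : ℕ} {s : Finset (Fin d → ℝ)} (hs : LinearIndepOn ℝ id (s : Set (Fin d → ℝ))) :
    s.card ≤ d := by
  have h1 : LinearIndependent ℝ (fun x : s => (x : Fin d → ℝ)) := hs
  simpa using h1.fintype_card_le_finrank

lemma ext_span {d : ℕ} {s : Set (Fin d → ℝ)} (hs : Submodule.span ℝ s = ⊤) {y z : Fin d → ℝ}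
    (h : ∀ v ∈ s, y ⬝ᵥ v = z ⬝ᵥ v) : y = z := by
  have key : ∀ v, y ⬝ᵥ v = z ⬝ᵥ v := by
    intro v
    have hv : v ∈ Submodule.span ℝ s := hs ▸ Submodule.mem_top
    induction hv using Submodule.span_induction with
    | mem x hx => exact h x hx
    | zero => simp
    | add a b _ _ h1 h2 => rw [dotProduct_add, dotProduct_add, h1, h2]
    | smul t a _ h1 => rw [dotProduct_smul, dotProduct_smul, h1]
  have := key (y - z)
  rw [← sub_eq_zero, ← sub_dotProduct, dotProduct_self_eq_zero] at this
  exact sub_eq_zero.1 this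

namespace CSP
variable {d : ℕ} (K : CSP d)

/-- feasible functionals -/
def Feas (q : Fin d → ℝ) : Prop := ∀ v ∈ K.V, q ⬝ᵥ v ≤ 1
/-- faces -/
def Face (s : Finset (Fin d → ℝ)) : Prop := s ⊆ K.V ∧ ∃ q, K.Feas q ∧ ∀ v ∈ s, q ⬝ᵥ v = 1
/-- facets -/
def Facet (s : Finset (Fin d → ℝ)) : Prop := K.Face s ∧ s.card = d
/-- tight set -/
def tight (q : Fin d → ℝ) : Finset (Fin d → ℝ) := K.V.filter fun v => q ⬝ᵥ v = 1

variable {K}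
lemma Face.mono {s t : Finset (Fin d → ℝ)} (h : K.Face t) (hst : s ⊆ t) : K.Face s :=
  ⟨hst.trans h.1, h.2.imp fun _ hq => ⟨hq.1, fun v hv => hq.2 v (hst hv)⟩⟩
lemma Face.ng {s : Finset (Fin d → ℝ)} (h : K.Face s) : K.Face (ng s) := by
  obtain ⟨h1, q, h2, h3⟩ := h
  refine ⟨fun v hv => ?_, -q, fun v hv => ?_, fun v hv => ?_⟩
  · have := K.neg _ (h1 (mem_ng.1 hv)); rwa [neg_neg] at this
  · have := h2 _ (K.neg v hv); rwa [dotProduct_neg, ← neg_dotProduct] at this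
  · have := h3 _ (mem_ng.1 hv); rwa [dotProduct_neg, ← neg_dotProduct] at this
lemma face_ng_iff {s : Finset (Fin d → ℝ)} : K.Face (CSLB.ng s) ↔ K.Face s :=
  ⟨fun h => by simpa [ng_ng] using h.ng, fun h => h.ng⟩
lemma Face.no_anti {s : Finset (Fin d → ℝ)} (h : K.Face s) {v : Fin d → ℝ} (hv : v ∈ s) : -v ∉ s := by
  obtain ⟨_, q, _, h3⟩ := h
  intro hn
  have h1 := h3 _ hv
  have h2 := h3 _ hn
  rw [dotProduct_neg] at h2; linarith
lemma Face.ne_neg {s : Finset (Fin d → ℝ)} (h : K.Face s) {v : Fin d → ℝ} (hv : v ∈ s) : v ≠ -v :=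
  fun he => h.no_anti hv (he ▸ hv)
lemma face_tight {q : Fin d → ℝ} (hq : K.Feas q) : K.Face (K.tight q) :=
  ⟨Finset.filter_subset _ _, q, hq, fun _ hv => (Finset.mem_filter.1 hv).2⟩
lemma Face.li {s : Finset (Fin d → ℝ)} (h : K.Face s) : LinearIndepOn ℝ id (s : Set (Fin d → ℝ)) := by
  obtain ⟨h1, q, h2, h3⟩ := h
  exact (K.simp q h2).mono fun v hv => ⟨h1 hv, h3 v hv⟩
lemma Face.card_le {s : Finset (Fin d → ℝ)} (h : K.Face s) : s.card ≤ d := card_le_of_li h.li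
lemma Face.mem {s : Finset (Fin d → ℝ)} (h : K.Face s) {v : Fin d → ℝ} (hv : v ∈ s) : v ∈ K.V := h.1 hv
lemma face_single {v : Fin d → ℝ} (hv : v ∈ K.V) : K.Face {v} := by
  obtain ⟨q, h1, h2⟩ := K.ext v hv
  exact ⟨by simpa using hv, q, h1, by simpa using h2⟩
lemma V_ne_zero {v : Fin d → ℝ} (hv : v ∈ K.V) : v ≠ 0 := by
  obtain ⟨q, h1, h2⟩ := K.ext v hv
  rintro rfl; simp at h2
lemma V_ne_neg {v : Fin d → ℝ} (hv : v ∈ K.V) : v ≠ -v :=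
  (face_single hv).ne_neg (by simp)

lemma push {q n : Fin d → ℝ} (hq : K.Feas q) (hn : ∀ v ∈ K.V, q ⬝ᵥ v = 1 → n ⬝ᵥ v ≤ 0)
    {w : Fin d → ℝ} (hw : w ∈ K.V) (hnw : 0 < n ⬝ᵥ w) :
    ∃ t : ℝ, 0 < t ∧ K.Feas (q + t • n) ∧ ∃ v' ∈ K.V, 0 < n ⬝ᵥ v' ∧ (q + t • n) ⬝ᵥ v' = 1 := by
  set S := K.V.filter fun v => 0 < n ⬝ᵥ v with hS
  obtain ⟨v', hv', hmin⟩ := Finset.exists_min_image S (fun v => (1 - q ⬝ᵥ v) / (n ⬝ᵥ v))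
    ⟨w, Finset.mem_filter.2 ⟨hw, hnw⟩⟩
  obtain ⟨hvV, hnv⟩ := Finset.mem_filter.1 hv'
  have hlt : q ⬝ᵥ v' < 1 := by
    refine lt_of_le_of_ne (hq v' hvV) fun h => ?_
    have := hn v' hvV h; linarith
  have htpos : 0 < (1 - q ⬝ᵥ v') / (n ⬝ᵥ v') := div_pos (by linarith) hnv
  refine ⟨(1 - q ⬝ᵥ v') / (n ⬝ᵥ v'), htpos, fun v hv => ?_, v', hvV, hnv, ?_⟩
  · rw [add_dotProduct, smul_dotProduct, smul_eq_mul]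
    by_cases h : 0 < n ⬝ᵥ v
    · have := hmin v (Finset.mem_filter.2 ⟨hv, h⟩)
      rw [le_div_iff₀ h] at this
      linarith
    · have := hq v hv
      nlinarith
  · rw [add_dotProduct, smul_dotProduct, smul_eq_mul]
    field_simp; ring

lemma exists_perp {s : Finset (Fin d → ℝ)} (hs : s.card < d) :
    ∃ n : Fin d → ℝ, n ≠ 0 ∧ ∀ v ∈ s, n ⬝ᵥ v = 0 := by
  have hlt : Submodule.span ℝ (s : Set (Fin d → ℝ)) < ⊤ := by
    rw [lt_top_iff_ne_top]
    intro h
    have h1 := finrank_span_finset_le_card (R := ℝ) s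
    rw [Set.finrank, h, finrank_top] at h1
    simp at h1; omega
  obtain ⟨f, hf, hf2⟩ := Submodule.exists_le_ker_of_lt_top _ hlt
  obtain ⟨y, hy⟩ := dual_dot f
  refine ⟨y, ?_, fun v hv => ?_⟩
  · rintro rfl; apply hf; ext z; simp [hy]
  · rw [← hy]; exact hf2 (Submodule.subset_span hv)

lemma exists_pos {n : Fin d → ℝ} (hn : n ≠ 0) : ∃ w ∈ K.V, 0 < n ⬝ᵥ w := by
  by_contra hcon
  push Not at hcon
  apply hn
  apply ext_span K.span
  intro v hv
  have h1 := hcon v hv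
  have h2 := hcon _ (K.neg v hv)
  rw [dotProduct_neg] at h2
  rw [zero_dotProduct]; linarith

lemma Face.exists_facet {s : Finset (Fin d → ℝ)} (h : K.Face s) : ∃ F, s ⊆ F ∧ K.Facet F := by
  set S := K.V.powerset.filter fun t => s ⊆ t ∧ K.Face t
  obtain ⟨F, hF, hmax⟩ := Finset.exists_max_image S (fun t => t.card)
    ⟨s, Finset.mem_filter.2 ⟨Finset.mem_powerset.2 h.1, subset_rfl, h⟩⟩
  obtain ⟨_, hsF, hFf⟩ := Finset.mem_filter.1 hF
  refine ⟨F, hsF, hFf, ?_⟩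
  by_contra hne
  have hlt : F.card < d := lt_of_le_of_ne hFf.card_le hne
  obtain ⟨hFV, q, hq, hq1⟩ := hFf
  have hFt : F = K.tight q := by
    apply Finset.eq_of_subset_of_card_le
    · exact fun v hv => Finset.mem_filter.2 ⟨hFV hv, hq1 v hv⟩
    · refine hmax _ (Finset.mem_filter.2 ⟨Finset.mem_powerset.2 (Finset.filter_subset _ _), ?_, face_tight hq⟩)
      exact fun v hv => Finset.mem_filter.2 ⟨h.1 hv, hq1 v (hsF hv)⟩
  obtain ⟨n, hn0, hn⟩ := exists_perp hlt
  obtain ⟨w, hw, hnw⟩ := exists_pos (K := K) hn0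
  obtain ⟨t, _, hf, v', hv', hnv', hv1⟩ := push hq (fun v hv hv1 =>
    (hn v (hFt ▸ Finset.mem_filter.2 ⟨hv, hv1⟩)).le) hw hnw
  have hsub : insert v' F ⊆ K.tight (q + t • n) := by
    intro v hv
    rcases Finset.mem_insert.1 hv with rfl | hv
    · exact Finset.mem_filter.2 ⟨hv', hv1⟩
    · refine Finset.mem_filter.2 ⟨hFV hv, ?_⟩
      rw [add_dotProduct, smul_dotProduct, hn v hv, hq1 v hv]; simp
  have hv'F : v' ∉ F := fun hc => by rw [hn v' hc] at hnv'; exact lt_irrefl _ hnv'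
  have hm := hmax (K.tight (q + t • n)) (Finset.mem_filter.2 ⟨Finset.mem_powerset.2
    (Finset.filter_subset _ _), (hsF.trans (Finset.subset_insert _ _)).trans hsub, face_tight hf⟩)
  have := Finset.card_le_card hsub
  rw [Finset.card_insert_of_notMem hv'F] at this
  omega

lemma Facet.q {F : Finset (Fin d → ℝ)} (h : K.Facet F) :
    ∃ q, K.Feas q ∧ (∀ v ∈ F, q ⬝ᵥ v = 1) ∧ ∀ v ∈ K.V, v ∉ F → q ⬝ᵥ v < 1 := by
  obtain ⟨⟨hFV, q, hq, hq1⟩, hc⟩ := h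
  refine ⟨q, hq, hq1, fun v hv hvF => lt_of_le_of_ne (hq v hv) fun he => ?_⟩
  have hsub : insert v F ⊆ K.tight q := by
    intro w hw
    rcases Finset.mem_insert.1 hw with rfl | hw
    · exact Finset.mem_filter.2 ⟨hv, he⟩
    · exact Finset.mem_filter.2 ⟨hFV hw, hq1 w hw⟩
  have := (Finset.card_le_card hsub).trans (face_tight hq).card_le
  rw [Finset.card_insert_of_notMem hvF] at this
  omega

lemma Facet.span {F : Finset (Fin d → ℝ)} (h : K.Facet F) :
    Submodule.span ℝ (F : Set (Fin d → ℝ)) = ⊤ := span_top_of_card h.1.li h.2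

lemma Facet.eq_of_subset {F s : Finset (Fin d → ℝ)} (h : K.Facet F) (hs : K.Face s) (hsub : F ⊆ s) :
    F = s := Finset.eq_of_subset_of_card_le hsub (by rw [h.2]; exact hs.card_le)

/-- a dual vector for a facet vertex, oriented outward -/
lemma Facet.nvec {F : Finset (Fin d → ℝ)} (h : K.Facet F) {a : Fin d → ℝ} (ha : a ∈ F) :
    ∃ n : Fin d → ℝ, n ⬝ᵥ a = -1 ∧ ∀ v ∈ F, v ≠ a → n ⬝ᵥ v = 0 := by
  obtain ⟨n, hn⟩ := interp h.1.li (fun v => if v = a then -1 else 0)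
  refine ⟨n, ?_, fun v hv hva => ?_⟩
  · rw [hn a ha, if_pos rfl]
  · rw [hn v hv, if_neg hva]

lemma Facet.pivot_aux {F : Finset (Fin d → ℝ)} (h : K.Facet F) {a q n : Fin d → ℝ} (ha : a ∈ F)
    (hq : K.Feas q) (q1 : ∀ v ∈ F, q ⬝ᵥ v = 1) (q2 : ∀ v ∈ K.V, v ∉ F → q ⬝ᵥ v < 1)
    (n1 : n ⬝ᵥ a = -1) (n2 : ∀ v ∈ F, v ≠ a → n ⬝ᵥ v = 0) :
    ∃ t : ℝ, 0 < t ∧ ∃ a', a' ∉ F ∧ K.Facet (insert a' (F.erase a)) ∧ K.Feas (q + t • n) ∧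
      ∀ v ∈ insert a' (F.erase a), (q + t • n) ⬝ᵥ v = 1 := by
  obtain ⟨t, ht, hf, v', hv', hnv', hv1⟩ := push hq (n := n) (fun v hv hv1 => by
    have hvF : v ∈ F := by
      by_contra hc
      exact absurd hv1 (q2 v hv hc).ne
    by_cases hva : v = a
    · rw [hva, n1]; norm_num
    · rw [n2 v hvF hva]) (K.neg a (h.1.mem ha)) (by rw [dotProduct_neg, n1]; norm_num)
  have hv'F : v' ∉ F := by
    intro hc
    by_cases hva : v' = a
    · rw [hva, n1] at hnv'; linarith
    · rw [n2 v' hc hva] at hnv'; linarith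
  have key : ∀ v ∈ insert v' (F.erase a), (q + t • n) ⬝ᵥ v = 1 := by
    intro v hv
    rcases Finset.mem_insert.1 hv with rfl | hv
    · exact hv1
    · obtain ⟨hva, hvF⟩ := Finset.mem_erase.1 hv
      rw [add_dotProduct, smul_dotProduct, n2 v hvF hva, q1 v hvF]; simp
  refine ⟨t, ht, v', hv'F, ⟨⟨?_, _, hf, key⟩, ?_⟩, hf, key⟩
  · intro v hv
    rcases Finset.mem_insert.1 hv with rfl | hv
    · exact hv'
    · exact h.1.mem (Finset.mem_of_mem_erase hv)
  · rw [Finset.card_insert_of_notMem (fun hc => hv'F (Finset.mem_of_mem_erase hc)),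
      Finset.card_erase_of_mem ha, h.2]
    have : 0 < F.card := Finset.card_pos.2 ⟨a, ha⟩
    have := h.2
    omega

lemma Facet.pivot {F : Finset (Fin d → ℝ)} (h : K.Facet F) {a : Fin d → ℝ} (ha : a ∈ F) :
    ∃ a', a' ∉ F ∧ K.Facet (insert a' (F.erase a)) := by
  obtain ⟨q, hq, q1, q2⟩ := h.q
  obtain ⟨n, n1, n2⟩ := h.nvec ha
  obtain ⟨t, _, a', h1, h2, _⟩ := h.pivot_aux ha hq q1 q2 n1 n2
  exact ⟨a', h1, h2⟩

/-- strong connectivity of stars -/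
lemma conn {τ F0 : Finset (Fin d → ℝ)} (h0 : K.Facet F0) (hτ0 : τ ⊆ F0)
    (Q : Finset (Fin d → ℝ) → Prop)
    (hQ : ∀ F a a', K.Facet F → τ ⊆ F → a ∈ F → a ∉ τ → a' ∉ F →
      K.Facet (insert a' (F.erase a)) → Q F → Q (insert a' (F.erase a)))
    (hQ0 : Q F0) : ∀ F, K.Facet F → τ ⊆ F → Q F := by
  intro F1 hF1 hτ1
  choose! qf hqf q1 q2 using fun (F : Finset (Fin d → ℝ)) (h : K.Facet F) => h.q
  set c := ∑ v ∈ F1, v with hc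
  set S := K.V.powerset.filter fun F => K.Facet F ∧ τ ⊆ F ∧ Q F
  obtain ⟨F, hF, hmax⟩ := Finset.exists_max_image S (fun F => qf F ⬝ᵥ c)
    ⟨F0, Finset.mem_filter.2 ⟨Finset.mem_powerset.2 h0.1.1, h0, hτ0, hQ0⟩⟩
  obtain ⟨_, hFf, hτF, hQF⟩ := Finset.mem_filter.1 hF
  by_cases hle : qf F1 ⬝ᵥ c ≤ qf F ⬝ᵥ c
  · -- then F = F1
    have e1 : qf F1 ⬝ᵥ c = ∑ v ∈ F1, (1 : ℝ) := by
      rw [hc, dotProduct_sum]; exact Finset.sum_congr rfl fun v hv => q1 F1 hF1 v hv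
    have e2 : ∀ v ∈ F1, qf F ⬝ᵥ v = 1 := by
      have h3 : ∀ v ∈ F1, qf F ⬝ᵥ v ≤ 1 := fun v hv => hqf F hFf v (hF1.1.mem hv)
      have h4 : ∑ v ∈ F1, qf F ⬝ᵥ v = ∑ v ∈ F1, (1 : ℝ) := by
        apply le_antisymm (Finset.sum_le_sum h3)
        rw [← e1, ← dotProduct_sum]; exact hle
      exact (Finset.sum_eq_sum_iff_of_le h3).1 h4
    have e3 : F1 ⊆ F := by
      intro v hv
      by_contra hcon
      exact absurd (e2 v hv) (q2 F hFf v (hF1.1.mem hv) hcon).ne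
    rw [hF1.eq_of_subset hFf.1 e3]; exact hQF
  · exfalso
    push Not at hle
    have hcs : c ∈ Submodule.span ℝ (F : Set (Fin d → ℝ)) := by rw [hFf.span]; trivial
    obtain ⟨lam, -, hlam⟩ := Submodule.mem_span_finset.1 hcs
    by_cases hex : ∃ a ∈ F, a ∉ τ ∧ lam a < 0
    · obtain ⟨a, ha, haτ, hla⟩ := hex
      obtain ⟨n, n1, n2⟩ := hFf.nvec ha
      obtain ⟨t, ht, a', h1, h2, h3, h4⟩ := hFf.pivot_aux ha (hqf F hFf) (q1 F hFf) (q2 F hFf) n1 n2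
      have hnew := hQ F a a' hFf hτF ha haτ h1 h2 hQF
      have hτn : τ ⊆ insert a' (F.erase a) := fun v hv => Finset.mem_insert_of_mem
        (Finset.mem_erase.2 ⟨fun e => haτ (e ▸ hv), hτF hv⟩)
      have hm := hmax _ (Finset.mem_filter.2 ⟨Finset.mem_powerset.2 h2.1.1, h2, hτn, hnew⟩)
      have heq : qf (insert a' (F.erase a)) = qf F + t • n := by
        apply ext_span h2.span
        intro v hv
        rw [q1 _ h2 v hv, h4 v hv]
      have hnc : n ⬝ᵥ c = - lam a := by
        rw [← hlam, dotProduct_sum, Finset.sum_eq_single_of_mem a ha]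
        · rw [dotProduct_smul, n1]; simp
        · intro b hb hba
          rw [dotProduct_smul, n2 b hb hba]; simp
      rw [heq, add_dotProduct, smul_dotProduct, hnc, smul_eq_mul] at hm
      nlinarith
    · push Not at hex
      have e1 : qf F1 ⬝ᵥ c ≤ qf F ⬝ᵥ c := by
        rw [← hlam, dotProduct_sum, dotProduct_sum]
        refine Finset.sum_le_sum fun a ha => ?_
        rw [dotProduct_smul, dotProduct_smul, smul_eq_mul, smul_eq_mul, q1 F hFf a ha]
        by_cases haτ : a ∈ τ
        · rw [q1 F1 hF1 a (hτ1 haτ)]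
        · exact mul_le_mul_of_nonneg_left (hqf F1 hF1 a (hFf.1.mem ha)) (hex a ha haτ)
      linarith

/-- a ridge lies in at most two facets -/
lemma ridge {R : Finset (Fin d → ℝ)} {a1 a2 a3 : Fin d → ℝ}
    (h1 : K.Facet (insert a1 R)) (h2 : K.Facet (insert a2 R)) (h3 : K.Facet (insert a3 R))
    (n1 : a1 ∉ R) (n2 : a2 ∉ R) (n3 : a3 ∉ R) (d12 : a1 ≠ a2) (d13 : a1 ≠ a3) : a2 = a3 := by
  by_contra d23
  obtain ⟨q1, f1, t1, s1⟩ := h1.q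
  obtain ⟨q2, f2, t2, s2⟩ := h2.q
  obtain ⟨q3, f3, t3, s3⟩ := h3.q
  have m1 : a1 ∈ insert a1 R := Finset.mem_insert_self _ _
  have m2 : a2 ∈ insert a2 R := Finset.mem_insert_self _ _
  have m3 : a3 ∈ insert a3 R := Finset.mem_insert_self _ _
  obtain ⟨n, nn1, nn2⟩ := h1.nvec m1
  have key : ∀ a q, (∀ v ∈ insert a R, q ⬝ᵥ v = 1) → q = q1 + (1 - q ⬝ᵥ a1) • n := by
    intro a q hq
    apply ext_span h1.span
    intro v hv
    rcases Finset.mem_insert.1 hv with rfl | hvR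
    · rw [add_dotProduct, smul_dotProduct, nn1, t1 v hv]; simp
    · rw [add_dotProduct, smul_dotProduct, nn2 v hv (fun e => n1 (e ▸ hvR)), t1 v hv,
        hq v (Finset.mem_insert_of_mem hvR)]; simp
  have nm : ∀ a b, a ≠ b → a ∉ R → a ∉ insert b R := fun a b hab haR hc => by
    rcases Finset.mem_insert.1 hc with h | h
    · exact hab h
    · exact haR h
  have e2 := key a2 q2 t2
  have e3 := key a3 q3 t3
  have p2 := s2 a1 (h1.1.mem m1) (nm _ _ d12 n1)
  have p3 := s3 a1 (h1.1.mem m1) (nm _ _ d13 n1)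
  have p12 := s1 a2 (h2.1.mem m2) (nm _ _ d12.symm n2)
  have p13 := s1 a3 (h3.1.mem m3) (nm _ _ d13.symm n3)
  have p23 := s2 a3 (h3.1.mem m3) (nm _ _ (Ne.symm d23) n3)
  have p32 := s3 a2 (h2.1.mem m2) (nm _ _ d23 n2)
  have u2 := t2 a2 m2
  have u3 := t3 a3 m3
  have z2 : 0 < 1 - q2 ⬝ᵥ a1 := by linarith
  have z3 : 0 < 1 - q3 ⬝ᵥ a1 := by linarith
  set x2 := 1 - q2 ⬝ᵥ a1
  set x3 := 1 - q3 ⬝ᵥ a1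
  rw [e2, add_dotProduct, smul_dotProduct, smul_eq_mul] at u2 p23
  rw [e3, add_dotProduct, smul_dotProduct, smul_eq_mul] at u3 p32
  have y2 : 0 < n ⬝ᵥ a2 := pos_of_mul_pos_right (by linarith : 0 < x2 * (n ⬝ᵥ a2)) z2.le
  have y3 : 0 < n ⬝ᵥ a3 := pos_of_mul_pos_right (by linarith : 0 < x3 * (n ⬝ᵥ a3)) z3.le
  have c1 : x3 < x2 := by nlinarith
  have c2 : x2 < x3 := by nlinarith
  linarith

end CSP
end Geo
end CSLB

namespace CSLB
section Conv
open Matrix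
variable {d : ℕ} {P : SPolytope d}

lemma P_ne (P : SPolytope d) : P.V.Nonempty := by
  by_contra h
  rw [Finset.not_nonempty_iff_eq_empty] at h
  have := P.span_top
  rw [h] at this
  simp at this
  
lemma zero_mem_body (hcs : IsCS P) : (0 : Fin d → ℝ) ∈ polyBody P.V := by
  obtain ⟨v, hv⟩ := P_ne P
  have h1 : v ∈ polyBody P.V := subset_convexHull ℝ _ hv
  have h2 : -v ∈ polyBody P.V := subset_convexHull ℝ _ (hcs v hv)
  have := (convex_convexHull ℝ (P.V : Set (Fin d → ℝ))) h1 h2 (by norm_num : (0:ℝ) ≤ 1/2)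
    (by norm_num : (0:ℝ) ≤ 1/2) (by norm_num)
  simpa [polyBody] using this

lemma le_body {V : Finset (Fin d → ℝ)} (f : (Fin d → ℝ) →ₗ[ℝ] ℝ) {c : ℝ}
    (h : ∀ v ∈ V, f v ≤ c) : ∀ y ∈ polyBody V, f y ≤ c := by
  intro y hy
  have hc : Convex ℝ {y : Fin d → ℝ | f y ≤ c} := convex_halfSpace_le f.isLinear c
  exact convexHull_min (fun v hv => h v hv) hc hy

/-- dot product as a linear map -/
def dotL (q : Fin d → ℝ) : (Fin d → ℝ) →ₗ[ℝ] ℝ :=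
  { toFun := fun y => q ⬝ᵥ y, map_add' := fun a b => dotProduct_add _ _ _,
    map_smul' := fun a b => by simp }
@[simp] lemma dotL_apply (q y : Fin d → ℝ) : dotL q y = q ⬝ᵥ y := rfl

lemma proper_of_feas (hcs : IsCS P) {q : Fin d → ℝ} (hq : ∀ v ∈ P.V, q ⬝ᵥ v ≤ 1) :
    IsProperFace P.V {y | y ∈ polyBody P.V ∧ q ⬝ᵥ y = 1} := by
  refine ⟨⟨dotL q, 1, le_body _ hq, rfl⟩, fun h => ?_⟩
  have := zero_mem_body hcs
  rw [← h] at this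
  simp at this

lemma li_of_affine {s : Set (Fin d → ℝ)} {q : Fin d → ℝ} (hq : ∀ v ∈ s, q ⬝ᵥ v = 1)
    (h : AffineIndependent ℝ (fun x : s => (x : Fin d → ℝ))) : LinearIndepOn ℝ id s := by
  change LinearIndependent ℝ (fun x : s => (x : Fin d → ℝ))
  rw [linearIndependent_iff']
  rw [affineIndependent_iff] at h
  intro t w hw
  refine h t w ?_ hw
  have : q ⬝ᵥ (∑ i ∈ t, w i • (i : Fin d → ℝ)) = 0 := by rw [hw]; simp
  rw [dotProduct_sum] at this
  rw [← this]
  refine Finset.sum_congr rfl fun i _ => ?_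
  rw [dotProduct_smul, hq i i.2]; simp

lemma ext_of (hcs : IsCS P) (hd : 1 ≤ d) {v : Fin d → ℝ} (hv : v ∈ P.V) :
    ∃ q : Fin d → ℝ, (∀ w ∈ P.V, q ⬝ᵥ w ≤ 1) ∧ q ⬝ᵥ v = 1 := by
  have hcl : IsClosed (convexHull ℝ ((P.V.erase v : Finset (Fin d → ℝ)) : Set (Fin d → ℝ))) :=
    ((P.V.erase v).finite_toSet.isCompact_convexHull (𝕜 := ℝ)).isClosed
  obtain ⟨f, u, hf1, hf2⟩ := geometric_hahn_banach_closed_point (convex_convexHull ℝ _) hcl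
    (P.extreme v hv)
  have hlt : ∀ w ∈ P.V, w ≠ v → f w < f v := fun w hw hwv =>
    (hf1 w (subset_convexHull ℝ _ (by simp [hw, hwv]))).trans hf2
  have hpos : 0 < f v := by
    by_cases h0 : v = 0
    · exfalso
      have hex : ∃ w ∈ P.V, w ≠ 0 := by
        by_contra hcon
        push Not at hcon
        have h1 : (P.V : Set (Fin d → ℝ)) ⊆ {0} := fun w hw => hcon w hw
        have h2 := affineSpan_mono ℝ h1
        rw [P.span_top] at h2
        have h3 : (fun _ => 1 : Fin d → ℝ) ∈ affineSpan ℝ ({0} : Set (Fin d → ℝ)) :=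
          h2 (AffineSubspace.mem_top ℝ _ _)
        rw [AffineSubspace.mem_affineSpan_singleton] at h3
        have := congrFun h3 ⟨0, hd⟩
        simp at this
      obtain ⟨w, hw, hw0⟩ := hex
      have h1 := hlt w hw (h0 ▸ hw0)
      have h2 := hlt (-w) (hcs w hw) (by rw [h0]; simpa using hw0)
      rw [h0] at h1 h2
      simp at h1 h2; linarith
    · have h1 := hlt (-v) (hcs v hv) (fun h => h0 (by
        have : v + v = 0 := by nth_rewrite 1 [← h]; simp
        have h2 : (2:ℝ) • v = 0 := by rw [two_smul]; exact this
        simpa using h2))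
      simp at h1; linarith
  obtain ⟨y, hy⟩ := dual_dot (f : (Fin d → ℝ) →ₗ[ℝ] ℝ)
  have hy' : ∀ z, f z = y ⬝ᵥ z := hy
  refine ⟨(f v)⁻¹ • y, fun w hw => ?_, ?_⟩
  · rw [smul_dotProduct, ← hy', smul_eq_mul, inv_mul_le_iff₀ hpos, mul_one]
    by_cases hwv : w = v
    · rw [hwv]
    · exact (hlt w hw hwv).le
  · rw [smul_dotProduct, ← hy', smul_eq_mul, inv_mul_cancel₀ hpos.ne']

/-- polar form of a centrally symmetric simplicial polytope -/
def toCSP (P : SPolytope d) (hcs : IsCS P) (hd : 1 ≤ d) : CSP d where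
  V := P.V
  neg := hcs
  span := by
    rw [eq_top_iff]
    intro x _
    have hx : x ∈ affineSpan ℝ (P.V : Set (Fin d → ℝ)) := by rw [P.span_top]; trivial
    exact affineSpan_subset_span hx
  simp := by
    intro q hq
    have h := (P.simplicial _ (proper_of_feas hcs hq)).1
    have he : (P.V : Set (Fin d → ℝ)) ∩ {y | y ∈ polyBody P.V ∧ q ⬝ᵥ y = 1} =
        {v : Fin d → ℝ | v ∈ P.V ∧ q ⬝ᵥ v = 1} := by
      ext v
      simp only [Set.mem_inter_iff, Finset.mem_coe, Set.mem_ofPred_eq]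
      exact ⟨fun h => ⟨h.1, h.2.2⟩, fun h => ⟨h.1, subset_convexHull ℝ _ h.1, h.2⟩⟩
    rw [he] at h
    exact li_of_affine (fun v hv => hv.2) h
  ext := fun v hv => ext_of hcs hd hv

lemma face_iff (hcs : IsCS P) (hd : 1 ≤ d) (s : Finset (Fin d → ℝ)) :
    BFace P s ↔ (toCSP P hcs hd).Face s := by
  constructor
  · rintro ⟨hs, F, ⟨⟨f, c, hf, hF⟩, hne⟩, hsF⟩
    refine ⟨hs, ?_⟩
    have hfv : ∀ v ∈ P.V, f v ≤ c := fun v hv => hf v (subset_convexHull ℝ _ hv)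
    have hfn : ∀ v ∈ P.V, - f v ≤ c := fun v hv => by
      have := hfv _ (hcs v hv); rwa [map_neg] at this
    obtain ⟨v0, hv0⟩ := P_ne P
    have hc : 0 < c := by
      by_contra hc
      apply hne
      have hz : ∀ v ∈ P.V, f v = 0 ∧ c = 0 := fun v hv => by
        have := hfv v hv; have := hfn v hv; constructor <;> linarith
      have hc0 := (hz v0 hv0).2
      rw [hF]
      ext y
      simp only [Set.mem_ofPred_eq, and_iff_left_iff_imp]
      intro hy
      apply le_antisymm (hf y hy)
      have := le_body (-f) (c := 0) (fun v hv => by simp [(hz v hv).1]) y hy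
      simp at this; linarith
    obtain ⟨y, hy⟩ := dual_dot f
    refine ⟨c⁻¹ • y, fun v hv => ?_, fun v hv => ?_⟩
    · rw [smul_dotProduct, ← hy, smul_eq_mul, inv_mul_le_iff₀ hc, mul_one]; exact hfv v hv
    · have := hsF hv
      rw [hF] at this
      rw [smul_dotProduct, ← hy, this.2, smul_eq_mul, inv_mul_cancel₀ hc.ne']
  · rintro ⟨hs, q, hq, hq1⟩
    exact ⟨hs, _, proper_of_feas hcs hq, fun v hv => ⟨subset_convexHull ℝ _ (hs hv), hq1 v hv⟩⟩

end Conv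
end CSLB

namespace CSLB
section RedS
open Matrix
variable {d : ℕ} {K : CSP d}

/-- strain of a field along a pair -/
def ed (m : (Fin d → ℝ) → (Fin d → ℝ)) (u v : Fin d → ℝ) : ℝ := (u - v) ⬝ᵥ (m u - m v)

lemma ed_comm (m : (Fin d → ℝ) → (Fin d → ℝ)) (u v : Fin d → ℝ) : ed m u v = ed m v u := by
  unfold ed
  rw [← neg_sub v u, ← neg_sub (m v) (m u), neg_dotProduct, dotProduct_neg, neg_neg]

lemma ed_self (m : (Fin d → ℝ) → (Fin d → ℝ)) (u : Fin d → ℝ) : ed m u u = 0 := by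
  simp [ed]

/-- projection data for a face with link of dimension two -/
structure Red (K : CSP d) (τ : Finset (Fin d → ℝ)) where
  f : Fin d → ℝ
  π : (Fin d → ℝ) → (Fin 3 → ℝ)
  fτ : ∀ s ∈ τ, f ⬝ᵥ s = 1
  fV : ∀ v ∈ K.V, v ∉ τ → f ⬝ᵥ v < 1
  πneg : ∀ v, π (-v) = -π v
  fac : ∀ y : Fin d → ℝ, (∀ s ∈ τ, y ⬝ᵥ s = 0) → ∃ M : Fin 3 → ℝ,
    (∀ z, y ⬝ᵥ z = M ⬝ᵥ π z) ∧ (y = 0 → M = 0)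
  lft : ∀ M : Fin 3 → ℝ, ∃ y : Fin d → ℝ, (∀ s ∈ τ, y ⬝ᵥ s = 0) ∧
    (∀ z, y ⬝ᵥ z = M ⬝ᵥ π z) ∧ (y = 0 → M = 0)

/-- triangles of the link -/
def CSP.Tri (K : CSP d) (τ : Finset (Fin d → ℝ)) (a b c : Fin d → ℝ) : Prop :=
  K.Facet (insert a (insert b (insert c τ)))

lemma ins_sw (τ : Finset (Fin d → ℝ)) (a b c : Fin d → ℝ) :
    insert a (insert b (insert c τ)) = insert b (insert a (insert c τ)) := Finset.insert_comm _ _ _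
lemma ins_ro (τ : Finset (Fin d → ℝ)) (a b c : Fin d → ℝ) :
    insert a (insert b (insert c τ)) = insert b (insert c (insert a τ)) := by
  rw [ins_sw, Finset.insert_comm a c]

lemma CSP.Tri.sw {τ : Finset (Fin d → ℝ)} {a b c : Fin d → ℝ} (h : K.Tri τ a b c) : K.Tri τ b a c := by
  unfold CSP.Tri at *; rwa [ins_sw]
lemma CSP.Tri.ro {τ : Finset (Fin d → ℝ)} {a b c : Fin d → ℝ} (h : K.Tri τ a b c) : K.Tri τ b c a := by
  unfold CSP.Tri at *; rwa [← ins_ro]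

lemma CSP.Tri.distinct {τ : Finset (Fin d → ℝ)} (hτ : τ.card + 3 = d) {a b c : Fin d → ℝ}
    (h : K.Tri τ a b c) : a ∉ τ ∧ b ∉ τ ∧ c ∉ τ ∧ a ≠ b ∧ a ≠ c ∧ b ≠ c := by
  have hc := h.2
  have l1 := Finset.card_insert_le a (insert b (insert c τ))
  have l2 := Finset.card_insert_le b (insert c τ)
  have l3 := Finset.card_insert_le c τ
  have n3 : c ∉ τ := fun hh => by rw [Finset.insert_eq_of_mem hh] at *; omega
  have n2 : b ∉ insert c τ := fun hh => by rw [Finset.insert_eq_of_mem hh] at *; omega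
  have n1 : a ∉ insert b (insert c τ) := fun hh => by rw [Finset.insert_eq_of_mem hh] at *; omega
  simp only [Finset.mem_insert, not_or] at n1 n2
  exact ⟨n1.2.2, n2.2, n3, n1.1, n1.2.1, n2.1⟩

/-- every facet containing the face is a triangle -/
lemma exists_tri {τ F : Finset (Fin d → ℝ)} (hτ : τ.card + 3 = d) (hF : K.Facet F) (hs : τ ⊆ F) :
    ∃ a b c, F = insert a (insert b (insert c τ)) ∧ K.Tri τ a b c := by
  have h1 : (F \ τ).card = 3 := by
    have := Finset.card_sdiff_add_card_eq_card hs
    have := hF.2; omega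
  obtain ⟨a, b, c, _, _, _, h⟩ := Finset.card_eq_three.1 h1
  have h2 : F = insert a (insert b (insert c τ)) := by
    rw [← Finset.sdiff_union_of_subset hs, h]
    ext x; simp
  exact ⟨a, b, c, h2, by unfold CSP.Tri; rwa [← h2]⟩

lemma tri_perm {τ : Finset (Fin d → ℝ)} (hτ : τ.card + 3 = d) {a b c a0 b0 c0 : Fin d → ℝ}
    (h : K.Tri τ a b c)
    (he : insert a (insert b (insert c τ)) = insert a0 (insert b0 (insert c0 τ)))
    (Q : (Fin d → ℝ) → (Fin d → ℝ) → (Fin d → ℝ) → Prop)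
    (hs : ∀ a b c, Q a b c → Q b a c) (hr : ∀ a b c, Q a b c → Q b c a) (h0 : Q a0 b0 c0) :
    Q a b c := by
  obtain ⟨na, nb, nc, ab, ac, bc⟩ := h.distinct hτ
  have ha : a ∈ insert a0 (insert b0 (insert c0 τ)) := by rw [← he]; simp
  have hb : b ∈ insert a0 (insert b0 (insert c0 τ)) := by rw [← he]; simp
  have hc : c ∈ insert a0 (insert b0 (insert c0 τ)) := by rw [← he]; simp
  simp only [Finset.mem_insert, na, nb, nc, or_false] at ha hb hc
  rcases ha with rfl | rfl | rfl <;> rcases hb with rfl | rfl | rfl <;>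
    rcases hc with rfl | rfl | rfl <;> first | contradiction | skip
  · exact h0
  · exact hs _ _ _ (hr _ _ _ (hr _ _ _ h0))
  · exact hs _ _ _ h0
  · exact hr _ _ _ h0
  · exact hr _ _ _ (hr _ _ _ h0)
  · exact hs _ _ _ (hr _ _ _ h0)

lemma tri_conn {τ : Finset (Fin d → ℝ)} (hτ : τ.card + 3 = d) {a0 b0 c0 : Fin d → ℝ}
    (h0 : K.Tri τ a0 b0 c0)
    (Q : (Fin d → ℝ) → (Fin d → ℝ) → (Fin d → ℝ) → Prop)
    (hs : ∀ a b c, Q a b c → Q b a c) (hr : ∀ a b c, Q a b c → Q b c a)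
    (hst : ∀ a b c c', K.Tri τ a b c → K.Tri τ a b c' → Q a b c → Q a b c')
    (hQ0 : Q a0 b0 c0) : ∀ a b c, K.Tri τ a b c → Q a b c := by
  have hsub : ∀ a b c, τ ⊆ insert a (insert b (insert c τ)) := fun a b c x hx => by simp [hx]
  have key := CSP.conn (K := K) h0 (hsub _ _ _)
    (fun F => ∀ a b c, F = insert a (insert b (insert c τ)) → Q a b c) (by
      intro F x x' hF hτF hx hxτ hx' hF' hQ a b c habc
      have ht : K.Tri τ a b c := by unfold CSP.Tri; rwa [← habc]
      have step : ∀ a b c, K.Tri τ a b c → insert x' (F.erase x) = insert a (insert b (insert c τ)) →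
          c = x' → Q a b c := by
        intro a b c ht habc hc
        obtain ⟨na, nb, nc, ab, ac, bc⟩ := ht.distinct hτ
        have hFe : F = insert a (insert b (insert x τ)) := by
          have h1 : F.erase x = insert a (insert b τ) := by
            have h2 : (insert x' (F.erase x)).erase x' = F.erase x :=
              Finset.erase_insert (fun h => hx' (Finset.mem_of_mem_erase h))
            rw [← h2, habc, ← hc, ins_ro, ins_ro, Finset.erase_insert]
            simp only [Finset.mem_insert, not_or]
            exact ⟨ac.symm, bc.symm, nc⟩
          rw [← Finset.insert_erase hx, h1, ins_ro]
        have hT : K.Tri τ a b x := by unfold CSP.Tri; rwa [← hFe]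
        exact hst _ _ _ _ hT ht (hQ _ _ _ hFe)
      have hmem : x' ∈ insert a (insert b (insert c τ)) := by rw [← habc]; simp
      have hx'τ : x' ∉ τ := fun h => hx' (hτF h)
      simp only [Finset.mem_insert, hx'τ, or_false] at hmem
      rcases hmem with h | h | h
      · exact hr _ _ _ (hr _ _ _ (step b c a ht.ro (by rw [habc, ins_ro]) h.symm))
      · exact hr _ _ _ (step c a b ht.ro.ro (by rw [habc, ins_ro, ins_ro]) h.symm)
      · exact step a b c ht habc h.symm) (by
      intro a b c he
      exact tri_perm hτ (by unfold CSP.Tri; rw [← he]; exact h0) he.symm Q hs hr hQ0)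
  intro a b c h
  exact key _ h (hsub _ _ _) a b c rfl

lemma exists_red {τ : Finset (Fin d → ℝ)} (hτ : τ.card + 3 = d) (hf : K.Face τ) : Nonempty (Red K τ) := by
  obtain ⟨F, hsF, hF⟩ := hf.exists_facet
  obtain ⟨q, hq, q1, q2⟩ := hF.q
  obtain ⟨h, hh⟩ := interp hF.1.li (fun v => if v ∈ τ then 0 else 1)
  have hev : ∀ᶠ ε in nhdsWithin (0:ℝ) (Set.Ioi 0), ∀ v ∈ K.V.filter (fun v => v ∉ F), q ⬝ᵥ v - ε * (h ⬝ᵥ v) < 1 := by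
    rw [Filter.eventually_all_finset]
    intro v hv
    obtain ⟨hv, hvF⟩ := Finset.mem_filter.1 hv
    have : Filter.Tendsto (fun ε : ℝ => q ⬝ᵥ v - ε * (h ⬝ᵥ v)) (nhdsWithin 0 (Set.Ioi 0)) (nhds (q ⬝ᵥ v - 0 * (h ⬝ᵥ v))) := by
      apply Filter.Tendsto.mono_left _ nhdsWithin_le_nhds
      exact Continuous.tendsto (by fun_prop) _
    apply this.eventually_lt_const
    rw [zero_mul, sub_zero]; exact q2 v hv hvF
  obtain ⟨ε, he1, he⟩ := (hev.and self_mem_nhdsWithin).exists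
  have hε : 0 < ε := he
  obtain ⟨a, b, c, hFe, ht⟩ := exists_tri hτ hF hsF
  obtain ⟨na, nb, nc, ab, ac, bc⟩ := ht.distinct hτ
  have haF : a ∈ F := by rw [hFe]; simp
  have hbF : b ∈ F := by rw [hFe]; simp
  have hcF : c ∈ F := by rw [hFe]; simp
  obtain ⟨x, hx⟩ := interp hF.1.li (fun v => if v = a then 1 else 0)
  obtain ⟨y, hy⟩ := interp hF.1.li (fun v => if v = b then 1 else 0)
  obtain ⟨z, hz⟩ := interp hF.1.li (fun v => if v = c then 1 else 0)
  have sτ : ∀ s ∈ τ, x ⬝ᵥ s = 0 ∧ y ⬝ᵥ s = 0 ∧ z ⬝ᵥ s = 0 := fun s hs =>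
    ⟨by rw [hx s (hsF hs), if_neg]; rintro rfl; exact na hs,
     by rw [hy s (hsF hs), if_neg]; rintro rfl; exact nb hs,
     by rw [hz s (hsF hs), if_neg]; rintro rfl; exact nc hs⟩
  have hM : ∀ (M w : Fin 3 → ℝ), M ⬝ᵥ w = M 0 * w 0 + M 1 * w 1 + M 2 * w 2 := by
    intro M w; simp [dotProduct, Fin.sum_univ_three]
  refine ⟨⟨q - ε • h, fun v => ![x ⬝ᵥ v, y ⬝ᵥ v, z ⬝ᵥ v], ?_, ?_, ?_, ?_, ?_⟩⟩
  · intro s hs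
    rw [sub_dotProduct, smul_dotProduct, q1 s (hsF hs), hh s (hsF hs), if_pos hs]; simp
  · intro v hv hvτ
    rw [sub_dotProduct, smul_dotProduct, smul_eq_mul]
    by_cases hvF : v ∈ F
    · rw [q1 v hvF, hh v hvF, if_neg hvτ]; linarith
    · exact he1 v (Finset.mem_filter.2 ⟨hv, hvF⟩)
  · intro v; ext i; fin_cases i <;> simp
  · intro w hw
    refine ⟨![w ⬝ᵥ a, w ⬝ᵥ b, w ⬝ᵥ c], fun u => ?_, fun h => ?_⟩
    · have : w = (w ⬝ᵥ a) • x + (w ⬝ᵥ b) • y + (w ⬝ᵥ c) • z := by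
        apply ext_span hF.span
        intro v hv
        have hv' : v ∈ F := hv
        simp only [add_dotProduct, smul_dotProduct, smul_eq_mul]
        rw [hx v hv', hy v hv', hz v hv']
        rw [hFe] at hv'
        simp only [Finset.mem_insert] at hv'
        rcases hv' with rfl | rfl | rfl | hv'
        · simp [ab, ac]
        · simp [ab.symm, bc]
        · simp [ac.symm, bc.symm]
        · rw [hw v hv', if_neg, if_neg, if_neg] <;> [simp; (rintro rfl; exact nc hv');
            (rintro rfl; exact nb hv'); (rintro rfl; exact na hv')]
      rw [hM]
      conv_lhs => rw [this]
      simp only [add_dotProduct, smul_dotProduct, smul_eq_mul]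
      simp
    · rw [h]; ext i; fin_cases i <;> simp
  · intro M
    refine ⟨M 0 • x + M 1 • y + M 2 • z, fun s hs => ?_, fun u => ?_, fun h0 => ?_⟩
    · obtain ⟨h1, h2, h3⟩ := sτ s hs
      simp only [add_dotProduct, smul_dotProduct, smul_eq_mul, h1, h2, h3]; simp
    · rw [hM]; simp only [add_dotProduct, smul_dotProduct, smul_eq_mul]; simp
    · have e1 := congrArg (· ⬝ᵥ a) h0
      have e2 := congrArg (· ⬝ᵥ b) h0
      have e3 := congrArg (· ⬝ᵥ c) h0
      simp only [add_dotProduct, smul_dotProduct, smul_eq_mul, hx a haF, hx b hbF, hx c hcF, hy a haF, hy b hbF, hy c hcF, hz a haF, hz b hbF, hz c hcF, zero_dotProduct] at e1 e2 e3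
      simp [ab, ac, bc, ab.symm, ac.symm, bc.symm] at e1 e2 e3
      ext i; fin_cases i <;> simp [e1, e2, e3]

end RedS
end CSLB

namespace CSLB
section RedT
open Matrix
variable {d : ℕ} {K : CSP d} {τ : Finset (Fin d → ℝ)}

lemma exists_ann {a b c : Fin 3 → ℝ} (h : dt a b c = 0) :
    ∃ M : Fin 3 → ℝ, M ≠ 0 ∧ M ⬝ᵥ a = 0 ∧ M ⬝ᵥ b = 0 ∧ M ⬝ᵥ c = 0 := by
  have hdet : (Matrix.of ![a, b, c]).det = 0 := by
    rw [← h, Matrix.det_fin_three]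
    simp [dt, cr, dotProduct, Fin.sum_univ_three]; ring
  obtain ⟨M, h0, hM⟩ := Matrix.exists_mulVec_eq_zero_iff.2 hdet
  refine ⟨M, h0, ?_, ?_, ?_⟩
  · have := congrFun hM 0; rw [dotProduct_comm]; simpa [Matrix.mulVec] using this
  · have := congrFun hM 1; rw [dotProduct_comm]; simpa [Matrix.mulVec] using this
  · have := congrFun hM 2; rw [dotProduct_comm]; simpa [Matrix.mulVec] using this

namespace Red
variable (R : Red K τ)
/-- distance to the hyperplane -/
def l (v : Fin d → ℝ) : ℝ := 1 - R.f ⬝ᵥ v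
/-- projected point -/
def p (v : Fin d → ℝ) : Fin 3 → ℝ := (R.l v)⁻¹ • R.π v
variable {R}
lemma l_pos {v : Fin d → ℝ} (hv : v ∈ K.V) (h : v ∉ τ) : 0 < R.l v := by
  have := R.fV v hv h; unfold l; linarith

lemma tri_det (hτ : τ.card + 3 = d) {a b c : Fin d → ℝ} (h : K.Tri τ a b c) :
    dt (R.p a) (R.p b) (R.p c) ≠ 0 := by
  intro h0
  obtain ⟨na, nb, nc, _⟩ := h.distinct hτ
  have la := l_pos (R := R) (h.1.mem (v := a) (by simp)) na
  have lb := l_pos (R := R) (h.1.mem (v := b) (by simp)) nb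
  have lc := l_pos (R := R) (h.1.mem (v := c) (by simp)) nc
  obtain ⟨M, hM0, ha, hb, hc⟩ := exists_ann h0
  obtain ⟨y, y1, y2, y3⟩ := R.lft M
  apply hM0
  apply y3
  unfold p at ha hb hc
  rw [dotProduct_smul, smul_eq_mul, ← y2, mul_eq_zero_iff_left (by positivity)] at ha hb hc
  apply ext_span h.span
  intro v hv
  rw [zero_dotProduct]
  simp only [Finset.coe_insert, Set.mem_insert_iff, Finset.mem_coe] at hv
  rcases hv with rfl | rfl | rfl | hv
  · exact ha
  · exact hb
  · exact hc
  · exact y1 v hv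

/-- the three dimensional configuration of the link -/
def cfg (R : Red K τ) (hτ : τ.card + 3 = d) : Cfg (Fin d → ℝ) where
  N := K.V.filter fun v => v ∉ τ
  p := R.p
  T := K.Tri τ
  Tsw := fun _ _ _ h => h.sw
  Tro := fun _ _ _ h => h.ro
  TN := fun a b c h => Finset.mem_filter.2 ⟨h.1.mem (by simp), (h.distinct hτ).1⟩
  Tdet := fun a b c h => tri_det hτ h
  Tq := by
    intro a b c h
    obtain ⟨na, nb, nc, _⟩ := h.distinct hτ
    obtain ⟨q, hq, q1, q2⟩ := CSP.Facet.q h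
    obtain ⟨M, hM, _⟩ := R.fac (q - R.f) (fun s hs => by
      rw [sub_dotProduct, R.fτ s hs, q1 s (by simp [hs])]; simp)
    have e : ∀ v ∈ K.V, v ∉ τ → M ⬝ᵥ R.p v = (q ⬝ᵥ v - R.f ⬝ᵥ v) / R.l v := by
      intro v _ _
      unfold p
      rw [dotProduct_smul, ← hM, sub_dotProduct, smul_eq_mul, div_eq_inv_mul]
    have e1 : ∀ v ∈ K.V, v ∉ τ → q ⬝ᵥ v = 1 → M ⬝ᵥ R.p v = 1 := by
      intro v h1 h2 h3
      rw [e v h1 h2, h3]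
      exact div_self (l_pos h1 h2).ne'
    refine ⟨M, e1 a (h.1.mem (by simp)) na (q1 a (by simp)), e1 b (h.1.mem (by simp)) nb (q1 b (by simp)),
      e1 c (h.1.mem (by simp)) nc (q1 c (by simp)), ?_⟩
    intro w hw wa wb wc
    obtain ⟨hwV, hwτ⟩ := Finset.mem_filter.1 hw
    have hlt := q2 w hwV (by simp [wa, wb, wc, hwτ])
    rw [e w hwV hwτ, div_lt_one (l_pos hwV hwτ)]
    unfold l; linarith
  Tpiv := by
    intro a b c h
    obtain ⟨na, nb, nc, ab, ac, bc⟩ := h.distinct hτ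
    obtain ⟨c', h1, h2⟩ := CSP.Facet.pivot h (a := c) (by simp)
    refine ⟨c', ?_, ?_⟩
    · rintro rfl; apply h1; simp
    · unfold CSP.Tri
      have : (insert a (insert b (insert c τ))).erase c = insert a (insert b τ) := by
        rw [ins_ro, ins_ro, Finset.erase_insert]
        simp only [Finset.mem_insert, not_or]
        exact ⟨ac.symm, bc.symm, nc⟩
      rw [this] at h2
      rw [ins_ro, ins_ro]; exact h2

lemma exists_mu (R : Red K τ) (z : (Fin d → ℝ) → (Fin d → ℝ)) : ∃ μ : (Fin d → ℝ) → (Fin 3 → ℝ),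
    ∀ v ∈ K.V, v ∉ τ → (∀ s ∈ τ, z v ⬝ᵥ v = z v ⬝ᵥ s) →
      (∀ y, z v ⬝ᵥ y - (z v ⬝ᵥ v) * (R.f ⬝ᵥ y) = R.l v * (μ v ⬝ᵥ R.π y)) ∧ (z v = 0 → μ v = 0) := by
  have : ∀ v, ∃ M : Fin 3 → ℝ, v ∈ K.V → v ∉ τ → (∀ s ∈ τ, z v ⬝ᵥ v = z v ⬝ᵥ s) →
      (∀ y, z v ⬝ᵥ y - (z v ⬝ᵥ v) * (R.f ⬝ᵥ y) = R.l v * (M ⬝ᵥ R.π y)) ∧ (z v = 0 → M = 0) := by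
    intro v
    by_cases h : v ∈ K.V ∧ v ∉ τ ∧ (∀ s ∈ τ, z v ⬝ᵥ v = z v ⬝ᵥ s)
    · obtain ⟨h1, h2, h3⟩ := h
      obtain ⟨M, hM, hM0⟩ := R.fac (z v - (z v ⬝ᵥ v) • R.f) (fun s hs => by
        rw [sub_dotProduct, smul_dotProduct, R.fτ s hs, h3 s hs]; simp)
      refine ⟨(R.l v)⁻¹ • M, fun _ _ _ => ⟨fun y => ?_, fun h0 => ?_⟩⟩
      · rw [smul_dotProduct, smul_eq_mul, mul_inv_cancel_left₀ (l_pos h1 h2).ne', ← hM,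
          sub_dotProduct, smul_dotProduct, smul_eq_mul]
      · rw [hM0 (by rw [h0]; simp)]; simp
    · exact ⟨0, fun h1 h2 h3 => absurd ⟨h1, h2, h3⟩ h⟩
  choose μ hμ using this
  exact ⟨μ, hμ⟩

lemma mu_id {z : (Fin d → ℝ) → (Fin d → ℝ)} {μ : (Fin d → ℝ) → (Fin 3 → ℝ)} {u v : Fin d → ℝ}
    (hu : u ∈ K.V) (hv : v ∈ K.V) (nu : u ∉ τ) (nv : v ∉ τ)
    (eu : ∀ y, z u ⬝ᵥ y - (z u ⬝ᵥ u) * (R.f ⬝ᵥ y) = R.l u * (μ u ⬝ᵥ R.π y))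
    (ev : ∀ y, z v ⬝ᵥ y - (z v ⬝ᵥ v) * (R.f ⬝ᵥ y) = R.l v * (μ v ⬝ᵥ R.π y)) :
    (R.p u - R.p v) ⬝ᵥ (μ u - μ v) = ed z u v / (R.l u * R.l v) := by
  have lu := l_pos (R := R) hu nu
  have lv := l_pos (R := R) hv nv
  have e1 := eu u
  have e2 := eu v
  have e3 := ev u
  have e4 := ev v
  rw [eq_div_iff (by positivity)]
  unfold p ed
  simp only [sub_dotProduct, dotProduct_sub, smul_dotProduct, smul_eq_mul]
  rw [dotProduct_comm (R.π u) (μ u), dotProduct_comm (R.π v) (μ u), dotProduct_comm (R.π u) (μ v),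
    dotProduct_comm (R.π v) (μ v), dotProduct_comm u (z u), dotProduct_comm u (z v),
    dotProduct_comm v (z u), dotProduct_comm v (z v)]
  have hlu : R.f ⬝ᵥ u = 1 - R.l u := by unfold l; ring
  have hlv : R.f ⬝ᵥ v = 1 - R.l v := by unfold l; ring
  rw [hlu] at e1 e3
  rw [hlv] at e2 e4
  field_simp
  have l1 := lu.ne'
  have l2 := lv.ne'
  have f1 : μ u ⬝ᵥ R.π u = z u ⬝ᵥ u := by
    apply mul_left_cancel₀ l1; linarith
  have f4 : μ v ⬝ᵥ R.π v = z v ⬝ᵥ v := by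
    apply mul_left_cancel₀ l2; linarith
  rw [f1, f4]
  linear_combination e2 + e3

lemma z_of_mu {z : (Fin d → ℝ) → (Fin d → ℝ)} {μ : (Fin d → ℝ) → (Fin 3 → ℝ)} {u : Fin d → ℝ}
    (hu : u ∈ K.V) (nu : u ∉ τ)
    (eu : ∀ y, z u ⬝ᵥ y - (z u ⬝ᵥ u) * (R.f ⬝ᵥ y) = R.l u * (μ u ⬝ᵥ R.π y)) (h : μ u = 0) : z u = 0 := by
  have lu := l_pos (R := R) hu nu
  have hlu : R.f ⬝ᵥ u = 1 - R.l u := by unfold l; ring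
  have e1 := eu u
  rw [h, hlu] at e1
  simp only [zero_dotProduct, mul_zero] at e1
  have e2 : z u ⬝ᵥ u = 0 := by
    apply mul_left_cancel₀ lu.ne'; linarith
  have e3 := eu (z u)
  rw [h, e2] at e3
  simp at e3
  exact e3
end Red

/-- motions of a star -/
def CSP.MotSt (K : CSP d) (τ : Finset (Fin d → ℝ)) (m : (Fin d → ℝ) → (Fin d → ℝ)) : Prop :=
  ∀ u v, K.Face (insert u (insert v τ)) → ed m u v = 0

lemma mem_tri {v : Fin d → ℝ} (hτ : τ.card + 3 = d) (hv : v ∉ τ) (h : K.Face (insert v τ)) :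
    ∃ b c, K.Tri τ v b c := by
  obtain ⟨F, h1, h2⟩ := h.exists_facet
  obtain ⟨a, b, c, h3, h4⟩ := exists_tri hτ h2 ((Finset.subset_insert _ _).trans h1)
  have h5 : v ∈ F := h1 (by simp)
  rw [h3] at h5
  simp only [Finset.mem_insert, hv, or_false] at h5
  rcases h5 with rfl | rfl | rfl
  · exact ⟨_, _, h4⟩
  · exact ⟨_, _, h4.ro⟩
  · exact ⟨_, _, h4.ro.ro⟩

theorem rig0 (hτ : τ.card + 3 = d) {m : (Fin d → ℝ) → (Fin d → ℝ)} (hm : K.MotSt τ m)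
    {F : Finset (Fin d → ℝ)} (hF : K.Facet F) (hsF : τ ⊆ F) (h0 : ∀ v ∈ F, m v = 0) :
    ∀ v, K.Face (insert v τ) → m v = 0 := by
  obtain ⟨R⟩ := exists_red hτ (hF.1.mono hsF)
  obtain ⟨μ, hμ⟩ := R.exists_mu m
  have hz : ∀ v, v ∉ τ → K.Face (insert v τ) → (∀ s ∈ τ, m v ⬝ᵥ v = m v ⬝ᵥ s) := by
    intro v hv hf s hs
    have := hm v s (by rwa [Finset.insert_eq_of_mem hs])
    unfold ed at this
    rw [h0 s (hsF hs), sub_zero, dotProduct_comm, dotProduct_sub] at this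
    linarith
  have hfull : ∀ v, v ∉ τ → K.Face (insert v τ) → _ := fun v hv hf =>
    hμ v (hf.mem (by simp)) hv (hz v hv hf)
  have fin : ∀ a b c, K.Tri τ a b c → K.Face (insert a τ) ∧ K.Face (insert a (insert b τ)) := by
    intro a b c h
    constructor <;> apply h.1.mono <;> intro x hx <;> simp only [Finset.mem_insert] at hx ⊢ <;> tauto
  have hmot : (R.cfg hτ).Mot μ := by
    intro a b c (h : K.Tri τ a b c)
    obtain ⟨na, nb, nc, _⟩ := h.distinct hτ
    have fa := fin a b c h
    have fb := fin b a c h.sw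
    have := Red.mu_id (R := R) (fa.1.mem (by simp)) (fb.1.mem (by simp)) na nb (hfull a na fa.1).1
      (hfull b nb fb.1).1
    rw [hm a b fa.2, zero_div] at this
    exact this
  obtain ⟨a0, b0, c0, hFe, ht⟩ := exists_tri hτ hF hsF
  have hzero : ∀ a b c, F = insert a (insert b (insert c τ)) → K.Tri τ a b c → μ a = 0 := by
    intro a b c he h
    exact (hfull a (h.distinct hτ).1 (fin a b c h).1).2 (h0 a (by rw [he]; simp))
  have key := Cfg.rigid hmot (a0 := a0) (b0 := b0) (c0 := c0)
    (fun Q hs hr hst h => tri_conn hτ ht Q hs hr hst h)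
    (hzero _ _ _ hFe ht) (hzero b0 c0 a0 (by rw [hFe, ins_ro]) ht.ro) (hzero c0 a0 b0 (by rw [hFe, ins_ro, ins_ro]) ht.ro.ro)
  intro v hv
  by_cases hvτ : v ∈ τ
  · exact h0 v (hsF hvτ)
  · obtain ⟨b, c, h⟩ := mem_tri hτ hvτ hv
    exact Red.z_of_mu (hv.mem (by simp)) hvτ (hfull v hvτ hv).1 (key _ _ _ h).1

end RedT
end CSLB

namespace CSLB
section TrivS
open Matrix
variable {d : ℕ} {K : CSP d} {τ : Finset (Fin d → ℝ)}

/-- infinitesimal isometries -/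
structure Tr (d : ℕ) where
  A : (Fin d → ℝ) →ₗ[ℝ] (Fin d → ℝ)
  b : Fin d → ℝ
  alt : ∀ x, A x ⬝ᵥ x = 0
/-- the field of an infinitesimal isometry -/
def Tr.t (T : Tr d) (y : Fin d → ℝ) : Fin d → ℝ := T.A y + T.b

lemma Tr.ed (T : Tr d) (u v : Fin d → ℝ) : ed T.t u v = 0 := by
  unfold CSLB.ed Tr.t
  have := T.alt (u - v)
  rw [map_sub] at this
  rw [add_sub_add_right_eq_sub, dotProduct_comm, this]

lemma ed_sub (m n : (Fin d → ℝ) → (Fin d → ℝ)) (u v : Fin d → ℝ) : ed (m - n) u v = ed m u v - ed n u v := by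
  unfold ed
  rw [← dotProduct_sub]; congr 1; simp only [Pi.sub_apply]; abel
lemma ed_add (m n : (Fin d → ℝ) → (Fin d → ℝ)) (u v : Fin d → ℝ) : ed (m + n) u v = ed m u v + ed n u v := by
  unfold ed
  rw [← dotProduct_add]; congr 1; simp only [Pi.add_apply]; abel
lemma ed_smul (c : ℝ) (n : (Fin d → ℝ) → (Fin d → ℝ)) (u v : Fin d → ℝ) : ed (c • n) u v = c * ed n u v := by
  unfold ed
  rw [← smul_eq_mul, ← dotProduct_smul]; congr 1; simp only [Pi.smul_apply]; rw [smul_sub]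

lemma simplex_triv {S : Finset (Fin d → ℝ)} (hS : LinearIndepOn ℝ id (S : Set (Fin d → ℝ)))
    {m : (Fin d → ℝ) → (Fin d → ℝ)} (hm : ∀ u ∈ S, ∀ v ∈ S, ed m u v = 0) :
    ∃ T : Tr d, ∀ v ∈ S, m v = T.t v := by
  obtain ⟨b, hb⟩ := interp hS (fun s => m s ⬝ᵥ s)
  have hdual : ∀ s : Fin d → ℝ, ∃ h : Fin d → ℝ, ∀ v ∈ (S : Set (Fin d → ℝ)), h ⬝ᵥ v = if v = s then 1 else 0 :=
    fun s => interp hS _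
  choose D hD using hdual
  set ν : (Fin d → ℝ) → (Fin d → ℝ) := fun s => m s - b with hν
  have e0 : ∀ s ∈ S, ν s ⬝ᵥ s = 0 := fun s hs => by
    simp only [hν, sub_dotProduct]; rw [hb s hs]; simp
  have e1 : ∀ s ∈ S, ∀ t ∈ S, ν s ⬝ᵥ t = - (ν t ⬝ᵥ s) := fun s hs t ht => by
    have h1 := hm s hs t ht
    have h2 : m s - m t = ν s - ν t := by simp [hν]
    unfold ed at h1
    rw [h2, dotProduct_comm] at h1
    simp only [sub_dotProduct, dotProduct_sub] at h1
    have := e0 s hs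
    have := e0 t ht
    linarith
  let A : (Fin d → ℝ) →ₗ[ℝ] (Fin d → ℝ) :=
    ∑ i ∈ S, ((dotL (D i)).smulRight (ν i) - (dotL (ν i)).smulRight (D i) +
      ∑ k ∈ S, (ν i ⬝ᵥ k) • (dotL (D k)).smulRight (D i))
  have hA : ∀ y, A y = ∑ i ∈ S, ((D i ⬝ᵥ y) • ν i - (ν i ⬝ᵥ y) • D i +
      ∑ k ∈ S, (ν i ⬝ᵥ k) • (D k ⬝ᵥ y) • D i) := by
    intro y; simp [A, LinearMap.sum_apply]
  refine ⟨⟨A, b, fun x => ?_⟩, fun v hv => ?_⟩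
  · rw [hA, sum_dotProduct]
    simp only [add_dotProduct, sub_dotProduct, smul_dotProduct, sum_dotProduct, smul_eq_mul]
    rw [Finset.sum_add_distrib]
    have h1 : ∑ i ∈ S, (D i ⬝ᵥ x * ν i ⬝ᵥ x - ν i ⬝ᵥ x * D i ⬝ᵥ x) = 0 :=
      Finset.sum_eq_zero fun i _ => by ring
    have h2 : ∑ i ∈ S, ∑ k ∈ S, ν i ⬝ᵥ k * (D k ⬝ᵥ x * D i ⬝ᵥ x) =
        - ∑ i ∈ S, ∑ k ∈ S, ν i ⬝ᵥ k * (D k ⬝ᵥ x * D i ⬝ᵥ x) := by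
      conv_lhs => rw [Finset.sum_comm]
      rw [← Finset.sum_neg_distrib]
      refine Finset.sum_congr rfl fun i hi => ?_
      rw [← Finset.sum_neg_distrib]
      refine Finset.sum_congr rfl fun k hk => ?_
      rw [e1 k hk i hi]; ring
    rw [h1]; linarith
  · have : A v = ν v := by
      rw [hA, Finset.sum_add_distrib, Finset.sum_sub_distrib]
      have h1 : ∑ i ∈ S, (D i ⬝ᵥ v) • ν i = ν v := by
        rw [Finset.sum_eq_single v]
        · rw [hD v v hv]; simp
        · intro i _ hi; rw [hD i v hv, if_neg hi.symm]; simp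
        · intro h; exact absurd hv h
      have h2 : ∑ i ∈ S, ∑ k ∈ S, (ν i ⬝ᵥ k) • (D k ⬝ᵥ v) • D i = ∑ i ∈ S, (ν i ⬝ᵥ v) • D i := by
        refine Finset.sum_congr rfl fun i _ => ?_
        rw [Finset.sum_eq_single v]
        · rw [hD v v hv]; simp
        · intro k _ hk; rw [hD k v hv, if_neg hk.symm]; simp
        · intro h; exact absurd hv h
      rw [h1, h2]; abel
    change m v = A v + b
    rw [this]; simp [hν]

theorem star_rigid (hτ : τ.card + 3 = d) (hf : K.Face τ) {m : (Fin d → ℝ) → (Fin d → ℝ)}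
    (hm : K.MotSt τ m) : ∃ T : Tr d, ∀ v, K.Face (insert v τ) → m v = T.t v := by
  obtain ⟨F, hsF, hF⟩ := hf.exists_facet
  obtain ⟨T, hT⟩ := simplex_triv hF.1.li (m := m) (fun u hu v hv => hm u v (hF.1.mono (by
    intro x hx; simp only [Finset.mem_insert] at hx; rcases hx with rfl | rfl | hx
    · exact hu
    · exact hv
    · exact hsF hx)))
  refine ⟨T, fun v hv => ?_⟩
  have := rig0 hτ (m := m - T.t) (fun u v h => by rw [ed_sub, hm u v h, T.ed]; simp) hF hsF
    (fun v hv => by simp [hT v hv]) v hv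
  simpa [sub_eq_zero] using this

/-- global infinitesimal rigidity -/
theorem poly_rigid (hd : 3 ≤ d) {m : (Fin d → ℝ) → (Fin d → ℝ)}
    (hm : ∀ u v, K.Face {u, v} → ed m u v = 0) : ∃ T : Tr d, ∀ v ∈ K.V, m v = T.t v := by
  have hst : ∀ τ, K.MotSt τ m := fun τ u v h => hm u v (h.mono (by
    intro x hx; simp only [Finset.mem_insert, Finset.mem_singleton] at hx ⊢; tauto))
  by_cases hV : K.V.Nonempty
  swap
  · rw [Finset.not_nonempty_iff_eq_empty] at hV
    exact ⟨⟨0, 0, by simp⟩, by simp [hV]⟩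
  obtain ⟨v0, hv0⟩ := hV
  obtain ⟨F0, _, hF0⟩ := (CSP.face_single hv0).exists_facet
  obtain ⟨T, hT⟩ := simplex_triv hF0.1.li (m := m) (fun u hu v hv => hm u v (hF0.1.mono (by
    intro x hx; simp only [Finset.mem_insert, Finset.mem_singleton] at hx; rcases hx with rfl | rfl
    · exact hu
    · exact hv)))
  refine ⟨T, fun v hv => ?_⟩
  have key := CSP.conn hF0 (Finset.empty_subset _) (fun F => ∀ v ∈ F, m v = T.t v) (by
    intro F a a' hF _ ha _ ha' hF' hQ v hv
    have hc : d - 3 ≤ (F.erase a).card := by rw [Finset.card_erase_of_mem ha, hF.2]; omega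
    obtain ⟨τ, hτs, hτc⟩ := Finset.exists_subset_card_eq hc
    have hτF : τ ⊆ F := hτs.trans (Finset.erase_subset _ _)
    have := rig0 (K := K) (τ := τ) (by omega) (m := m - T.t) (fun u v h => by rw [ed_sub, hst τ u v h, T.ed]; simp)
      hF hτF (fun v hv => by simp [hQ v hv]) v (hF'.1.mono (by
        intro x hx
        rcases Finset.mem_insert.1 hx with rfl | hx
        · exact hv
        · exact Finset.mem_insert_of_mem (hτs hx)))
    simpa [sub_eq_zero] using this) hT
  obtain ⟨F, h1, h2⟩ := (CSP.face_single hv).exists_facet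
  exact key F h2 (Finset.empty_subset _) v (h1 (by simp))

end TrivS
end CSLB

namespace CSLB
section Inv
variable {X : Type*} [Fintype X] (σ : X → X) (W : Type*) [AddCommGroup W] [Module ℝ W] [FiniteDimensional ℝ W]

/-- even functions -/
def ev : Submodule ℝ (X → W) where
  carrier := {f | ∀ x, f (σ x) = f x}
  add_mem' := fun {a b} ha hb x => by simp [ha x, hb x]
  zero_mem' := fun x => rfl
  smul_mem' := fun c a ha x => by simp [ha x]
/-- odd functions -/
def od : Submodule ℝ (X → W) where
  carrier := {f | ∀ x, f (σ x) = - f x}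
  add_mem' := fun {a b} ha hb x => by simp only [Pi.add_apply]; rw [ha x, hb x]; abel
  zero_mem' := fun x => by simp
  smul_mem' := fun c a ha x => by simp [ha x]

lemma exists_sign (h1 : ∀ x, σ (σ x) = x) (h2 : ∀ x, σ x ≠ x) :
    ∃ χ : X → ℝ, (∀ x, χ (σ x) = - χ x) ∧ ∀ x, χ x * χ x = 1 := by
  let e := Fintype.equivFin X
  refine ⟨fun x => if e x < e (σ x) then 1 else -1, fun x => ?_, fun x => ?_⟩
  · have h3 : e (σ x) ≠ e x := fun h => h2 x (e.injective h)
    simp only [h1]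
    rcases lt_or_gt_of_ne h3 with h | h
    · rw [if_pos h, if_neg (not_lt.2 h.le)]; simp
    · rw [if_neg (not_lt.2 h.le), if_pos h]
  · simp only; split_ifs <;> simp

lemma invdim (h1 : ∀ x, σ (σ x) = x) (h2 : ∀ x, σ x ≠ x) :
    2 * Module.finrank ℝ (ev σ W) = Fintype.card X * Module.finrank ℝ W ∧
    2 * Module.finrank ℝ (od σ W) = Fintype.card X * Module.finrank ℝ W := by
  obtain ⟨χ, hχ1, hχ2⟩ := exists_sign σ h1 h2
  have hc : IsCompl (ev σ W) (od σ W) := by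
    refine ⟨Submodule.disjoint_def.2 fun f hf hg => ?_, codisjoint_iff_le_sup.2 fun f _ => ?_⟩
    · ext x
      have := (hf x).symm.trans (hg x)
      have h3 : (2:ℝ) • f x = 0 := by rw [two_smul]; nth_rewrite 1 [this]; simp
      simpa using h3
    · rw [Submodule.mem_sup]
      refine ⟨(2:ℝ)⁻¹ • (f + f ∘ σ), fun x => ?_, (2:ℝ)⁻¹ • (f - f ∘ σ), fun x => ?_, ?_⟩
      · simp [h1, add_comm]
      · simp only [Pi.smul_apply, Pi.sub_apply, Function.comp, h1, ← smul_neg, neg_sub]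
      · rw [← smul_add]; ext x; simp only [Pi.smul_apply, Pi.add_apply, Pi.sub_apply, Function.comp]
        rw [show f x + f (σ x) + (f x - f (σ x)) = (2:ℝ) • f x by rw [two_smul]; abel, smul_smul]; norm_num
  have h4 := Submodule.finrank_add_eq_of_isCompl hc
  rw [Module.finrank_pi_fintype] at h4
  simp only [Finset.sum_const, Finset.card_univ, smul_eq_mul] at h4
  let L : (X → W) →ₗ[ℝ] (X → W) :=
    { toFun := fun f x => χ x • f x
      map_add' := fun f g => by ext x; simp
      map_smul' := fun c f => by ext x; simp [smul_smul, mul_comm] }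
  have hL : ∀ f x, L f x = χ x • f x := fun _ _ => rfl
  have hLL : ∀ f, L (L f) = f := fun f => by ext x; rw [hL, hL, smul_smul, hχ2, one_smul]
  have hinj : Function.Injective L := fun f g h => by rw [← hLL f, h, hLL]
  let Le : (X → W) ≃ₗ[ℝ] (X → W) := LinearEquiv.ofInvolutive L hLL
  have hLe : ∀ f x, Le f x = χ x • f x := fun _ _ => rfl
  have l1 : Module.finrank ℝ (ev σ W) ≤ Module.finrank ℝ (od σ W) := by
    rw [← Le.finrank_map_eq]
    apply Submodule.finrank_mono
    rintro _ ⟨f, hf, rfl⟩ x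
    change Le f (σ x) = - Le f x
    rw [hLe, hLe, hχ1, hf x, neg_smul]
  have l2 : Module.finrank ℝ (od σ W) ≤ Module.finrank ℝ (ev σ W) := by
    rw [← Le.finrank_map_eq]
    apply Submodule.finrank_mono
    rintro _ ⟨f, hf, rfl⟩ x
    change Le f (σ x) = Le f x
    rw [hLe, hLe, hχ1, hf x, neg_smul, smul_neg, neg_neg]
  omega
end Inv
end CSLB

namespace CSLB
section PartI
open Matrix
variable {d : ℕ} {K : CSP d}

/-- edges -/
def CSP.E (K : CSP d) : Finset (Finset (Fin d → ℝ)) :=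
  K.V.powerset.filter fun e => e.card = 2 ∧ K.Face e

/-- strain on unordered pairs, as a linear map -/
def Rs (d : ℕ) : ((Fin d → ℝ) → (Fin d → ℝ)) →ₗ[ℝ] (Finset (Fin d → ℝ) → ℝ) where
  toFun := fun m e => (1/2) * ∑ u ∈ e, ∑ v ∈ e, ed m u v
  map_add' := fun m n => by
    ext e; simp only [ed_add, Finset.sum_add_distrib, Pi.add_apply]; ring
  map_smul' := fun c m => by
    ext e; simp only [ed_smul, Pi.smul_apply, smul_eq_mul, RingHom.id_apply, ← Finset.mul_sum]; ring

lemma Rs_apply (m : (Fin d → ℝ) → (Fin d → ℝ)) (e) : Rs d m e = (1/2) * ∑ u ∈ e, ∑ v ∈ e, ed m u v := rfl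

lemma Rs_pair (m : (Fin d → ℝ) → (Fin d → ℝ)) {u v : Fin d → ℝ} (h : u ≠ v) : Rs d m {u, v} = ed m u v := by
  rw [Rs_apply, Finset.sum_pair h, Finset.sum_pair h, Finset.sum_pair h, ed_self, ed_self, ed_comm m v u]; ring

lemma Rs_congr {m n : (Fin d → ℝ) → (Fin d → ℝ)} {e : Finset (Fin d → ℝ)} (h : ∀ v ∈ e, m v = n v) : Rs d m e = Rs d n e := by
  rw [Rs_apply, Rs_apply]; congr 1
  refine Finset.sum_congr rfl fun u hu => Finset.sum_congr rfl fun v hv => ?_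
  simp only [ed, h u hu, h v hv]

lemma ed_ng (m : (Fin d → ℝ) → (Fin d → ℝ)) (u v : Fin d → ℝ) : ed m (-u) (-v) = - ed (fun x => m (-x)) u v := by
  simp only [ed]
  rw [← neg_dotProduct]; congr 1; abel

lemma Rs_ng (m : (Fin d → ℝ) → (Fin d → ℝ)) (e : Finset (Fin d → ℝ)) :
    Rs d m (ng e) = - Rs d (fun x => m (-x)) e := by
  rw [Rs_apply, Rs_apply]
  unfold ng
  rw [Finset.sum_image (fun _ _ _ _ h => neg_injective h)]
  simp_rw [Finset.sum_image (fun _ _ _ _ h => neg_injective h : Set.InjOn (Neg.neg : (Fin d → ℝ) → (Fin d → ℝ)) e), ed_ng]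
  simp only [Finset.sum_neg_distrib]; ring

/-- extension by zero -/
def extL (X : Finset (Fin d → ℝ)) : (X → (Fin d → ℝ)) →ₗ[ℝ] ((Fin d → ℝ) → (Fin d → ℝ)) where
  toFun := fun m v => if h : v ∈ X then m ⟨v, h⟩ else 0
  map_add' := fun m n => by ext v i; simp only [Pi.add_apply]; split_ifs <;> simp
  map_smul' := fun c m => by ext v i; simp only [Pi.smul_apply, RingHom.id_apply]; split_ifs <;> simp
lemma extL_mem {X : Finset (Fin d → ℝ)} (m : X → (Fin d → ℝ)) {v : Fin d → ℝ} (h : v ∈ X) : extL X m v = m ⟨v, h⟩ := by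
  change (if h : v ∈ X then m ⟨v, h⟩ else 0) = _
  rw [dif_pos h]
lemma extL_not {X : Finset (Fin d → ℝ)} (m : X → (Fin d → ℝ)) {v : Fin d → ℝ} (h : v ∉ X) : extL X m v = 0 := by
  change (if h : v ∈ X then m ⟨v, h⟩ else 0) = _
  rw [dif_neg h]

/-- restriction to a finite set -/
def resL {Y : Type*} (E : Finset Y) : (Y → ℝ) →ₗ[ℝ] (E → ℝ) where
  toFun := fun f e => f e
  map_add' := fun _ _ => rfl
  map_smul' := fun _ _ => rfl

lemma mem_E {e : Finset (Fin d → ℝ)} : e ∈ K.E ↔ e.card = 2 ∧ K.Face e := by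
  unfold CSP.E
  rw [Finset.mem_filter, Finset.mem_powerset]
  exact ⟨fun h => h.2, fun h => ⟨h.2.1, h⟩⟩
lemma ng_mem_E {e : Finset (Fin d → ℝ)} (h : e ∈ K.E) : ng e ∈ K.E := by
  rw [mem_E] at *; rw [card_ng]; exact ⟨h.1, h.2.ng⟩
lemma pair_mem_E {u v : Fin d → ℝ} (h : u ≠ v) (hf : K.Face {u, v}) : ({u, v} : Finset _) ∈ K.E :=
  mem_E.2 ⟨Finset.card_pair h, hf⟩
lemma ng_ne_E {e : Finset (Fin d → ℝ)} (h : e ∈ K.E) : ng e ≠ e := by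
  rw [mem_E] at h
  intro he
  have hne : e.Nonempty := Finset.card_pos.1 (by omega)
  obtain ⟨v, hv⟩ := hne
  refine h.2.no_anti hv ?_
  rw [← he, mem_ng, neg_neg]; exact hv

/-- involution on vertices -/
def CSP.nV (K : CSP d) (v : K.V) : K.V := ⟨-v.1, K.neg _ v.2⟩
/-- involution on edges -/
def CSP.nE (K : CSP d) (e : K.E) : K.E := ⟨ng e.1, ng_mem_E e.2⟩

theorem partI (hd : 3 ≤ d) (hc : K.E.card + 2 * d = d * K.V.card) (ρ : Finset (Fin d → ℝ) → ℝ)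
    (hρ : ∀ e ∈ K.E, ρ (ng e) = - ρ e) :
    ∃ m : (Fin d → ℝ) → (Fin d → ℝ), (∀ v ∈ K.V, m (-v) = m v) ∧ ∀ e ∈ K.E, Rs d m e = ρ e := by
  let L0 : (K.V → (Fin d → ℝ)) →ₗ[ℝ] (K.E → ℝ) := (resL K.E).comp ((Rs d).comp (extL K.V))
  have hL0 : ∀ m e, L0 m e = Rs d (extL K.V m) e := fun _ _ => rfl
  have hev : ∀ m ∈ ev K.nV (Fin d → ℝ), ∀ v ∈ K.V, extL K.V m (-v) = extL K.V m v := by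
    intro m hm v hv
    rw [extL_mem m hv, extL_mem m (K.neg v hv)]
    exact hm ⟨v, hv⟩
  let L : ev K.nV (Fin d → ℝ) →ₗ[ℝ] od K.nE ℝ := (L0.domRestrict _).codRestrict _ (by
    rintro ⟨m, hm⟩ e
    change Rs d (extL K.V m) (ng e) = - Rs d (extL K.V m) e
    rw [Rs_ng]
    congr 1
    apply Rs_congr
    intro v hv
    exact hev m hm v ((mem_E.1 e.2).2.mem hv))
  have hL : ∀ m e, (L m).1 e = Rs d (extL K.V m.1) e := fun _ _ => rfl
  have d1 := (invdim K.nV (Fin d → ℝ) (fun x => Subtype.ext (neg_neg _)) (fun x h => by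
    exact CSP.V_ne_neg x.2 (congrArg Subtype.val h).symm)).1
  have d2 := (invdim K.nE ℝ (fun x => Subtype.ext (ng_ng _)) (fun x h => by
    exact ng_ne_E x.2 (congrArg Subtype.val h))).2
  rw [Module.finrank_pi, Fintype.card_fin, Fintype.card_coe] at d1
  rw [Module.finrank_self, Fintype.card_coe] at d2
  let C : (Fin d → ℝ) →ₗ[ℝ] (K.V → (Fin d → ℝ)) := LinearMap.pi fun _ => LinearMap.id
  have hker : Module.finrank ℝ (LinearMap.ker L) ≤ d := by
    have h1 : (LinearMap.ker L).map (ev K.nV (Fin d → ℝ)).subtype ≤ LinearMap.range C := by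
      rintro _ ⟨m, hm, rfl⟩
      have hm0 : L m = 0 := hm
      obtain ⟨T, hT⟩ := poly_rigid (K := K) hd (m := extL K.V m.1) (by
        intro u v huv
        by_cases h : u = v
        · rw [h, ed_self]
        · rw [← Rs_pair _ h, ← hL m ⟨_, pair_mem_E h huv⟩, hm0]; rfl)
      refine ⟨T.b, ?_⟩
      ext1 v
      change T.b = m.1 v
      have e1 := hT v v.2
      have e2 := hT _ (K.neg v v.2)
      rw [hev m.1 m.2 v v.2] at e2
      unfold Tr.t at e1 e2
      rw [map_neg] at e2
      have e3 : T.A v = - T.A v := add_right_cancel (e1.symm.trans e2)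
      have e4 : (2:ℝ) • T.A v = 0 := by rw [two_smul]; nth_rewrite 1 [e3]; simp
      have e5 : T.A v = 0 := by simpa using e4
      rw [e5, zero_add] at e1
      rw [← e1, extL_mem m.1 v.2]
    have h2 := Submodule.finrank_mono h1
    rw [Submodule.finrank_map_subtype_eq] at h2
    have h3 := LinearMap.finrank_range_le C
    rw [Module.finrank_pi, Fintype.card_fin] at h3
    exact h2.trans h3
  have hrk := L.finrank_range_add_finrank_ker
  have hsurj : LinearMap.range L = ⊤ := by
    apply Submodule.eq_top_of_finrank_eq
    apply le_antisymm (Submodule.finrank_le _)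
    have : d * K.V.card = K.V.card * d := mul_comm _ _
    omega
  obtain ⟨m, hm⟩ := LinearMap.range_eq_top.1 hsurj ⟨fun e => ρ e, fun e => hρ e e.2⟩
  refine ⟨extL K.V m.1, hev m.1 m.2, fun e he => ?_⟩
  rw [← hL m ⟨e, he⟩, hm]

/-- stresses are symmetric -/
theorem stress_symm (hd : 3 ≤ d) (hc : K.E.card + 2 * d = d * K.V.card) {ω : Finset (Fin d → ℝ) → ℝ}
    (hω : ∀ m, ∑ e ∈ K.E, ω e * Rs d m e = 0) : ∀ e ∈ K.E, ω (ng e) = ω e := by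
  have hω2 : ∀ m, ∑ e ∈ K.E, ω (ng e) * Rs d m e = 0 := by
    intro m
    have h1 : ∑ e ∈ K.E, ω (ng e) * Rs d m e = ∑ e ∈ K.E, ω e * Rs d m (ng e) := by
      refine Finset.sum_bij' (fun e _ => ng e) (fun e _ => ng e) (fun e h => ng_mem_E h)
        (fun e h => ng_mem_E h) (fun e _ => ng_ng e) (fun e _ => ng_ng e) (fun e _ => by rw [ng_ng])
    rw [h1]
    simp only [Rs_ng, mul_neg, Finset.sum_neg_distrib]
    rw [hω, neg_zero]
  obtain ⟨m, _, hm⟩ := partI (K := K) hd hc (fun e => ω e - ω (ng e)) (fun e _ => by rw [ng_ng]; ring)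
  have h3 : ∑ e ∈ K.E, (ω e - ω (ng e)) * (ω e - ω (ng e)) = 0 := by
    rw [Finset.sum_congr rfl (fun e he => by rw [← hm e he] : ∀ e ∈ K.E, (ω e - ω (ng e)) * (ω e - ω (ng e)) = (ω e - ω (ng e)) * Rs d m e)]
    simp only [sub_mul, Finset.sum_sub_distrib, hω, hω2, sub_zero]
  intro e he
  have := (Finset.sum_eq_zero_iff_of_nonneg (fun e _ => mul_self_nonneg _)).1 h3 e he
  have := mul_self_eq_zero.1 this
  linarith
end PartI
end CSLB

namespace CSLB
section PartD
open Matrix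
variable {d : ℕ} {K : CSP d} {τ : Finset (Fin d → ℝ)}

/-- common vertices of the stars of a face and its antipode -/
def CSP.W (K : CSP d) (τ : Finset (Fin d → ℝ)) : Finset (Fin d → ℝ) :=
  K.V.filter fun w => K.Face (insert w τ) ∧ K.Face (insert (-w) τ)
/-- common edges of the stars of a face and its antipode -/
def CSP.H (K : CSP d) (τ : Finset (Fin d → ℝ)) : Finset (Finset (Fin d → ℝ)) :=
  K.E.filter fun e => K.Face (e ∪ τ) ∧ K.Face (ng e ∪ τ)

lemma mem_W {w : Fin d → ℝ} : w ∈ K.W τ ↔ K.Face (insert w τ) ∧ K.Face (insert (-w) τ) := by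
  unfold CSP.W
  rw [Finset.mem_filter]
  exact ⟨fun h => h.2, fun h => ⟨h.1.mem (by simp), h⟩⟩
lemma W_V {w : Fin d → ℝ} (h : w ∈ K.W τ) : w ∈ K.V := (Finset.mem_filter.1 h).1
lemma W_neg {w : Fin d → ℝ} (h : w ∈ K.W τ) : -w ∈ K.W τ := by
  rw [mem_W] at *; rw [neg_neg]; exact h.symm
lemma W_not {w : Fin d → ℝ} (h : w ∈ K.W τ) : w ∉ τ := by
  rw [mem_W] at h
  intro hw
  exact h.2.no_anti (v := w) (by simp [hw]) (by simp)
lemma mem_H {e : Finset (Fin d → ℝ)} : e ∈ K.H τ ↔ e.card = 2 ∧ K.Face (e ∪ τ) ∧ K.Face (ng e ∪ τ) := by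
  unfold CSP.H
  rw [Finset.mem_filter, mem_E]
  exact ⟨fun h => ⟨h.1.1, h.2⟩, fun h => ⟨⟨h.1, h.2.1.mono Finset.subset_union_left⟩, h.2⟩⟩
lemma H_E {e : Finset (Fin d → ℝ)} (h : e ∈ K.H τ) : e ∈ K.E := (Finset.mem_filter.1 h).1
lemma H_neg {e : Finset (Fin d → ℝ)} (h : e ∈ K.H τ) : ng e ∈ K.H τ := by
  rw [mem_H] at *; rw [ng_ng, card_ng]; exact ⟨h.1, h.2.symm⟩
lemma H_W {e : Finset (Fin d → ℝ)} (h : e ∈ K.H τ) : e ⊆ K.W τ := by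
  intro v hv
  rw [mem_H] at h
  rw [mem_W]
  refine ⟨h.2.1.mono ?_, h.2.2.mono ?_⟩
  · intro x hx; rcases Finset.mem_insert.1 hx with rfl | hx
    · exact Finset.mem_union_left _ hv
    · exact Finset.mem_union_right _ hx
  · intro x hx; rcases Finset.mem_insert.1 hx with rfl | hx
    · exact Finset.mem_union_left _ (by rw [mem_ng, neg_neg]; exact hv)
    · exact Finset.mem_union_right _ hx

lemma D1 (hd : 3 ≤ d) (hc : K.E.card + 2 * d = d * K.V.card) (τ : Finset (Fin d → ℝ))
    (α : Finset (Fin d → ℝ) → ℝ) (hα : ∀ e ∈ K.H τ, α (ng e) = - α e) (n : (Fin d → ℝ) → (Fin d → ℝ)) :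
    ∃ m : (Fin d → ℝ) → (Fin d → ℝ), (∀ v ∈ K.V, m (-v) = m v) ∧
      (∀ e ∈ K.H τ, Rs d (m + n) e = α e + Rs d n e) ∧
      (∀ e ∈ K.E, K.Face (e ∪ τ) → e ∉ K.H τ → Rs d (m + n) e = 0) := by
  obtain ⟨m, hm, hme⟩ := partI (K := K) hd hc (fun e => if K.Face (e ∪ τ) then
      (if K.Face (ng e ∪ τ) then α e else - Rs d n e) else
      (if K.Face (ng e ∪ τ) then Rs d n (ng e) else 0)) (by
    intro e he
    simp only [ng_ng]
    by_cases h1 : K.Face (e ∪ τ) <;> by_cases h2 : K.Face (ng e ∪ τ) <;> simp only [h1, h2, if_true, if_false]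
    · exact hα e (Finset.mem_filter.2 ⟨he, h1, h2⟩)
    · simp
    · simp)
  refine ⟨m, hm, fun e he => ?_, fun e he h1 h2 => ?_⟩
  · have h := mem_H.1 he
    rw [map_add, Pi.add_apply, hme e (H_E he), if_pos h.2.1, if_pos h.2.2]
  · rw [map_add, Pi.add_apply, hme e he, if_pos h1, if_neg]
    · simp
    · intro h3; exact h2 (Finset.mem_filter.2 ⟨he, h1, h3⟩)

lemma motSt_of {m : (Fin d → ℝ) → (Fin d → ℝ)} (h : ∀ e ∈ K.E, K.Face (e ∪ τ) → Rs d m e = 0) : K.MotSt τ m := by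
  intro u v huv
  by_cases huv' : u = v
  · rw [huv', ed_self]
  · rw [← Rs_pair _ huv']
    apply h
    · apply pair_mem_E huv'
      apply huv.mono; intro x hx
      simp only [Finset.mem_insert, Finset.mem_singleton] at hx ⊢; tauto
    · apply huv.mono; intro x hx
      simp only [Finset.mem_insert, Finset.mem_singleton, Finset.mem_union] at hx ⊢; tauto

lemma D2 (hd : 3 ≤ d) (hc : K.E.card + 2 * d = d * K.V.card) (hτ : τ.card + 3 = d) (hf : K.Face τ)
    (n : (Fin d → ℝ) → (Fin d → ℝ)) (hn : ∀ w ∈ K.W τ, n (-w) = - n w)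
    (hz : ∀ e ∈ K.H τ, Rs d n e = 0) : ∃ T : Tr d, ∀ w ∈ K.W τ, n w = T.A w := by
  obtain ⟨m, hm, h1, h2⟩ := D1 hd hc τ 0 (by simp) n
  obtain ⟨T, hT⟩ := star_rigid hτ hf (m := m + n) (motSt_of fun e he hfe => by
    by_cases hH : e ∈ K.H τ
    · rw [h1 e hH, hz e hH]; simp
    · exact h2 e he hfe hH)
  refine ⟨T, fun w hw => ?_⟩
  have hw' := mem_W.1 hw
  have e1 := hT w hw'.1
  have e2 := hT (-w) hw'.2
  simp only [Pi.add_apply, Tr.t] at e1 e2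
  rw [hm w (W_V hw), hn w hw, map_neg] at e2
  have e3 : (2:ℝ) • (n w) = (2:ℝ) • (T.A w) := by
    rw [two_smul, two_smul]
    have : m w + n w - (m w + - n w) = T.A w + T.b - (- T.A w + T.b) := by rw [e1, e2]
    calc n w + n w = m w + n w - (m w + - n w) := by abel
      _ = _ := this
      _ = _ := by abel
  exact smul_right_injective _ (by norm_num : (2:ℝ) ≠ 0) e3

/-- planar strain for projected points -/
def R3 (p : (Fin d → ℝ) → (Fin 3 → ℝ)) : ((Fin d → ℝ) → (Fin 3 → ℝ)) →ₗ[ℝ] (Finset (Fin d → ℝ) → ℝ) where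
  toFun := fun m e => (1/2) * ∑ u ∈ e, ∑ v ∈ e, (p u - p v) ⬝ᵥ (m u - m v)
  map_add' := fun m n => by
    ext e; simp only [Pi.add_apply, add_sub_add_comm, dotProduct_add, Finset.sum_add_distrib]; ring
  map_smul' := fun c m => by
    ext e; simp only [Pi.smul_apply, ← smul_sub, dotProduct_smul, smul_eq_mul, RingHom.id_apply, ← Finset.mul_sum]; ring

lemma R3_pair (p m : (Fin d → ℝ) → (Fin 3 → ℝ)) {u v : Fin d → ℝ} (h : u ≠ v) :
    R3 p m {u, v} = (p u - p v) ⬝ᵥ (m u - m v) := by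
  change (1/2) * ∑ u ∈ _, ∑ v ∈ _, (p u - p v) ⬝ᵥ (m u - m v) = _
  rw [Finset.sum_pair h, Finset.sum_pair h, Finset.sum_pair h]
  simp only [sub_self, zero_dotProduct, add_zero, zero_add]
  rw [← neg_sub (p u), ← neg_sub (m u), neg_dotProduct, dotProduct_neg]; ring

lemma D3 (hd : 3 ≤ d) (hc : K.E.card + 2 * d = d * K.V.card) (hf : K.Face τ)
    (R : Red K τ) (α : Finset (Fin d → ℝ) → ℝ) (hα : ∀ e ∈ K.H τ, α (ng e) = - α e)
    (n : (Fin d → ℝ) → (Fin d → ℝ)) :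
    ∃ μ : (Fin d → ℝ) → (Fin 3 → ℝ), ∀ e ∈ K.H τ,
      (∏ v ∈ e, R.l v) * R3 R.p μ e = α e + Rs d n e := by
  obtain ⟨m, hm, h1, h2⟩ := D1 hd hc τ α hα n
  have hnot : ∀ u v, u ∈ τ → u ≠ v → K.Face (insert v τ) → ed (m + n) u v = 0 := by
    intro u v hu huv hfv
    rw [← Rs_pair _ huv]
    apply h2
    · apply pair_mem_E huv; apply hfv.mono; intro x hx
      simp only [Finset.mem_insert, Finset.mem_singleton] at hx ⊢
      rcases hx with rfl | rfl
      · right; exact hu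
      · left; rfl
    · apply hfv.mono; intro x hx
      simp only [Finset.mem_insert, Finset.mem_singleton, Finset.mem_union] at hx ⊢
      rcases hx with (rfl | rfl) | h
      · right; exact hu
      · left; rfl
      · right; exact h
    · intro hH
      exact W_not (H_W hH (by simp : u ∈ _)) hu
  obtain ⟨T, hT⟩ := simplex_triv hf.li (m := m + n) (fun u hu v hv => by
    by_cases huv : u = v
    · rw [huv, ed_self]
    · exact hnot u v hu huv (by rwa [Finset.insert_eq_of_mem hv]))
  set z := m + n - T.t with hz
  have hze : ∀ u v, ed z u v = ed (m + n) u v := fun u v => by rw [hz, ed_sub, T.ed, sub_zero]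
  have hz0 : ∀ s ∈ τ, z s = 0 := fun s hs => by rw [hz, Pi.sub_apply, hT s hs, sub_self]
  obtain ⟨μ, hμ⟩ := R.exists_mu z
  have hfull : ∀ v ∈ K.W τ, _ := fun v hv => (hμ v (W_V hv) (W_not hv) (fun s hs => by
    have := hnot s v hs (fun h => W_not hv (h ▸ hs)) (mem_W.1 hv).1
    rw [← hze] at this
    unfold ed at this
    rw [hz0 s hs, zero_sub, dotProduct_neg, neg_eq_zero, sub_dotProduct, dotProduct_comm, dotProduct_comm v] at this
    linarith)).1
  refine ⟨μ, fun e he => ?_⟩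
  rw [← h1 e he]
  have hWe := H_W he
  obtain ⟨u, v, huv, rfl⟩ := Finset.card_eq_two.1 (mem_H.1 he).1
  have hu := hWe (by simp : u ∈ _)
  have hv := hWe (by simp : v ∈ _)
  rw [Finset.prod_pair huv, R3_pair _ _ huv, Rs_pair _ huv, ← hze,
    Red.mu_id (W_V hu) (W_V hv) (W_not hu) (W_not hv) (hfull u hu) (hfull v hv)]
  have := Red.l_pos (R := R) (W_V hu) (W_not hu)
  have := Red.l_pos (R := R) (W_V hv) (W_not hv)
  field_simp
end PartD
end CSLB

namespace CSLB
section PartD5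
open Matrix
variable {d : ℕ} {K : CSP d} {τ : Finset (Fin d → ℝ)}

/-- involution on common vertices -/
def CSP.nW (K : CSP d) (τ : Finset (Fin d → ℝ)) (v : K.W τ) : K.W τ := ⟨-v.1, W_neg v.2⟩
/-- involution on common edges -/
def CSP.nH (K : CSP d) (τ : Finset (Fin d → ℝ)) (v : K.H τ) : K.H τ := ⟨ng v.1, H_neg v.2⟩

/-- swap on ordered pairs -/
def offSw (B : Finset (Fin d → ℝ)) (p : B.offDiag) : B.offDiag :=
  ⟨(p.1.2, p.1.1), by have := p.2; simp only [Finset.mem_offDiag] at *; exact ⟨this.2.1, this.1, this.2.2.symm⟩⟩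

lemma exists_basis (W : Finset (Fin d → ℝ)) : ∃ B ⊆ W, LinearIndepOn ℝ id (B : Set (Fin d → ℝ)) ∧
    Submodule.span ℝ (B : Set (Fin d → ℝ)) = Submodule.span ℝ (W : Set (Fin d → ℝ)) := by
  obtain ⟨b, h1, h2, h3⟩ := exists_linearIndependent ℝ (W : Set (Fin d → ℝ))
  have hb : b.Finite := W.finite_toSet.subset h1
  refine ⟨hb.toFinset, fun x hx => ?_, ?_, ?_⟩
  · exact h1 (hb.mem_toFinset.1 hx)
  · rw [hb.coe_toFinset]; exact h3
  · rw [hb.coe_toFinset]; exact h2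

lemma D5 (hd : 3 ≤ d) (hc : K.E.card + 2 * d = d * K.V.card) (hτ : τ.card + 3 = d) (hf : K.Face τ)
    (hW : (K.W τ).Nonempty) : ∃ X : Submodule ℝ (K.H τ → ℝ), X ≤ ev (K.nH τ) ℝ ∧
      (∀ x ∈ X, ∃ n, ∀ e : K.H τ, x e = Rs d n e) ∧
      (∃ j, 1 ≤ j ∧ j ≤ d ∧ 2 * j ≤ (K.W τ).card ∧
        (K.W τ).card * d ≤ 2 * Module.finrank ℝ X + j * (j - 1) + 2 * (j * (d - j))) := by
  obtain ⟨B, hBW, hBli, hBsp⟩ := exists_basis (K.W τ)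
  set S := Submodule.span ℝ (B : Set (Fin d → ℝ)) with hS
  let O := od (K.nW τ) (Fin d → ℝ)
  have dO := (invdim (K.nW τ) (Fin d → ℝ) (fun x => Subtype.ext (neg_neg _)) (fun x h =>
    CSP.V_ne_neg (W_V x.2) (congrArg Subtype.val h).symm)).2
  rw [Module.finrank_pi, Fintype.card_fin, Fintype.card_coe] at dO
  have dP := (invdim (offSw B) ℝ (fun x => rfl) (fun x h => by
    have h1 : x.1.2 = x.1.1 := congrArg (fun y => y.1.1) h
    have := x.2; rw [Finset.mem_offDiag] at this; exact this.2.2 h1.symm)).2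
  rw [Module.finrank_self, Fintype.card_coe, Finset.offDiag_card] at dP
  let G1 : O →ₗ[ℝ] od (offSw B) ℝ :=
    { toFun := fun n => ⟨fun p => extL _ n.1 p.1.1 ⬝ᵥ p.1.2 - extL _ n.1 p.1.2 ⬝ᵥ p.1.1, fun p => by
        simp only [offSw]; ring⟩
      map_add' := fun m n => by
        ext p; simp only [Submodule.coe_add, map_add, Pi.add_apply, add_dotProduct]; ring
      map_smul' := fun c n => by
        ext p; simp only [Submodule.coe_smul, map_smul, Pi.smul_apply, smul_dotProduct, RingHom.id_apply, smul_eq_mul]; ring }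
  let G2 : O →ₗ[ℝ] (B → (Fin d → ℝ) ⧸ S) :=
    { toFun := fun n b => S.mkQ (extL _ n.1 b)
      map_add' := fun m n => by ext b; simp only [Submodule.coe_add, map_add, Pi.add_apply]
      map_smul' := fun c n => by ext b; simp only [Submodule.coe_smul, map_smul, Pi.smul_apply, RingHom.id_apply] }
  let G := G1.prod G2
  have hG : ∀ n, n ∈ LinearMap.ker G → (∀ b ∈ B, ∀ b' ∈ B, extL _ n.1 b ⬝ᵥ b' = extL _ n.1 b' ⬝ᵥ b) ∧
      ∀ b ∈ B, extL _ n.1 b ∈ S := by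
    intro n hn
    have h0 : G n = 0 := hn
    have h1 : G1 n = 0 := congrArg Prod.fst h0
    have h2 : G2 n = 0 := congrArg Prod.snd h0
    refine ⟨fun b hb b' hb' => ?_, fun b hb => ?_⟩
    · by_cases hbb : b = b'
      · rw [hbb]
      · have h3 := congrFun (congrArg Subtype.val h1) ⟨(b, b'), Finset.mem_offDiag.2 ⟨hb, hb', hbb⟩⟩
        exact sub_eq_zero.1 h3
    · have h3 := congrFun h2 ⟨b, hb⟩
      exact (Submodule.Quotient.mk_eq_zero S).1 h3
  have hrk := G.finrank_range_add_finrank_ker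
  have hle := Submodule.finrank_le (LinearMap.range G)
  rw [Module.finrank_prod, Module.finrank_pi_fintype] at hle
  simp only [Finset.sum_const, Finset.card_univ, smul_eq_mul, Fintype.card_coe] at hle
  have hq := S.finrank_quotient_add_finrank
  have hSB : Module.finrank ℝ S = B.card := finrank_span_finset_eq_card hBli
  rw [hSB, Module.finrank_pi, Fintype.card_fin] at hq
  let RH : O →ₗ[ℝ] (K.H τ → ℝ) := (resL (K.H τ)).comp ((Rs d).comp ((extL (K.W τ)).comp O.subtype))
  have hRH : ∀ n e, RH n e = Rs d (extL _ n.1) e := fun _ _ => rfl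
  have hodd : ∀ n : O, ∀ w ∈ K.W τ, extL _ n.1 (-w) = - extL _ n.1 w := by
    intro n w hw
    rw [extL_mem _ hw, extL_mem _ (W_neg hw)]
    exact n.2 ⟨w, hw⟩
  have hinj : Function.Injective (RH.domRestrict (LinearMap.ker G)) := by
    refine (injective_iff_map_eq_zero _).2 ?_
    rintro ⟨n, hn⟩ h0
    have h0' : RH n = 0 := h0
    obtain ⟨T, hT⟩ := D2 hd hc hτ hf (extL _ n.1) (hodd n) (fun e he => by rw [← hRH n ⟨e, he⟩, h0']; rfl)
    obtain ⟨g1, g2⟩ := hG n hn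
    have talt : ∀ x y, T.A x ⬝ᵥ y = - (T.A y ⬝ᵥ x) := by
      intro x y
      have := T.alt (x + y)
      have h1 := T.alt x
      have h2 := T.alt y
      simp only [map_add, add_dotProduct, dotProduct_add] at this
      linarith
    have z1 : ∀ b ∈ B, ∀ b' ∈ B, T.A b ⬝ᵥ b' = 0 := by
      intro b hb b' hb'
      have := g1 b hb b' hb'
      rw [hT b (hBW hb), hT b' (hBW hb'), talt b' b] at this
      linarith
    have z2 : ∀ b ∈ B, T.A b = 0 := by
      intro b hb
      have h3 : ∀ y ∈ S, T.A b ⬝ᵥ y = 0 := by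
        intro y hy
        induction hy using Submodule.span_induction with
        | mem x hx => exact z1 b hb x hx
        | zero => simp
        | add x y _ _ hx hy => rw [dotProduct_add, hx, hy, add_zero]
        | smul c x _ hx => rw [dotProduct_smul, hx, smul_zero]
      have h4 := h3 _ (g2 b hb)
      rw [hT b (hBW hb)] at h4
      exact dotProduct_self_eq_zero.1 h4
    have z3 : ∀ y ∈ S, T.A y = 0 := by
      intro y hy
      induction hy using Submodule.span_induction with
      | mem x hx => exact z2 x hx
      | zero => simp
      | add x y _ _ hx hy => rw [map_add, hx, hy, add_zero]
      | smul c x _ hx => rw [map_smul, hx, smul_zero]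
    apply Subtype.ext
    apply Subtype.ext
    ext1 w
    have h5 := hT w w.2
    rw [z3 w (by rw [hBsp]; exact Submodule.subset_span w.2), extL_mem _ w.2] at h5
    exact h5
  refine ⟨LinearMap.range (RH.domRestrict (LinearMap.ker G)), ?_, ?_, B.card, ?_, ?_, ?_, ?_⟩
  · rintro _ ⟨⟨n, hn⟩, rfl⟩ e
    change Rs d (extL _ n.1) (ng e) = Rs d (extL _ n.1) e
    rw [Rs_ng]
    have : Rs d (fun x => extL _ n.1 (-x)) e = Rs d ((-1:ℝ) • extL _ n.1) e := by
      apply Rs_congr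
      intro v hv
      rw [hodd n v (H_W e.2 hv)]; simp
    rw [this, map_smul]; simp
  · rintro _ ⟨⟨n, hn⟩, rfl⟩
    exact ⟨extL _ n.1, fun e => rfl⟩
  · rw [Nat.succ_le_iff, Finset.card_pos]
    by_contra hB
    rw [Finset.not_nonempty_iff_eq_empty] at hB
    obtain ⟨w, hw⟩ := hW
    have : w ∈ S := by rw [hBsp]; exact Submodule.subset_span hw
    rw [hS, hB] at this
    simp at this
    exact CSP.V_ne_zero (W_V hw) this
  · exact card_le_of_li hBli
  · have hdis : Disjoint B (ng B) := by
      rw [Finset.disjoint_left]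
      intro b hb hb'
      rw [mem_ng] at hb'
      obtain ⟨h, hh⟩ := interp hBli (fun v => if v = b then 1 else 0)
      have h1 := hh b hb
      have h2 := hh (-b) hb'
      rw [if_pos rfl] at h1
      rw [if_neg (fun h => CSP.V_ne_neg (W_V (hBW hb)) h.symm), dotProduct_neg, h1] at h2
      norm_num at h2
    have hsub : B ∪ ng B ⊆ K.W τ := by
      intro x hx
      rcases Finset.mem_union.1 hx with hx | hx
      · exact hBW hx
      · have := W_neg (hBW (mem_ng.1 hx)); rwa [neg_neg] at this
    have := Finset.card_le_card hsub
    rw [Finset.card_union_of_disjoint hdis, card_ng] at this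
    omega
  · rw [LinearMap.finrank_range_of_inj hinj]
    have hq' : Module.finrank ℝ ((Fin d → ℝ) ⧸ S) = d - B.card := by omega
    rw [hq'] at hle
    have h6 : B.card * (B.card - 1) = B.card * B.card - B.card := by rw [Nat.mul_sub, mul_one]
    have h7 : Module.finrank ℝ O = Module.finrank ℝ (od (K.nW τ) (Fin d → ℝ)) := rfl
    omega
end PartD5
end CSLB

namespace CSLB
section PartD6
open Matrix
variable {d : ℕ} {K : CSP d} {τ : Finset (Fin d → ℝ)}

/-- extension by zero, planar version -/
def extL3 (X : Finset (Fin d → ℝ)) : (X → (Fin 3 → ℝ)) →ₗ[ℝ] ((Fin d → ℝ) → (Fin 3 → ℝ)) where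
  toFun := fun m v => if h : v ∈ X then m ⟨v, h⟩ else 0
  map_add' := fun m n => by ext v i; simp only [Pi.add_apply]; split_ifs <;> simp
  map_smul' := fun c m => by ext v i; simp only [Pi.smul_apply, RingHom.id_apply]; split_ifs <;> simp
lemma extL3_mem {X : Finset (Fin d → ℝ)} (m : X → (Fin 3 → ℝ)) {v : Fin d → ℝ} (h : v ∈ X) : extL3 X m v = m ⟨v, h⟩ := by
  change (if h : v ∈ X then m ⟨v, h⟩ else 0) = _
  rw [dif_pos h]

lemma R3_congr (p : (Fin d → ℝ) → (Fin 3 → ℝ)) {m n : (Fin d → ℝ) → (Fin 3 → ℝ)} {e : Finset (Fin d → ℝ)} (h : ∀ v ∈ e, m v = n v) : R3 p m e = R3 p n e := by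
  change (1/2) * ∑ u ∈ _, ∑ v ∈ _, (p u - p v) ⬝ᵥ (m u - m v) = (1/2) * ∑ u ∈ _, ∑ v ∈ _, (p u - p v) ⬝ᵥ (n u - n v)
  congr 1
  refine Finset.sum_congr rfl fun u hu => Finset.sum_congr rfl fun v hv => ?_
  rw [h u hu, h v hv]

/-- infinitesimal isometries in dimension three -/
def Phi (p : (Fin d → ℝ) → (Fin 3 → ℝ)) (X : Finset (Fin d → ℝ)) :
    ((Fin 3 → ℝ) × (Fin 3 → ℝ)) →ₗ[ℝ] (X → (Fin 3 → ℝ)) where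
  toFun := fun ab w => cr ab.1 (p w) + ab.2
  map_add' := fun a b => by
    ext w : 1
    change cr (a.1 + b.1) (p w) + (a.2 + b.2) = (cr a.1 (p w) + a.2) + (cr b.1 (p w) + b.2)
    rw [cr_add_left]; abel
  map_smul' := fun c a => by
    ext w : 1
    change cr (c • a.1) (p w) + c • a.2 = c • (cr a.1 (p w) + a.2)
    rw [cr_smul_left, smul_add]

lemma cr_dot (α x y β : Fin 3 → ℝ) : (x - y) ⬝ᵥ ((cr α x + β) - (cr α y + β)) = 0 := by
  simp [cr, dotProduct, Fin.sum_univ_three]; ring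

lemma D6 (hd : 3 ≤ d) (hc : K.E.card + 2 * d = d * K.V.card) (hτ : τ.card + 3 = d) (hf : K.Face τ)
    (X : Submodule ℝ (K.H τ → ℝ)) (hX : X ≤ ev (K.nH τ) ℝ)
    (hXn : ∀ x ∈ X, ∃ n, ∀ e : K.H τ, x e = Rs d n e) (hH : (K.H τ).Nonempty) :
    2 * Module.finrank ℝ X + (K.H τ).card + 12 ≤ 6 * (K.W τ).card := by
  obtain ⟨R⟩ := exists_red hτ hf
  let Lw : (K.W τ → (Fin 3 → ℝ)) →ₗ[ℝ] (K.H τ → ℝ) :=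
    { toFun := fun μ e => (∏ v ∈ e.1, R.l v) * R3 R.p (extL3 _ μ) e
      map_add' := fun a b => by ext e; simp only [map_add, Pi.add_apply]; ring
      map_smul' := fun c a => by ext e; simp only [map_smul, Pi.smul_apply, RingHom.id_apply, smul_eq_mul]; ring }
  have hLw : ∀ μ e, Lw μ e = (∏ v ∈ e.1, R.l v) * R3 R.p (extL3 _ μ) e := fun _ _ => rfl
  have dH := (invdim (K.nH τ) ℝ (fun x => Subtype.ext (ng_ng _)) (fun x h => by
    exact ng_ne_E (H_E x.2) (congrArg Subtype.val h))).2
  rw [Module.finrank_self, Fintype.card_coe] at dH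
  have hdis : od (K.nH τ) ℝ ⊓ X = ⊥ := by
    rw [eq_bot_iff]
    rintro f ⟨h1, h2⟩
    have h3 := hX h2
    rw [Submodule.mem_bot]
    ext e
    have := (h1 e).symm.trans (h3 e)
    simp only [Pi.zero_apply]; linarith
  have hsum := Submodule.finrank_sup_add_finrank_inf_eq (od (K.nH τ) ℝ) X
  rw [hdis, finrank_bot, add_zero] at hsum
  have hle : od (K.nH τ) ℝ ⊔ X ≤ LinearMap.range Lw := by
    intro f hf'
    obtain ⟨a, ha, x, hx, rfl⟩ := Submodule.mem_sup.1 hf'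
    obtain ⟨n, hn⟩ := hXn x hx
    obtain ⟨μ, hμ⟩ := D3 hd hc hf R (fun e => if h : e ∈ K.H τ then a ⟨e, h⟩ else 0) (by
      intro e he
      rw [dif_pos he, dif_pos (H_neg he)]
      exact ha ⟨e, he⟩) n
    refine ⟨fun w => μ w, ?_⟩
    ext e
    have h1 := hμ e e.2
    rw [dif_pos e.2] at h1
    rw [hLw, Pi.add_apply, hn e, ← h1]
    congr 1
    apply R3_congr
    intro v hv
    rw [extL3_mem _ (H_W e.2 hv)]
  have hrk := Lw.finrank_range_add_finrank_ker
  rw [Module.finrank_pi_fintype] at hrk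
  simp only [Module.finrank_pi, Fintype.card_fin, Finset.sum_const, Finset.card_univ, smul_eq_mul, Fintype.card_coe] at hrk
  have h6 : 6 ≤ Module.finrank ℝ (LinearMap.ker Lw) := by
    have hr : LinearMap.range (Phi R.p (K.W τ)) ≤ LinearMap.ker Lw := by
      rintro _ ⟨ab, rfl⟩
      change Lw _ = 0
      ext e
      have hWe := H_W e.2
      obtain ⟨u, v, huv, he⟩ := Finset.card_eq_two.1 (mem_H.1 e.2).1
      rw [he] at hWe
      rw [hLw, he, R3_pair _ _ huv, extL3_mem _ (hWe (by simp : u ∈ _)), extL3_mem _ (hWe (by simp : v ∈ _))]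
      change _ * ((R.p u - R.p v) ⬝ᵥ ((cr ab.1 (R.p u) + ab.2) - (cr ab.1 (R.p v) + ab.2))) = 0
      rw [cr_dot, mul_zero]
    have hi : Function.Injective (Phi R.p (K.W τ)) := by
      refine (injective_iff_map_eq_zero _).2 ?_
      rintro ⟨α, β⟩ h0
      have hz : ∀ w ∈ K.W τ, cr α (R.p w) + β = 0 := fun w hw => congrFun h0 ⟨w, hw⟩
      have hz1 : ∀ w ∈ K.W τ, cr α (R.p w) = 0 ∧ β = 0 := by
        intro w hw
        have e1 := hz w hw
        have e2 := hz _ (W_neg hw)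
        have l1 := Red.l_pos (R := R) (W_V hw) (W_not hw)
        have l2 := Red.l_pos (R := R) (W_V (W_neg hw)) (W_not (W_neg hw))
        have e3 : R.p (-w) = (-(R.l w / R.l (-w))) • R.p w := by
          unfold Red.p
          rw [R.πneg, smul_smul, smul_neg, ← neg_smul]; congr 1; field_simp
        have e4 : cr α (R.p (-w)) = (-(R.l w / R.l (-w))) • cr α (R.p w) := by
          rw [e3]; ext i; fin_cases i <;> simp [cr] <;> ring
        rw [e4] at e2
        have e5 : (1 + R.l w / R.l (-w)) • cr α (R.p w) = 0 := by
          rw [add_smul, one_smul]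
          have : cr α (R.p w) + β - ((-(R.l w / R.l (-w))) • cr α (R.p w) + β) = 0 := by rw [e1, e2]; simp
          rw [neg_smul] at this
          rw [← this]; abel
        have e6 : cr α (R.p w) = 0 := by
          rcases smul_eq_zero.1 e5 with h | h
          · have : 0 < R.l w / R.l (-w) := by positivity
            linarith
          · exact h
        refine ⟨e6, ?_⟩
        rw [e6, zero_add] at e1; exact e1
      obtain ⟨e, he⟩ := hH
      have hWe := H_W he
      obtain ⟨u, v, huv, he'⟩ := Finset.card_eq_two.1 (mem_H.1 he).1
      have hu := hWe (by simp [he'] : u ∈ e)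
      have hv := hWe (by simp [he'] : v ∈ e)
      have hα : α = 0 := by
        by_contra hα
        have hface : K.Face (insert u (insert v τ)) := by
          apply (mem_H.1 he).2.1.mono
          intro x hx; rw [he']; simp only [Finset.mem_insert, Finset.mem_union, Finset.mem_singleton] at *; tauto
        obtain ⟨F, hsF, hF⟩ := hface.exists_facet
        have hcard : (insert u (insert v τ)).card + 1 = d := by
          rw [Finset.card_insert_of_notMem, Finset.card_insert_of_notMem (W_not hv)]
          · omega
          · simp only [Finset.mem_insert, not_or]; exact ⟨huv, W_not hu⟩
        obtain ⟨c, hcF, hcn⟩ : ∃ c ∈ F, c ∉ insert u (insert v τ) := by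
          by_contra hcon
          push Not at hcon
          have := Finset.card_le_card (fun x hx => hcon x hx : F ⊆ _)
          have := hF.2; omega
        have hFe : insert c (insert u (insert v τ)) = F := by
          apply Finset.eq_of_subset_of_card_le
          · intro x hx; rcases Finset.mem_insert.1 hx with rfl | hx
            · exact hcF
            · exact hsF hx
          · rw [Finset.card_insert_of_notMem hcn, hF.2, hcard]
        have ht : K.Tri τ c u v := by unfold CSP.Tri; rw [hFe]; exact hF
        apply Red.tri_det (R := R) hτ ht.ro
        have pu := par_of_cr hα (a := R.p u) (by rw [cr_swap, (hz1 u hu).1, neg_zero])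
        have pv := par_of_cr hα (a := R.p v) (by rw [cr_swap, (hz1 v hv).1, neg_zero])
        rw [pu, pv]
        simp [dt, cr, dotProduct, Fin.sum_univ_three]; ring
      rw [hα, (hz1 u hu).2]; rfl
    have h1 := LinearMap.finrank_range_of_inj hi
    have h2 := Submodule.finrank_mono hr
    rw [h1, Module.finrank_prod, Module.finrank_pi, Fintype.card_fin] at h2
    exact h2
  have h7 := Submodule.finrank_mono hle
  omega

lemma octa_arith {d t i N E0 k F : ℕ} (hd : 4 ≤ d) (hj2 : d * t * 2 + (i + 1) * (i + 2) ≤ 2 * N)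
    (dH : 2 * F = E0) (hb : N ≤ F) (h6 : 2 * N + E0 + 12 ≤ 6 * k) (hk : 2 * ((i + 1) + t) = k) :
    t = 0 ∧ (i = 1 ∨ i = 2) := by
  have h1 : 4 * N + 12 ≤ 6 * k := by omega
  have h2 : 4 * t ≤ d * t := Nat.mul_le_mul_right _ hd
  have h3 : 4 * t * 2 + (i + 1) * (i + 2) ≤ 2 * N := by omega
  have h4 : i * i + 2 + 2 * t ≤ 3 * i := by
    have : (i + 1) * (i + 2) = i * i + 3 * i + 2 := by ring
    omega
  have h5 : i ≤ 2 := by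
    by_contra h
    have : 3 * i ≤ i * i := Nat.mul_le_mul_right _ (by omega)
    omega
  interval_cases i <;> omega

set_option maxHeartbeats 1000000 in
theorem octa (hd : 4 ≤ d) (hc : K.E.card + 2 * d = d * K.V.card) (hτ : τ.card + 3 = d) (hf : K.Face τ)
    (hW : (K.W τ).Nonempty) :
    (K.W τ).card = 6 ∧ ∀ u ∈ K.W τ, ∀ v ∈ K.W τ, u ≠ v → u ≠ -v → {u, v} ∈ K.H τ := by
  obtain ⟨X, hX, hXn, j, j1, j2, j3, hj⟩ := D5 (by omega) hc hτ hf hW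
  have dH := (invdim (K.nH τ) ℝ (fun x => Subtype.ext (ng_ng _)) (fun x h => by
    exact ng_ne_E (H_E x.2) (congrArg Subtype.val h))).1
  rw [Module.finrank_self, Fintype.card_coe, mul_one] at dH
  have hb := Submodule.finrank_mono hX
  have dW := (invdim (K.nW τ) ℝ (fun x => Subtype.ext (neg_neg _)) (fun x h =>
    CSP.V_ne_neg (W_V x.2) (congrArg Subtype.val h).symm)).1
  rw [Module.finrank_self, Fintype.card_coe, mul_one] at dW
  set N := Module.finrank ℝ X
  set k := (K.W τ).card with hk
  set E0 := (K.H τ).card with hE0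
  set κ := Module.finrank ℝ (ev (K.nW τ) ℝ)
  obtain ⟨i, rfl⟩ : ∃ i, j = i + 1 := ⟨j - 1, by omega⟩
  obtain ⟨t, ht⟩ : ∃ t, κ = (i + 1) + t := ⟨κ - (i + 1), by omega⟩
  obtain ⟨r, hr⟩ : ∃ r, d = (i + 1) + r := ⟨d - (i + 1), by omega⟩
  have hj2 : d * t * 2 + (i + 1) * (i + 2) ≤ 2 * N := by
    have h1 : d - (i + 1) = r := by omega
    rw [h1, ← dW, ht, Nat.add_sub_cancel] at hj
    nlinarith
  have hN : 0 < N := by nlinarith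
  have hHne : (K.H τ).Nonempty := Finset.card_pos.1 (by omega)
  have h6 := D6 (by omega) hc hτ hf X hX hXn hHne
  let an := (K.W τ).image fun w => ({w, -w} : Finset (Fin d → ℝ))
  have ha : k ≤ 2 * an.card := by
    have hsub : K.W τ ⊆ an.biUnion id := by
      intro w hw
      rw [Finset.mem_biUnion]
      exact ⟨{w, -w}, Finset.mem_image_of_mem _ hw, by simp⟩
    have h1 := Finset.card_le_card hsub
    have h2 := Finset.card_biUnion_le_card_mul an id 2 (by
      intro e he
      obtain ⟨w, _, rfl⟩ := Finset.mem_image.1 he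
      exact Finset.card_le_two)
    omega
  have hdis : Disjoint (K.H τ) an := by
    rw [Finset.disjoint_left]
    intro e he he'
    obtain ⟨w, _, rfl⟩ := Finset.mem_image.1 he'
    exact (mem_E.1 (H_E he)).2.no_anti (v := w) (by simp) (by simp)
  have hsub : K.H τ ∪ an ⊆ (K.W τ).powersetCard 2 := by
    intro e he
    rw [Finset.mem_powersetCard]
    rcases Finset.mem_union.1 he with he | he
    · exact ⟨H_W he, (mem_H.1 he).1⟩
    · obtain ⟨w, hw, rfl⟩ := Finset.mem_image.1 he
      refine ⟨?_, Finset.card_pair (CSP.V_ne_neg (W_V hw))⟩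
      intro x hx; simp only [Finset.mem_insert, Finset.mem_singleton] at hx
      rcases hx with rfl | rfl
      · exact hw
      · exact W_neg hw
  have hcard := Finset.card_le_card hsub
  rw [Finset.card_union_of_disjoint hdis, Finset.card_powersetCard] at hcard
  obtain ⟨ht0, hi⟩ := octa_arith hd hj2 dH hb h6 (by rw [← ht]; exact dW)
  rcases hi with rfl | rfl
  · exfalso
    have : k = 4 := by omega
    rw [← hk, this] at hcard
    simp [Nat.choose] at hcard
    omega
  · have hk6 : k = 6 := by omega
    refine ⟨hk6, ?_⟩
    have heq : K.H τ ∪ an = (K.W τ).powersetCard 2 := by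
      apply Finset.eq_of_subset_of_card_le hsub
      rw [Finset.card_union_of_disjoint hdis, Finset.card_powersetCard, ← hk, hk6]
      simp [Nat.choose]; omega
    intro u hu v hv huv huv'
    have : ({u, v} : Finset (Fin d → ℝ)) ∈ K.H τ ∪ an := by
      rw [heq, Finset.mem_powersetCard]
      refine ⟨?_, Finset.card_pair huv⟩
      intro x hx; simp only [Finset.mem_insert, Finset.mem_singleton] at hx
      rcases hx with rfl | rfl
      · exact hu
      · exact hv
    rcases Finset.mem_union.1 this with h | h
    · exact h
    · exfalso
      obtain ⟨w, _, hw⟩ := Finset.mem_image.1 h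
      have h1 : u ∈ ({w, -w} : Finset _) := by rw [hw]; simp
      have h2 : v ∈ ({w, -w} : Finset _) := by rw [hw]; simp
      simp only [Finset.mem_insert, Finset.mem_singleton] at h1 h2
      rcases h1 with rfl | rfl <;> rcases h2 with rfl | rfl
      · exact huv rfl
      · exact huv' (by simp)
      · exact huv' rfl
      · exact huv rfl
end PartD6
end CSLB

namespace CSLB
section PartE
variable {d : ℕ} {K : CSP d} {τ : Finset (Fin d → ℝ)}

/-- no missing facets -/
def CSP.Prm (K : CSP d) : Prop :=
  ∀ σ : Finset (Fin d → ℝ), σ ⊆ K.V → σ.card = d → (∀ τ ⊂ σ, K.Face τ) → K.Face σ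

lemma claim (hd : 4 ≤ d) (hc : K.E.card + 2 * d = d * K.V.card) (hτ : τ.card + 3 = d) (hf : K.Face τ)
    {x y : Fin d → ℝ} (fx : K.Face (insert x τ)) (fy : K.Face (insert y τ)) (hxy : K.Face {x, y}) :
    K.Face (insert x (insert y τ)) := by
  by_contra hcon
  have hne : x ≠ y := by
    rintro rfl; apply hcon; simpa using fx
  have he : ({x, y} : Finset (Fin d → ℝ)) ∈ K.E := mem_E.2 ⟨Finset.card_pair hne, hxy⟩
  have hee := ng_ne_E he
  obtain ⟨m, -, hm⟩ := partI (K := K) (by omega) hc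
    (fun e => if e = {x, y} then 1 else if e = ng {x, y} then -1 else 0) (by
      intro e _
      by_cases h1 : e = {x, y}
      · subst h1
        simp only [if_true, if_neg hee]
      · by_cases h2 : e = ng {x, y}
        · subst h2
          simp only [ng_ng, if_true, if_neg hee]; norm_num
        · have h3 : ng e ≠ {x, y} := fun h => h2 (by rw [← h, ng_ng])
          have h4 : ng e ≠ ng {x, y} := fun h => h1 (by rw [← ng_ng e, h, ng_ng])
          simp only [if_neg h1, if_neg h2, if_neg h3, if_neg h4]; norm_num)
  by_cases hneg : K.Face (ng {x, y} ∪ τ)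
  · have hx : x ∈ K.W τ := mem_W.2 ⟨fx, hneg.mono (by
      intro z hz; rw [Finset.mem_union, mem_ng]; simp only [Finset.mem_insert, Finset.mem_singleton] at *
      rcases hz with rfl | hz
      · left; left; simp
      · right; exact hz)⟩
    have hy : y ∈ K.W τ := mem_W.2 ⟨fy, hneg.mono (by
      intro z hz; rw [Finset.mem_union, mem_ng]; simp only [Finset.mem_insert, Finset.mem_singleton] at *
      rcases hz with rfl | hz
      · left; right; simp
      · right; exact hz)⟩
    have hxy' : x ≠ -y := by
      rintro rfl
      exact hxy.no_anti (v := y) (by simp) (by simp)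
    have := (octa hd hc hτ hf ⟨x, hx⟩).2 x hx y hy hne hxy'
    apply hcon
    refine (mem_H.1 this).2.1.mono ?_
    intro z hz; simp only [Finset.mem_union, Finset.mem_insert, Finset.mem_singleton] at *; tauto
  · have hmot : K.MotSt τ m := motSt_of (by
      intro e he' hfe
      rw [hm e he']
      have h1 : e ≠ {x, y} := by
        rintro rfl
        apply hcon; refine hfe.mono ?_
        intro z hz; simp only [Finset.mem_union, Finset.mem_insert, Finset.mem_singleton] at *; tauto
      have h2 : e ≠ ng {x, y} := by
        rintro rfl; exact hneg hfe
      rw [if_neg h1, if_neg h2])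
    obtain ⟨T, hT⟩ := star_rigid hτ hf hmot
    have h1 := hm _ he
    rw [if_pos rfl, Rs_pair _ hne] at h1
    have h2 : ed m x y = 0 := by
      have := T.ed x y
      unfold ed at this ⊢
      rw [hT x fx, hT y fy]; exact this
    linarith

lemma flag3 (hd : 4 ≤ d) (hc : K.E.card + 2 * d = d * K.V.card) (hp : K.Prm) (hτ : τ.card + 3 = d) (hf : K.Face τ)
    {a b c : Fin d → ℝ} (fa : K.Face (insert a τ)) (fb : K.Face (insert b τ)) (fc : K.Face (insert c τ))
    (hab : K.Face {a, b}) (hac : K.Face {a, c}) (hbc : K.Face {b, c}) :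
    K.Face (insert a (insert b (insert c τ))) := by
  have cab := claim hd hc hτ hf fa fb hab
  have cac := claim hd hc hτ hf fa fc hac
  have cbc := claim hd hc hτ hf fb fc hbc
  by_cases ha : a ∈ insert b (insert c τ)
  · rwa [Finset.insert_eq_of_mem ha]
  by_cases hb : b ∈ insert c τ
  · rwa [Finset.insert_eq_of_mem hb]
  by_cases hcc : c ∈ τ
  · rwa [Finset.insert_eq_of_mem hcc]
  have hcard : (insert a (insert b (insert c τ))).card = d := by
    rw [Finset.card_insert_of_notMem ha, Finset.card_insert_of_notMem hb, Finset.card_insert_of_notMem hcc]; omega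
  simp only [Finset.mem_insert, not_or] at ha hb
  apply hp _ _ hcard
  · intro s hs
    obtain ⟨v, hv, hvs⟩ := Finset.exists_of_ssubset hs
    have hsub : ∀ z ∈ s, z ≠ v ∧ (z = a ∨ z = b ∨ z = c ∨ z ∈ τ) := by
      intro z hz
      refine ⟨fun h => hvs (h ▸ hz), ?_⟩
      simpa using hs.1 hz
    simp only [Finset.mem_insert] at hv
    rcases hv with rfl | rfl | rfl | hv
    · refine cbc.mono fun z hz => ?_
      have := hsub z hz; simp only [Finset.mem_insert]; tauto
    · refine cac.mono fun z hz => ?_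
      have := hsub z hz; simp only [Finset.mem_insert]; tauto
    · refine cab.mono fun z hz => ?_
      have := hsub z hz; simp only [Finset.mem_insert]; tauto
    · have hτ2 : (insert a (τ.erase v)).card + 3 = d := by
        rw [Finset.card_insert_of_notMem (fun h => ha.2.2 (Finset.mem_of_mem_erase h)), Finset.card_erase_add_one hv]
        exact hτ
      have hs2 : ∀ w, insert w (insert a (τ.erase v)) ⊆ insert a (insert w τ) := by
        intro w z hz
        simp only [Finset.mem_insert, Finset.mem_erase] at *; tauto
      have := claim hd hc hτ2 (fa.mono (Finset.insert_subset_insert _ (Finset.erase_subset _ _)))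
        (cab.mono (hs2 b)) (cac.mono (hs2 c)) hbc
      refine this.mono fun z hz => ?_
      have := hsub z hz; simp only [Finset.mem_insert, Finset.mem_erase]; tauto
  · intro z hz
    simp only [Finset.mem_insert] at hz
    rcases hz with rfl | rfl | rfl | hz
    · exact fa.mem (by simp)
    · exact fb.mem (by simp)
    · exact fc.mem (by simp)
    · exact hf.mem hz

lemma oct_pair (hd : 4 ≤ d) (hc : K.E.card + 2 * d = d * K.V.card) (hτ : τ.card + 3 = d) (hf : K.Face τ)
    {u v : Fin d → ℝ} (hu : u ∈ K.W τ) (hv : v ∈ K.W τ) (h2 : u ≠ -v) :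
    K.Face (insert u (insert v τ)) := by
  by_cases h1 : u = v
  · subst h1; simpa using (mem_W.1 hu).1
  have := (octa hd hc hτ hf ⟨u, hu⟩).2 u hu v hv h1 h2
  refine (mem_H.1 this).2.1.mono ?_
  intro z hz; simp only [Finset.mem_union, Finset.mem_insert, Finset.mem_singleton] at *; tauto

lemma oct_face (hd : 4 ≤ d) (hc : K.E.card + 2 * d = d * K.V.card) (hp : K.Prm) (hτ : τ.card + 3 = d) (hf : K.Face τ)
    {a b c : Fin d → ℝ} (ha : a ∈ K.W τ) (hb : b ∈ K.W τ) (hcW : c ∈ K.W τ)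
    (hab : a ≠ -b) (hac : a ≠ -c) (hbc : b ≠ -c) :
    K.Face (insert a (insert b (insert c τ))) := by
  have hs : ∀ u v : Fin d → ℝ, ({u, v} : Finset (Fin d → ℝ)) ⊆ insert u (insert v τ) := by
    intro u v z hz; simp only [Finset.mem_insert, Finset.mem_singleton] at *; tauto
  exact flag3 hd hc hp hτ hf (mem_W.1 ha).1 (mem_W.1 hb).1 (mem_W.1 hcW).1
    ((oct_pair hd hc hτ hf ha hb hab).mono (hs _ _)) ((oct_pair hd hc hτ hf ha hcW hac).mono (hs _ _))
    ((oct_pair hd hc hτ hf hb hcW hbc).mono (hs _ _))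

lemma oct_link (hd : 4 ≤ d) (hc : K.E.card + 2 * d = d * K.V.card) (hp : K.Prm) (hτ : τ.card + 3 = d) (hf : K.Face τ)
    (hW : (K.W τ).Nonempty) : ∀ F, K.Facet F → τ ⊆ F → ∀ a ∈ F, a ∉ τ → a ∈ K.W τ := by
  have h6 := (octa hd hc hτ hf hW).1
  obtain ⟨a, ha⟩ := hW
  obtain ⟨b, hb, hb1⟩ : ∃ b ∈ K.W τ, b ∉ ({a, -a} : Finset (Fin d → ℝ)) := by
    by_contra h; push Not at h
    have := (Finset.card_le_card (fun x hx => h x hx : K.W τ ⊆ _)).trans Finset.card_le_two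
    omega
  obtain ⟨c, hcW, hc1⟩ : ∃ c ∈ K.W τ, c ∉ ({a, -a, b, -b} : Finset (Fin d → ℝ)) := by
    by_contra h; push Not at h
    have := (Finset.card_le_card (fun x hx => h x hx : K.W τ ⊆ _)).trans Finset.card_le_four
    omega
  simp only [Finset.mem_insert, Finset.mem_singleton, not_or] at hb1 hc1
  have hface := oct_face hd hc hp hτ hf ha hb hcW (fun h => hb1.2 (by rw [h, neg_neg]))
    (fun h => hc1.2.1 (by rw [h, neg_neg])) (fun h => hc1.2.2.2 (by rw [h, neg_neg]))
  have hF0 : K.Facet (insert a (insert b (insert c τ))) := by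
    refine ⟨hface, ?_⟩
    rw [Finset.card_insert_of_notMem, Finset.card_insert_of_notMem, Finset.card_insert_of_notMem (W_not hcW)]
    · omega
    · simp only [Finset.mem_insert, not_or]; exact ⟨Ne.symm hc1.2.2.1, W_not hb⟩
    · simp only [Finset.mem_insert, not_or]; exact ⟨Ne.symm hb1.1, Ne.symm hc1.1, W_not ha⟩
  refine CSP.conn hF0 (τ := τ) (fun z hz => by simp [hz]) (fun F => ∀ a ∈ F, a ∉ τ → a ∈ K.W τ) ?_ ?_
  · intro F x x' hF hτF hxF hxτ hx'F hF' hQ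
    have hx : x ∈ K.W τ := hQ x hxF hxτ
    -- the other facet through the ridge is obtained by x ↦ -x
    obtain ⟨p, q, hpq, hpq2⟩ : ∃ p q, p ≠ q ∧ (F.erase x) \ τ = {p, q} := by
      apply Finset.card_eq_two.1
      rw [Finset.card_sdiff_of_subset, Finset.card_erase_of_mem hxF, hF.2]
      · omega
      · intro z hz; exact Finset.mem_erase.2 ⟨fun h => hxτ (h ▸ hz), hτF hz⟩
    have hpm : p ∈ F.erase x \ τ := by rw [hpq2]; simp
    have hqm : q ∈ F.erase x \ τ := by rw [hpq2]; simp
    simp only [Finset.mem_sdiff, Finset.mem_erase] at hpm hqm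
    have hFe : F.erase x = insert p (insert q τ) := by
      ext z
      have : z ∈ F.erase x \ τ ↔ z = p ∨ z = q := by rw [hpq2]; simp
      have h3 : z ∈ τ → z ∈ F.erase x := fun hz => Finset.mem_erase.2 ⟨fun h => hxτ (h ▸ hz), hτF hz⟩
      simp only [Finset.mem_sdiff, Finset.mem_insert] at *
      tauto
    have hpW := hQ p hpm.1.2 hpm.2
    have hqW := hQ q hqm.1.2 hqm.2
    have hno : ∀ {z w}, z ∈ F → w ∈ F → z ≠ -w := by
      intro z w hz hw h
      exact hF.1.no_anti hw (h ▸ hz)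
    have hxF' : -x ∉ F := hF.1.no_anti hxF
    have hneg : K.Facet (insert (-x) (F.erase x)) := by
      refine ⟨?_, ?_⟩
      · rw [hFe]
        exact oct_face hd hc hp hτ hf (W_neg hx) hpW hqW (fun h => hpm.1.1 (neg_injective h).symm)
          (fun h => hqm.1.1 (neg_injective h).symm) (hno hpm.1.2 hqm.1.2)
      · rw [Finset.card_insert_of_notMem (fun h => hxF' (Finset.mem_of_mem_erase h)), Finset.card_erase_add_one hxF, hF.2]
    have heq : x' = -x := CSP.ridge (R := F.erase x) (a1 := x) (by rw [Finset.insert_erase hxF]; exact hF) hF' hneg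
      (by simp) (fun h => hx'F (Finset.mem_of_mem_erase h)) (fun h => hxF' (Finset.mem_of_mem_erase h))
      (fun h => hx'F (h ▸ hxF)) (CSP.V_ne_neg (W_V hx))
    intro z hz hzτ
    rcases Finset.mem_insert.1 hz with rfl | hz
    · rw [heq]; exact W_neg hx
    · exact hQ z (Finset.mem_of_mem_erase hz) hzτ
  · intro z hz hzτ
    simp only [Finset.mem_insert] at hz
    rcases hz with rfl | rfl | rfl | hz
    · exact ha
    · exact hb
    · exact hcW
    · exact absurd hz hzτ
end PartE
end CSLB

namespace CSLB
section PartG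
variable {d : ℕ} {K : CSP d} {τ : Finset (Fin d → ℝ)}

/-- facets containing a good codimension-three face -/
def CSP.Good (K : CSP d) (F : Finset (Fin d → ℝ)) : Prop :=
  ∃ τ ⊆ F, τ.card + 3 = d ∧ (K.W τ).Nonempty

lemma exch (hd : 4 ≤ d) (hc : K.E.card + 2 * d = d * K.V.card) (hp : K.Prm) {F : Finset (Fin d → ℝ)} (hF : K.Facet F)
    (hτF : τ ⊆ F) (hτ : τ.card + 3 = d) (hW : (K.W τ).Nonempty) {v i : Fin d → ℝ} (_hv : v ∈ τ) (hi : i ∈ F) (hiτ : i ∉ τ) :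
    (K.W (insert i (τ.erase v))).Nonempty := by
  have hf : K.Face τ := hF.1.mono hτF
  obtain ⟨j, hj, hjn⟩ : ∃ j ∈ F, j ∉ insert i τ := by
    by_contra h; push Not at h
    have := (Finset.card_le_card (fun x hx => h x hx : F ⊆ _)).trans (Finset.card_insert_le _ _)
    have := hF.2; omega
  simp only [Finset.mem_insert, not_or] at hjn
  have hiW := oct_link hd hc hp hτ hf hW F hF hτF i hi hiτ
  have hjW := oct_link hd hc hp hτ hf hW F hF hτF j hj hjn.2
  refine ⟨j, mem_W.2 ⟨hF.1.mono ?_, (oct_pair hd hc hτ hf (W_neg hjW) hiW (fun h => hjn.1 (neg_injective h))).mono ?_⟩⟩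
  · intro z hz
    simp only [Finset.mem_insert, Finset.mem_erase] at hz
    rcases hz with rfl | rfl | hz
    · exact hj
    · exact hi
    · exact hτF hz.2
  · intro z hz
    simp only [Finset.mem_insert, Finset.mem_erase] at *
    tauto

lemma good_out (hd : 4 ≤ d) (hc : K.E.card + 2 * d = d * K.V.card) (hp : K.Prm) {F : Finset (Fin d → ℝ)} (hF : K.Facet F)
    (hτF : τ ⊆ F) (hτ : τ.card + 3 = d) (hW : (K.W τ).Nonempty) {v : Fin d → ℝ} (hv : v ∈ F) (hvτ : v ∉ τ) :
    K.Facet (insert (-v) (F.erase v)) ∧ K.Good (insert (-v) (F.erase v)) := by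
  have hf : K.Face τ := hF.1.mono hτF
  have hvF : -v ∉ F := hF.1.no_anti hv
  have hsub : τ ⊆ F.erase v := fun z hz => Finset.mem_erase.2 ⟨fun h => hvτ (h ▸ hz), hτF hz⟩
  refine ⟨⟨?_, ?_⟩, τ, fun z hz => Finset.mem_insert_of_mem (hsub hz), hτ, hW⟩
  · obtain ⟨p, q, hpq, hpq2⟩ : ∃ p q, p ≠ q ∧ (F.erase v) \ τ = {p, q} := by
      apply Finset.card_eq_two.1
      rw [Finset.card_sdiff_of_subset hsub, Finset.card_erase_of_mem hv, hF.2]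
      omega
    have hpm : p ∈ F.erase v \ τ := by rw [hpq2]; simp
    have hqm : q ∈ F.erase v \ τ := by rw [hpq2]; simp
    simp only [Finset.mem_sdiff, Finset.mem_erase] at hpm hqm
    have hFe : F.erase v = insert p (insert q τ) := by
      ext z
      have : z ∈ F.erase v \ τ ↔ z = p ∨ z = q := by rw [hpq2]; simp
      have h3 : z ∈ τ → z ∈ F.erase v := fun hz => hsub hz
      simp only [Finset.mem_sdiff, Finset.mem_insert] at *
      tauto
    have L := oct_link hd hc hp hτ hf hW F hF hτF
    rw [hFe]
    exact oct_face hd hc hp hτ hf (W_neg (L v hv hvτ)) (L p hpm.1.2 hpm.2) (L q hqm.1.2 hqm.2)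
      (fun h => hpm.1.1 (neg_injective h).symm)
      (fun h => hqm.1.1 (neg_injective h).symm) (fun h => hF.1.no_anti hqm.1.2 (h ▸ hpm.1.2))
  · rw [Finset.card_insert_of_notMem (fun h => hvF (Finset.mem_of_mem_erase h)), Finset.card_erase_add_one hv, hF.2]

lemma good_piv (hd : 4 ≤ d) (hc : K.E.card + 2 * d = d * K.V.card) (hp : K.Prm) {F : Finset (Fin d → ℝ)} (hF : K.Facet F)
    (hG : K.Good F) {v : Fin d → ℝ} (hv : v ∈ F) :
    K.Facet (insert (-v) (F.erase v)) ∧ K.Good (insert (-v) (F.erase v)) := by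
  obtain ⟨τ, hτF, hτ, hW⟩ := hG
  by_cases hvτ : v ∈ τ
  · obtain ⟨i, hi, hiτ⟩ : ∃ i ∈ F, i ∉ τ := by
      by_contra h; push Not at h
      have := (Finset.card_le_card (fun x hx => h x hx : F ⊆ _))
      have := hF.2; omega
    refine good_out hd hc hp hF (τ := insert i (τ.erase v)) ?_ ?_ (exch hd hc hp hF hτF hτ hW hvτ hi hiτ) hv ?_
    · intro z hz
      simp only [Finset.mem_insert, Finset.mem_erase] at hz
      rcases hz with rfl | hz
      · exact hi
      · exact hτF hz.2
    · rw [Finset.card_insert_of_notMem (fun h => hiτ (Finset.mem_of_mem_erase h)), Finset.card_erase_add_one hvτ, hτ]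
    · simp only [Finset.mem_insert, Finset.mem_erase, not_or]
      exact ⟨fun h => hiτ (h ▸ hvτ), by simp⟩
  · exact good_out hd hc hp hF hτF hτ hW hv hvτ

lemma piv_eq {F : Finset (Fin d → ℝ)} (hF : K.Facet F) {a a' : Fin d → ℝ} (ha : a ∈ F) (ha' : a' ∉ F)
    (h1 : K.Facet (insert a' (F.erase a))) (h2 : K.Facet (insert (-a) (F.erase a))) : a' = -a :=
  CSP.ridge (R := F.erase a) (a1 := a) (by rw [Finset.insert_erase ha]; exact hF) h1 h2
      (by simp) (fun h => ha' (Finset.mem_of_mem_erase h)) (fun h => hF.1.no_anti ha (Finset.mem_of_mem_erase h))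
      (fun h => ha' (h ▸ ha)) (CSP.V_ne_neg (hF.1.mem ha))

lemma good_all (hd : 4 ≤ d) (hc : K.E.card + 2 * d = d * K.V.card) (hp : K.Prm) {F0 : Finset (Fin d → ℝ)} (hF0 : K.Facet F0)
    (hG : K.Good F0) : ∀ F, K.Facet F → K.Good F := by
  intro F hF
  refine CSP.conn hF0 (τ := ∅) (by simp) K.Good ?_ hG F hF (by simp)
  intro F a a' hF _ ha _ ha' hF' hQ
  obtain ⟨h1, h2⟩ := good_piv hd hc hp hF hQ ha
  rw [piv_eq hF ha ha' hF' h1]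
  exact h2

lemma good_V (hd : 4 ≤ d) (hc : K.E.card + 2 * d = d * K.V.card) (hp : K.Prm) {F0 : Finset (Fin d → ℝ)} (hF0 : K.Facet F0)
    (hG : K.Good F0) : ∀ v ∈ K.V, v ∈ F0 ∨ -v ∈ F0 := by
  intro v hv
  obtain ⟨F, hvF, hF⟩ := (CSP.face_single hv).exists_facet
  have := CSP.conn hF0 (τ := ∅) (by simp) (fun F => ∀ v ∈ F, v ∈ F0 ∨ -v ∈ F0) ?_ (fun v hv => Or.inl hv) F hF (by simp)
  · exact this v (hvF (by simp))
  · intro F a a' hF _ ha _ ha' hF' hQ z hz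
    rw [piv_eq hF ha ha' hF' (good_piv hd hc hp hF (good_all hd hc hp hF0 hG F hF) ha).1] at hz
    rcases Finset.mem_insert.1 hz with rfl | hz
    · rcases hQ a ha with h | h
      · right; simpa using h
      · left; exact h
    · exact hQ z (Finset.mem_of_mem_erase hz)

lemma cross_concl (hd : 4 ≤ d) (hc : K.E.card + 2 * d = d * K.V.card) (hp : K.Prm) {F0 : Finset (Fin d → ℝ)} (hF0 : K.Facet F0)
    (hG : K.Good F0) {u : Fin d → ℝ} (hu : u ∈ K.V) :
    K.V.card = 2 * d ∧ (∀ w ∈ K.V, w ≠ u → w ≠ -u → K.Face {u, w}) ∧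
      ∀ e, K.Face e → K.Face (insert u e) ∨ K.Face (insert (-u) e) := by
  have hall := good_all hd hc hp hF0 hG
  refine ⟨?_, ?_, ?_⟩
  · have : K.V = F0 ∪ ng F0 := by
      ext v
      rw [Finset.mem_union, mem_ng]
      constructor
      · exact good_V hd hc hp hF0 hG v
      · rintro (h | h)
        · exact hF0.1.mem h
        · have := K.neg _ (hF0.1.mem h); rwa [neg_neg] at this
    rw [this, Finset.card_union_of_disjoint, card_ng, hF0.2]
    · omega
    · rw [Finset.disjoint_left]; intro v hv hv'
      exact hF0.1.no_anti hv (mem_ng.1 hv')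
  · intro w hw h1 h2
    obtain ⟨F, hwF, hF⟩ := (CSP.face_single hw).exists_facet
    have hwF' : w ∈ F := hwF (by simp)
    rcases good_V hd hc hp hF (hall F hF) u hu with h | h
    · refine hF.1.mono ?_
      intro z hz; simp only [Finset.mem_insert, Finset.mem_singleton] at hz
      rcases hz with rfl | rfl <;> assumption
    · refine (good_piv hd hc hp hF (hall F hF) h).1.1.mono ?_
      intro z hz; simp only [Finset.mem_insert, Finset.mem_singleton] at hz
      rcases hz with rfl | rfl
      · simp
      · exact Finset.mem_insert_of_mem (Finset.mem_erase.2 ⟨h2, hwF'⟩)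
  · intro e he
    obtain ⟨F, heF, hF⟩ := he.exists_facet
    rcases good_V hd hc hp hF (hall F hF) u hu with h | h
    · left; exact hF.1.mono (Finset.insert_subset h heF)
    · right; exact hF.1.mono (Finset.insert_subset h heF)
end PartG
end CSLB

namespace CSLB
section PartF1
open Matrix
variable {d : ℕ} {K : CSP d} {τ τ1 τ2 σ : Finset (Fin d → ℝ)}

/-- edges in the star of a face -/
def CSP.Es (K : CSP d) (τ : Finset (Fin d → ℝ)) : Finset (Finset (Fin d → ℝ)) :=
  K.E.filter fun e => K.Face (e ∪ τ)
lemma mem_Es {e : Finset (Fin d → ℝ)} : e ∈ K.Es τ ↔ e ∈ K.E ∧ K.Face (e ∪ τ) := by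
  unfold CSP.Es; rw [Finset.mem_filter]

lemma Es_V {e : Finset (Fin d → ℝ)} (h : e ∈ K.Es τ) {v : Fin d → ℝ} (hv : v ∈ e) : K.Face (insert v τ) := by
  refine (mem_Es.1 h).2.mono ?_
  intro z hz
  rcases Finset.mem_insert.1 hz with rfl | hz
  · exact Finset.mem_union_left _ hv
  · exact Finset.mem_union_right _ hz

lemma Es_anti (hW : K.W τ = ∅) {e : Finset (Fin d → ℝ)} (h : e ∈ K.Es τ) {v : Fin d → ℝ} (hv : v ∈ ng e) :
    ¬ K.Face (insert v τ) := by
  intro hf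
  have h1 : -v ∈ e := mem_ng.1 hv
  have : v ∈ K.W τ := mem_W.2 ⟨hf, Es_V h h1⟩
  rw [hW] at this; simp at this

lemma Es_ng (hW : K.W τ = ∅) {e : Finset (Fin d → ℝ)} (h : e ∈ K.Es τ) : ng e ∉ K.Es τ := by
  intro h2
  have h3 : (ng e).Nonempty := by
    rw [← Finset.card_pos, (mem_E.1 (mem_Es.1 h2).1).1]; norm_num
  obtain ⟨v, hv⟩ := h3
  exact Es_anti hW h hv (Es_V h2 hv)

lemma stress_half (hd : 3 ≤ d) (hc : K.E.card + 2 * d = d * K.V.card) (h1 : K.W τ1 = ∅) (h2 : K.W τ2 = ∅)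
    {ω : Finset (Fin d → ℝ) → ℝ} (hs : ∀ e ∈ K.E, ω e ≠ 0 → e ∈ K.Es τ1 ∨ e ∈ K.Es τ2)
    (hω : ∀ m, ∑ e ∈ K.E, ω e * Rs d m e = 0) : ∀ e ∈ K.Es τ1, ω e = 0 := by
  have hsym := stress_symm hd hc hω
  have hst : ∀ m, ∑ e ∈ K.E, (if e ∈ K.Es τ1 then ω e else 0) * Rs d m e = 0 := by
    intro m
    refine Eq.trans ?_ (hω (fun v => if K.Face (insert v τ1) then m v else 0))
    refine Finset.sum_congr rfl fun e he => ?_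
    by_cases hX : e ∈ K.Es τ1
    · rw [if_pos hX]
      congr 1
      apply Rs_congr
      intro v hv
      rw [if_pos (Es_V hX hv)]
    · rw [if_neg hX, zero_mul]
      by_cases h0 : ω e = 0
      · rw [h0, zero_mul]
      · have hY : e ∈ K.Es τ2 := (hs e he h0).resolve_left hX
        have h3 : ng e ∈ K.Es τ1 := by
          refine (hs (ng e) (ng_mem_E he) (by rw [hsym e he]; exact h0)).resolve_right (Es_ng h2 hY)
        have h4 : Rs d (fun v => if K.Face (insert v τ1) then m v else 0) e = Rs d 0 e := by
          apply Rs_congr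
          intro v hv
          rw [if_neg (Es_anti h1 h3 (by rw [ng_ng]; exact hv))]; rfl
        rw [h4, map_zero]; simp
  have hsym1 := stress_symm hd hc hst
  intro e he
  have := hsym1 e (mem_Es.1 he).1
  simp only [if_pos he, if_neg (Es_ng h1 he)] at this
  exact this.symm

lemma surj_star (hd : 3 ≤ d) (hc : K.E.card + 2 * d = d * K.V.card) (h1 : K.W τ1 = ∅) (h2 : K.W τ2 = ∅)
    (ρ : Finset (Fin d → ℝ) → ℝ) : ∃ m, ∀ e ∈ K.Es τ1 ∪ K.Es τ2, Rs d m e = ρ e := by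
  set U := K.Es τ1 ∪ K.Es τ2 with hU
  have hUE : U ⊆ K.E := by
    intro e he
    rcases Finset.mem_union.1 he with h | h <;> exact (mem_Es.1 h).1
  let L : ((Fin d → ℝ) → (Fin d → ℝ)) →ₗ[ℝ] (U → ℝ) := (resL U).comp (Rs d)
  have htop : LinearMap.range L = ⊤ := by
    by_contra hne
    obtain ⟨f, hf0, hf⟩ := Submodule.exists_le_ker_of_lt_top _ (lt_top_iff_ne_top.2 hne)
    let ω : Finset (Fin d → ℝ) → ℝ := fun e => if h : e ∈ U then f (Pi.single ⟨e, h⟩ 1) else 0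
    have hfe : ∀ x, f x = ∑ e : U, ω e * x e := by
      intro x
      conv_lhs => rw [pi_eq_sum_univ' x]
      rw [map_sum]
      refine Finset.sum_congr rfl fun e _ => ?_
      rw [map_smul, smul_eq_mul, mul_comm]
      congr 1
      simp only [ω, dif_pos e.2]
    have hst : ∀ m, ∑ e ∈ K.E, ω e * Rs d m e = 0 := by
      intro m
      have h3 : f (L m) = 0 := hf ⟨m, rfl⟩
      rw [hfe] at h3
      rw [← h3]
      change _ = ∑ e : U, ω e * Rs d m e
      rw [Finset.sum_coe_sort U (fun e => ω e * Rs d m e)]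
      symm
      apply Finset.sum_subset hUE
      intro e _ he
      simp only [ω, dif_neg he, zero_mul]
    have hs : ∀ e ∈ K.E, ω e ≠ 0 → e ∈ K.Es τ1 ∨ e ∈ K.Es τ2 := by
      intro e _ h
      by_contra hcon
      apply h
      have : e ∉ U := by rw [hU, Finset.mem_union]; exact hcon
      simp only [ω, dif_neg this]
    have hA := stress_half hd hc h1 h2 hs hst
    have hB := stress_half hd hc h2 h1 (fun e he h => (hs e he h).symm) hst
    apply hf0
    refine LinearMap.ext fun x => ?_
    rw [hfe, LinearMap.zero_apply]
    apply Finset.sum_eq_zero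
    intro e _
    have : ω e = 0 := by
      rcases Finset.mem_union.1 e.2 with h | h
      · exact hA _ h
      · exact hB _ h
    rw [this, zero_mul]
  obtain ⟨m, hm⟩ : (fun e : U => ρ e) ∈ LinearMap.range L := by rw [htop]; trivial
  exact ⟨m, fun e he => congrFun hm ⟨e, he⟩⟩

lemma inter_rigid (hd : 3 ≤ d) (hc : K.E.card + 2 * d = d * K.V.card) (h1 : K.W τ1 = ∅) (h2 : K.W τ2 = ∅)
    (hτ1 : τ1.card + 3 = d) (hτ2 : τ2.card + 3 = d) (f1 : K.Face τ1) (f2 : K.Face τ2)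
    {n : (Fin d → ℝ) → (Fin d → ℝ)} (hn : ∀ e ∈ K.Es τ1, e ∈ K.Es τ2 → Rs d n e = 0) :
    ∃ T : Tr d, ∀ v, K.Face (insert v τ1) → K.Face (insert v τ2) → n v = T.t v := by
  obtain ⟨m, hm⟩ := surj_star hd hc h1 h2 (fun e => if e ∈ K.Es τ1 then Rs d n e else 0)
  obtain ⟨T2, hT2⟩ := star_rigid hτ2 f2 (m := m) (motSt_of (by
    intro e he hf
    have h3 : e ∈ K.Es τ2 := mem_Es.2 ⟨he, hf⟩
    rw [hm e (Finset.mem_union_right _ h3)]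
    split_ifs with h4
    · exact hn e h4 h3
    · rfl))
  obtain ⟨T1, hT1⟩ := star_rigid hτ1 f1 (m := m - n) (motSt_of (by
    intro e he hf
    have h3 : e ∈ K.Es τ1 := mem_Es.2 ⟨he, hf⟩
    rw [map_sub, Pi.sub_apply, hm e (Finset.mem_union_left _ h3), if_pos h3, sub_self]))
  refine ⟨⟨T2.A - T1.A, T2.b - T1.b, ?_⟩, ?_⟩
  · intro x
    rw [LinearMap.sub_apply, sub_dotProduct, T2.alt, T1.alt, sub_zero]
  · intro v hv1 hv2
    have e1 := hT1 v hv1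
    have e2 := hT2 v hv2
    unfold Tr.t at *
    rw [Pi.sub_apply, e2] at e1
    rw [LinearMap.sub_apply]
    have : n v = (T2.A v + T2.b) - (T1.A v + T1.b) := by rw [← e1]; abel
    rw [this, add_sub_add_comm]

/-- skew matrix entries from pairs -/
def skw (s : (Finset.univ.powersetCard 2 : Finset (Finset (Fin d))) → ℝ) (i j : Fin d) : ℝ :=
  if h : i ≠ j then (if i < j then 1 else -1) * s ⟨{i, j}, Finset.mem_powersetCard.2 ⟨Finset.subset_univ _, Finset.card_pair h⟩⟩ else 0

/-- parametrisation of trivial fields -/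
def Theta (Z : Finset (Fin d → ℝ)) :
    (((Finset.univ.powersetCard 2 : Finset (Finset (Fin d))) → ℝ) × (Fin d → ℝ)) →ₗ[ℝ] (Z → (Fin d → ℝ)) where
  toFun := fun sb z i => ∑ j, skw sb.1 i j * z.1 j + sb.2 i
  map_add' := fun a b => by
    ext z i
    have : ∀ j, skw (a + b).1 i j = skw a.1 i j + skw b.1 i j := by
      intro j; unfold skw; split_ifs <;> simp [Prod.fst_add] <;> ring
    simp only [this, add_mul, Finset.sum_add_distrib, Prod.snd_add, Pi.add_apply]; ring
  map_smul' := fun c a => by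
    ext z i
    have : ∀ j, skw (c • a).1 i j = c * skw a.1 i j := by
      intro j; unfold skw; split_ifs <;> simp [Prod.smul_fst]
    simp only [this, mul_assoc, ← Finset.mul_sum, Prod.smul_snd, Pi.smul_apply, smul_eq_mul, RingHom.id_apply]; ring

lemma Tr_Theta (T : Tr d) (Z : Finset (Fin d → ℝ)) : (fun z : Z => T.t z.1) ∈ LinearMap.range (Theta Z) := by
  have hsk : ∀ x y, T.A x ⬝ᵥ y + T.A y ⬝ᵥ x = 0 := by
    intro x y
    have h1 := T.alt (x + y)
    rw [map_add, add_dotProduct, dotProduct_add, dotProduct_add, T.alt, T.alt] at h1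
    linarith
  let M : Fin d → Fin d → ℝ := fun i j => T.A (Pi.single j 1) i
  have hM : ∀ i j, M i j + M j i = 0 := by
    intro i j
    have := hsk (Pi.single j 1) (Pi.single i 1)
    rw [dotProduct_single, dotProduct_single, mul_one, mul_one] at this
    exact this
  refine ⟨(fun p => ∑ i ∈ p.1, ∑ j ∈ p.1, if i < j then M i j else 0, T.b), ?_⟩
  have hskw : ∀ i j, skw (fun p : (Finset.univ.powersetCard 2 : Finset (Finset (Fin d))) => ∑ i ∈ p.1, ∑ j ∈ p.1, if i < j then M i j else 0) i j = M i j := by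
    intro i j
    unfold skw
    have h0 := hM i j
    split_ifs with h1 h2
    · beta_reduce
      rw [Finset.sum_pair h1, Finset.sum_pair h1, Finset.sum_pair h1]
      simp [h2, not_lt_of_gt h2]
    · have h3 : j < i := lt_of_le_of_ne (not_lt.1 h2) (Ne.symm h1)
      beta_reduce
      rw [Finset.sum_pair h1, Finset.sum_pair h1, Finset.sum_pair h1]
      simp [h3, h2]; linarith
    · push Not at h1
      subst h1; linarith
  ext z i
  change ∑ j, skw _ i j * z.1 j + T.b i = (T.A z.1 + T.b) i
  simp only [hskw, Pi.add_apply]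
  congr 1
  conv_rhs => rw [pi_eq_sum_univ' z.1]
  rw [map_sum, Finset.sum_apply]
  refine Finset.sum_congr rfl fun j _ => ?_
  rw [map_smul, Pi.smul_apply, smul_eq_mul, mul_comm]

lemma count_rigid (Z : Finset (Fin d → ℝ)) (A : Finset (Finset (Fin d → ℝ)))
    (h : ∀ n : (Fin d → ℝ) → (Fin d → ℝ), (∀ e ∈ A, Rs d n e = 0) → ∃ T : Tr d, ∀ v ∈ Z, n v = T.t v) :
    d * Z.card ≤ A.card + d.choose 2 + d := by
  let L : (Z → (Fin d → ℝ)) →ₗ[ℝ] (A → ℝ) := ((resL A).comp (Rs d)).comp (extL Z)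
  have hk : LinearMap.ker L ≤ LinearMap.range (Theta Z) := by
    intro m hm
    obtain ⟨T, hT⟩ := h (extL Z m) (fun e he => congrFun (LinearMap.mem_ker.1 hm) ⟨e, he⟩)
    have : m = fun z : Z => T.t z.1 := by
      ext z : 1
      rw [← hT z z.2, extL_mem _ z.2]
    rw [this]
    exact Tr_Theta T Z
  have h1 := L.finrank_range_add_finrank_ker
  have h2 := Submodule.finrank_mono hk
  have h3 := LinearMap.finrank_range_le (Theta Z)
  have h4 := Submodule.finrank_le (LinearMap.range L)
  rw [Module.finrank_prod, Module.finrank_pi, Module.finrank_pi, Fintype.card_coe, Finset.card_powersetCard, Finset.card_univ, Fintype.card_fin] at h3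
  rw [Module.finrank_pi, Fintype.card_coe] at h4
  rw [Module.finrank_pi_fintype] at h1
  simp only [Module.finrank_pi, Fintype.card_fin, Finset.sum_const, Finset.card_univ, smul_eq_mul, Fintype.card_coe] at h1
  rw [mul_comm]; omega
end PartF1
end CSLB

namespace CSLB
section PartF2
variable {d : ℕ} {K : CSP d} {σ : Finset (Fin d → ℝ)}

/-- vertices of the link -/
def CSP.N (K : CSP d) (σ : Finset (Fin d → ℝ)) : Finset (Fin d → ℝ) :=
  K.V.filter fun v => v ∉ σ ∧ K.Face (insert v σ)
lemma mem_N {v : Fin d → ℝ} : v ∈ K.N σ ↔ v ∉ σ ∧ K.Face (insert v σ) := by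
  unfold CSP.N; rw [Finset.mem_filter]
  exact ⟨fun h => h.2, fun h => ⟨h.2.mem (by simp), h⟩⟩

lemma Es_inter (hd : 4 ≤ d) (hc : K.E.card + 2 * d = d * K.V.card) (hp : K.Prm) (hσ : σ.card + 2 = d) (hf : K.Face σ)
    {a b : Fin d → ℝ} (_ha : a ∈ σ) (hb : b ∈ σ) (hab : a ≠ b) {e : Finset (Fin d → ℝ)}
    (h1 : e ∈ K.Es (σ.erase b)) (h2 : e ∈ K.Es (σ.erase a)) : e ∈ K.Es σ := by
  obtain ⟨hE, hF1⟩ := mem_Es.1 h1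
  obtain ⟨_, hF2⟩ := mem_Es.1 h2
  obtain ⟨he2, hfe⟩ := mem_E.1 hE
  obtain ⟨p, q, hpq, rfl⟩ := Finset.card_eq_two.1 he2
  refine mem_Es.2 ⟨hE, ?_⟩
  have hbm : b ∈ σ.erase a := Finset.mem_erase.2 ⟨Ne.symm hab, hb⟩
  have hcd : (σ.erase b).card + 3 = d := by
    have := Finset.card_erase_add_one hb; omega
  have := flag3 hd hc hp hcd (hf.mono (Finset.erase_subset _ _)) (a := p) (b := q) (c := b)
    (Es_V h1 (by simp)) (Es_V h1 (by simp)) (by rw [Finset.insert_erase hb]; exact hf) hfe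
    (hF2.mono (by
      intro z hz; simp only [Finset.mem_insert, Finset.mem_singleton] at hz
      rcases hz with rfl | rfl
      · simp
      · exact Finset.mem_union_right _ hbm))
    (hF2.mono (by
      intro z hz; simp only [Finset.mem_insert, Finset.mem_singleton] at hz
      rcases hz with rfl | rfl
      · simp
      · exact Finset.mem_union_right _ hbm))
  rw [Finset.insert_erase hb] at this
  refine this.mono ?_
  intro z hz; simp only [Finset.mem_union, Finset.mem_insert, Finset.mem_singleton] at *; tauto

lemma link_deg (hσ : σ.card + 2 = d) :
    ((K.Es σ).filter fun e => e ⊆ K.N σ).card ≤ (K.N σ).card := by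
  set B := (K.Es σ).filter fun e => e ⊆ K.N σ with hB
  have h := Finset.card_mul_le_card_mul (s := B) (t := K.N σ) (fun e v => v ∈ e) (m := 2) (n := 2) ?_ ?_
  · omega
  · intro e he
    obtain ⟨h1, h2⟩ := Finset.mem_filter.1 he
    have h3 : Finset.bipartiteAbove (fun (e : Finset (Fin d → ℝ)) v => v ∈ e) (K.N σ) e = e := by
      ext v
      rw [Finset.mem_bipartiteAbove]
      exact ⟨fun h => h.2, fun h => ⟨h2 h, h⟩⟩
    rw [h3, (mem_E.1 (mem_Es.1 h1).1).1]
  · intro x hx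
    by_contra hcon
    push Not at hcon
    obtain ⟨e1, h1, e2, h2, e3, h3, h12, h13, h23⟩ := Finset.two_lt_card.1 hcon
    rw [Finset.mem_bipartiteBelow] at h1 h2 h3
    have key : ∀ e ∈ B, x ∈ e → ∃ y, e = {x, y} ∧ y ∉ insert x σ ∧ K.Facet (insert y (insert x σ)) := by
      intro e he hxe
      obtain ⟨g1, g2⟩ := Finset.mem_filter.1 he
      obtain ⟨g3, g4⟩ := mem_Es.1 g1
      obtain ⟨y, hy⟩ : ∃ y, e.erase x = {y} := by
        apply Finset.card_eq_one.1
        rw [Finset.card_erase_of_mem hxe, (mem_E.1 g3).1]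
      have hye : y ∈ e.erase x := by rw [hy]; simp
      have hee : e = {x, y} := by rw [← hy, Finset.insert_erase hxe]
      have hyn : y ∉ insert x σ := by
        simp only [Finset.mem_insert, not_or]
        exact ⟨(Finset.mem_erase.1 hye).1, (mem_N.1 (g2 (Finset.mem_erase.1 hye).2)).1⟩
      refine ⟨y, hee, hyn, g4.mono ?_, ?_⟩
      · rw [hee]
        intro z hz; simp only [Finset.mem_union, Finset.mem_insert, Finset.mem_singleton] at *; tauto
      · rw [Finset.card_insert_of_notMem hyn, Finset.card_insert_of_notMem (mem_N.1 hx).1]; omega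
    obtain ⟨y1, r1, n1, F1⟩ := key e1 h1.1 h1.2
    obtain ⟨y2, r2, n2, F2⟩ := key e2 h2.1 h2.2
    obtain ⟨y3, r3, n3, F3⟩ := key e3 h3.1 h3.2
    have := CSP.ridge F1 F2 F3 n1 n2 n3 (fun h => h12 (by rw [r1, r2, h])) (fun h => h13 (by rw [r1, r3, h]))
    exact h23 (by rw [r2, r3, this])

lemma choose_two_sq (k : ℕ) : 2 * k.choose 2 + k = k * k := by
  induction k with
  | zero => rfl
  | succ k ih =>
    rw [Nat.choose_succ_succ' k 1, Nat.choose_one_right]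
    nlinarith

lemma link_small (hd : 4 ≤ d) (hc : K.E.card + 2 * d = d * K.V.card) (hp : K.Prm) (hσ : σ.card + 2 = d) (hf : K.Face σ)
    {a b : Fin d → ℝ} (ha : a ∈ σ) (hb : b ∈ σ) (hab : a ≠ b)
    (h1 : K.W (σ.erase b) = ∅) (h2 : K.W (σ.erase a) = ∅) : (K.N σ).card ≤ 3 := by
  have hcb : (σ.erase b).card + 3 = d := by
    have := Finset.card_erase_add_one hb; omega
  have hca : (σ.erase a).card + 3 = d := by
    have := Finset.card_erase_add_one ha; omega
  have hZ := count_rigid (σ ∪ K.N σ) (K.Es σ) (by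
    intro n hn
    obtain ⟨T, hT⟩ := inter_rigid (by omega) hc h1 h2 hcb hca (hf.mono (Finset.erase_subset _ _))
      (hf.mono (Finset.erase_subset _ _)) (n := n)
      (fun e he1 he2 => hn e (Es_inter hd hc hp hσ hf ha hb hab he1 he2))
    refine ⟨T, fun v hv => ?_⟩
    have hvf : K.Face (insert v σ) := by
      rcases Finset.mem_union.1 hv with h | h
      · rw [Finset.insert_eq_of_mem h]; exact hf
      · exact (mem_N.1 h).2
    exact hT v (hvf.mono (Finset.insert_subset_insert _ (Finset.erase_subset _ _)))
      (hvf.mono (Finset.insert_subset_insert _ (Finset.erase_subset _ _))))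
  rw [Finset.card_union_of_disjoint (by
    rw [Finset.disjoint_left]; intro v hv hv'; exact (mem_N.1 hv').1 hv)] at hZ
  have hsub : K.Es σ ⊆ (σ.powersetCard 2 ∪ (σ ×ˢ K.N σ).image (fun p => ({p.1, p.2} : Finset (Fin d → ℝ)))) ∪
      ((K.Es σ).filter fun e => e ⊆ K.N σ) := by
    intro e he
    have he2 := (mem_E.1 (mem_Es.1 he).1).1
    obtain ⟨p, q, hpq, rfl⟩ := Finset.card_eq_two.1 he2
    have hin : ∀ v ∈ ({p, q} : Finset (Fin d → ℝ)), v ∈ σ ∨ v ∈ K.N σ := by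
      intro v hv
      by_cases h : v ∈ σ
      · exact Or.inl h
      · exact Or.inr (mem_N.2 ⟨h, Es_V he hv⟩)
    rw [Finset.mem_union, Finset.mem_union, Finset.mem_powersetCard, Finset.mem_image, Finset.mem_filter]
    rcases hin p (by simp) with hpp | hpp <;> rcases hin q (by simp) with hqq | hqq
    · left; left
      refine ⟨?_, he2⟩
      intro z hz; simp only [Finset.mem_insert, Finset.mem_singleton] at hz
      rcases hz with rfl | rfl <;> assumption
    · left; right
      exact ⟨(p, q), Finset.mem_product.2 ⟨hpp, hqq⟩, rfl⟩
    · left; right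
      exact ⟨(q, p), Finset.mem_product.2 ⟨hqq, hpp⟩, Finset.pair_comm _ _⟩
    · right
      refine ⟨he, ?_⟩
      intro z hz; simp only [Finset.mem_insert, Finset.mem_singleton] at hz
      rcases hz with rfl | rfl <;> assumption
  have hA := Finset.card_le_card hsub
  have hA1 := Finset.card_union_le (σ.powersetCard 2 ∪ (σ ×ˢ K.N σ).image (fun p => ({p.1, p.2} : Finset (Fin d → ℝ))))
      ((K.Es σ).filter fun e => e ⊆ K.N σ)
  have hA2 := Finset.card_union_le (σ.powersetCard 2) ((σ ×ˢ K.N σ).image (fun p => ({p.1, p.2} : Finset (Fin d → ℝ))))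
  have hA3 : ((σ ×ˢ K.N σ).image (fun p => ({p.1, p.2} : Finset (Fin d → ℝ)))).card ≤ σ.card * (K.N σ).card := by
    refine Finset.card_image_le.trans ?_
    rw [Finset.card_product]
  have hA4 := link_deg (K := K) hσ
  rw [Finset.card_powersetCard] at hA2
  generalize (K.N σ).card = n at *
  generalize σ.card = s at *
  have hAA : (K.Es σ).card ≤ s.choose 2 + s * n + n := by omega
  have c1 := choose_two_sq s
  have c2 := choose_two_sq d
  generalize (K.Es σ).card = A at *
  generalize s.choose 2 = C1 at *
  generalize d.choose 2 = C2 at *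
  clear hA hA1 hA2 hA3 hA4 hc hcb hca
  have hd2 : d = s + 2 := by omega
  rw [hd2] at hZ c2
  nlinarith

lemma exists_big (hd : 3 ≤ d) {F0 : Finset (Fin d → ℝ)} (hF0 : K.Facet F0) :
    ∃ σ, σ.card + 2 = d ∧ K.Face σ ∧ 4 ≤ (K.N σ).card := by
  by_contra hcon
  push Not at hcon
  have hpiv : ∀ v ∈ F0, ∃ z, z ∉ F0 ∧ K.Facet (insert z (F0.erase v)) := fun v hv => CSP.Facet.pivot hF0 hv
  have huniq : ∀ v ∈ F0, ∀ w ∈ F0, v ≠ w → ∀ z z', z ∉ F0 → z' ∉ F0 → K.Facet (insert z (F0.erase v)) →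
      K.Facet (insert z' (F0.erase w)) → z = z' := by
    intro v hv w hw hvw z z' hz hz' h1 h2
    by_contra hzz
    set σ := (F0.erase v).erase w with hσ
    have hw' : w ∈ F0.erase v := Finset.mem_erase.2 ⟨Ne.symm hvw, hw⟩
    have hcard : σ.card + 2 = d := by
      have e1 := Finset.card_erase_add_one hv
      have e2 := Finset.card_erase_add_one hw'
      have := hF0.2; rw [hσ]; omega
    have hlt := hcon σ hcard (hF0.1.mono ((Finset.erase_subset _ _).trans (Finset.erase_subset _ _)))
    have hin : ({v, w, z, z'} : Finset (Fin d → ℝ)) ⊆ K.N σ := by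
      intro x hx
      simp only [Finset.mem_insert, Finset.mem_singleton] at hx
      rw [mem_N]
      rcases hx with rfl | rfl | rfl | rfl
      · refine ⟨by simp [hσ], hF0.1.mono ?_⟩
        intro y hy; simp only [hσ, Finset.mem_insert, Finset.mem_erase] at hy
        rcases hy with rfl | hy
        · exact hv
        · exact hy.2.2
      · refine ⟨by simp [hσ], hF0.1.mono ?_⟩
        intro y hy; simp only [hσ, Finset.mem_insert, Finset.mem_erase] at hy
        rcases hy with rfl | hy
        · exact hw
        · exact hy.2.2
      · refine ⟨by simp [hσ, hz], h1.1.mono ?_⟩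
        intro y hy; simp only [hσ, Finset.mem_insert, Finset.mem_erase] at *; tauto
      · refine ⟨by simp [hσ, hz'], h2.1.mono ?_⟩
        intro y hy; simp only [hσ, Finset.mem_insert, Finset.mem_erase] at *; tauto
    have hc4 : ({v, w, z, z'} : Finset (Fin d → ℝ)).card = 4 := by
      have hvz : v ≠ z := fun h => hz (h ▸ hv)
      have hvz' : v ≠ z' := fun h => hz' (h ▸ hv)
      have hwz : w ≠ z := fun h => hz (h ▸ hw)
      have hwz' : w ≠ z' := fun h => hz' (h ▸ hw)
      rw [Finset.card_insert_of_notMem (by simp [hvw, hvz, hvz']), Finset.card_insert_of_notMem (by simp [hwz, hwz']),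
        Finset.card_pair hzz]
    have := Finset.card_le_card hin
    omega
  obtain ⟨v0, hv0, w0, hw0, x0, hx0, hvw, hvx, hwx⟩ := Finset.two_lt_card.1 (show 2 < F0.card by rw [hF0.2]; omega)
  obtain ⟨z, hz, hzF⟩ := hpiv v0 hv0
  have hall : ∀ v ∈ F0, K.Facet (insert z (F0.erase v)) := by
    intro v hv
    by_cases h : v = v0
    · rw [h]; exact hzF
    · obtain ⟨z', hz', hzF'⟩ := hpiv v hv
      rw [huniq v0 hv0 v hv (Ne.symm h) z z' hz hz' hzF hzF']; exact hzF'
  have hcardG : (insert z F0).card = d + 1 := by rw [Finset.card_insert_of_notMem hz, hF0.2]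
  have hallG : ∀ a ∈ insert z F0, K.Facet ((insert z F0).erase a) := by
    intro a ha
    by_cases haz : a = z
    · rw [haz, Finset.erase_insert hz]; exact hF0
    · rw [Finset.erase_insert_of_ne (Ne.symm haz)]
      exact hall a ((Finset.mem_insert.1 ha).resolve_left haz)
  have hV : ∀ v ∈ K.V, v ∈ insert z F0 := by
    intro v hv
    obtain ⟨F, hvF, hF⟩ := (CSP.face_single hv).exists_facet
    refine CSP.conn hF0 (τ := ∅) (by simp) (fun F => F ⊆ insert z F0) ?_ (Finset.subset_insert _ _) F hF (by simp) (hvF (by simp))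
    intro F a a' hF _ ha _ ha' hF' hQ
    obtain ⟨c, hcG, hcF⟩ : ∃ c ∈ insert z F0, c ∉ F := by
      by_contra h; push Not at h
      have := Finset.card_le_card (fun x hx => h x hx : insert z F0 ⊆ F)
      have := hF.2; omega
    have hGa : insert c (F.erase a) = (insert z F0).erase a := by
      apply Finset.eq_of_subset_of_card_le
      · intro y hy
        rcases Finset.mem_insert.1 hy with rfl | hy
        · exact Finset.mem_erase.2 ⟨fun h => hcF (h ▸ ha), hcG⟩
        · exact Finset.mem_erase.2 ⟨(Finset.mem_erase.1 hy).1, hQ (Finset.mem_erase.1 hy).2⟩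
      · rw [Finset.card_insert_of_notMem (fun h => hcF (Finset.mem_of_mem_erase h)), Finset.card_erase_add_one ha, hF.2,
          Finset.card_erase_of_mem (hQ ha), hcardG]; omega
    have heq : a' = c := CSP.ridge (R := F.erase a) (a1 := a) (by rw [Finset.insert_erase ha]; exact hF) hF'
      (by rw [hGa]; exact hallG a (hQ ha))
      (by simp) (fun h => ha' (Finset.mem_of_mem_erase h)) (fun h => hcF (Finset.mem_of_mem_erase h))
      (fun h => ha' (h ▸ ha)) (fun h => hcF (h ▸ ha))
    intro y hy
    rcases Finset.mem_insert.1 hy with rfl | hy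
    · rw [heq]; exact hcG
    · exact hQ (Finset.mem_of_mem_erase hy)
  have hz1 : ∀ v ∈ F0, -v = z := by
    intro v hv
    exact (Finset.mem_insert.1 (hV _ (K.neg _ (hF0.1.mem hv)))).resolve_right (hF0.1.no_anti hv)
  exact hvw (neg_injective ((hz1 v0 hv0).trans (hz1 w0 hw0).symm))

lemma exists_good (hd : 4 ≤ d) (hc : K.E.card + 2 * d = d * K.V.card) (hp : K.Prm) {u : Fin d → ℝ} (hu : u ∈ K.V) :
    ∃ F, K.Facet F ∧ K.Good F := by
  obtain ⟨F0, _, hF0⟩ := (CSP.face_single hu).exists_facet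
  obtain ⟨σ, hσ, hf, h4⟩ := exists_big (by omega) hF0
  obtain ⟨a, ha, b, hb, hab⟩ := Finset.one_lt_card.1 (show 1 < σ.card by omega)
  obtain ⟨F, hσF, hF⟩ := hf.exists_facet
  refine ⟨F, hF, ?_⟩
  by_contra hng
  have hE : ∀ x ∈ σ, K.W (σ.erase x) = ∅ := by
    intro x hx
    by_contra h
    apply hng
    refine ⟨σ.erase x, (Finset.erase_subset _ _).trans hσF, ?_, Finset.nonempty_iff_ne_empty.2 h⟩
    have := Finset.card_erase_add_one hx; omega
  have := link_small hd hc hp hσ hf ha hb hab (hE b hb) (hE a ha)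
  omega
end PartF2
end CSLB

/-- Let `d ≥ 5` and let `P` be a prime cs simplicial `d`-polytope with
`g₂(P) = C(d,2) - d`. Then for every vertex `u`: (1) `u` and `-u` have exactly `2d - 2`
common neighbors; and (2) the graph of `st(u) ∪ st(-u)` is the whole graph of `∂P`:
every other vertex is adjacent to `u` or `-u`, and every edge extends by `u` or `-u`
to a face. -/
theorem stmt10 {d : ℕ} (hd : 5 ≤ d) (P : SPolytope d) (hp : IsPrimePoly P) (hcs : IsCS P)
    (hg2 : g2 P = (d.choose 2 : ℤ) - (d : ℤ)) (u : Fin d → ℝ) (hu : u ∈ P.V) :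
    ({v : Fin d → ℝ | v ∈ P.V ∧ Adj P u v ∧ Adj P (-u) v}.ncard = 2 * d - 2) ∧
    (∀ w ∈ P.V, w ≠ u → w ≠ -u → Adj P u w ∨ Adj P (-u) w) ∧
    (∀ e ∈ edgeFinset P, BFace P (insert u e) ∨ BFace P (insert (-u) e)) := by
  have hd1 : 1 ≤ d := by omega
  have hface := CSLB.face_iff hcs hd1
  set K := CSLB.toCSP P hcs hd1 with hK
  have hKV : K.V = P.V := rfl
  have hE : K.E = edgeFinset P := by
    ext e
    rw [CSLB.mem_E]
    unfold edgeFinset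
    rw [Finset.mem_filter, Finset.mem_powerset, hface]
    exact ⟨fun h => ⟨fun v hv => h.2.mem hv, h⟩, fun h => h.2⟩
  have hc : K.E.card + 2 * d = d * K.V.card := by
    unfold g2 f1 f0 at hg2
    rw [← hE, ← hKV] at hg2
    have h1 : (d + 1).choose 2 = d.choose 2 + d := by
      rw [Nat.choose_succ_succ' d 1, Nat.choose_one_right]; ring
    rw [h1] at hg2
    push_cast at hg2
    have : ((K.E.card : ℤ) + 2 * d) = d * K.V.card := by linarith
    exact_mod_cast this
  have hprm : K.Prm := by
    intro σ hσV hσ hsub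
    by_contra hcon
    apply hp
    refine ⟨σ, ⟨hσV, fun h => hcon ((hface σ).1 h), fun τ hτ => (hface τ).2 (hsub τ hτ)⟩, hσ⟩
  have huK : u ∈ K.V := hu
  obtain ⟨F, hF, hG⟩ := CSLB.exists_good (by omega) hc hprm huK
  obtain ⟨c1, c2, c3⟩ := CSLB.cross_concl (by omega) hc hprm hF hG huK
  obtain ⟨-, c2', -⟩ := CSLB.cross_concl (by omega) hc hprm hF hG (K.neg u huK)
  have hA1 : ∀ w ∈ P.V, w ≠ u → w ≠ -u → Adj P u w := fun w hw h1 h2 => ⟨Ne.symm h1, (hface _).2 (c2 w hw h1 h2)⟩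
  have hA2 : ∀ w ∈ P.V, w ≠ u → w ≠ -u → Adj P (-u) w := fun w hw h1 h2 =>
    ⟨Ne.symm h2, (hface _).2 (c2' w hw h2 (by rw [neg_neg]; exact h1))⟩
  refine ⟨?_, fun w hw h1 h2 => Or.inl (hA1 w hw h1 h2), ?_⟩
  · have hset : {v : Fin d → ℝ | v ∈ P.V ∧ Adj P u v ∧ Adj P (-u) v} = ((P.V.erase u).erase (-u) : Finset (Fin d → ℝ)) := by
      ext v
      simp only [Set.mem_ofPred_eq, Finset.coe_erase, Set.mem_sdiff, Set.mem_singleton_iff, Finset.mem_coe]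
      constructor
      · rintro ⟨h1, h2, h3⟩
        exact ⟨⟨h1, Ne.symm h2.1⟩, Ne.symm h3.1⟩
      · rintro ⟨⟨h1, h2⟩, h3⟩
        exact ⟨h1, hA1 v h1 h2 h3, hA2 v h1 h2 h3⟩
    rw [hset, Set.ncard_coe_finset, Finset.card_erase_of_mem, Finset.card_erase_of_mem hu]
    · rw [hKV] at c1; omega
    · exact Finset.mem_erase.2 ⟨Ne.symm (CSLB.CSP.V_ne_neg huK), K.neg u huK⟩
  · intro e he
    rw [hface, hface]
    apply c3
    rw [← hE, CSLB.mem_E] at he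
    exact he.2
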